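/- Let s, r satisfy s ≥ r, 2s − r > 3/2, and s > 3/4, and let ε > 0 be sufficiently small. Then for all Schwartz g-valued A, A' on ℝ^{1+3} one has ‖Λ_+^{−1} Λ_−^{ε−1} Q_0[A, A']‖_{G^r} ≲ ‖A‖_{F^s} ‖A'‖_{F^s}, where Q_0[u,v] = [∂_α u, ∂^α v]. -/

import Mathlib

noncomputable section

open MeasureTheory Complex
open scoped FourierTransform RealInnerProductSpace BigOperators

/-! ## Basic setup: space-time `ℝ^{1+3}` and Fourier analytic toolbox -/

/-- Space-time `ℝ^{1+3}` (used both for physical points `(t,x)` and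
Fourier variables `(τ,ξ)`); coordinate `0` is time. -/
abbrev SpaceTime : Type := EuclideanSpace ℝ (Fin 4)

/-- Space `ℝ³`. -/
abbrev Space : Type := EuclideanSpace ℝ (Fin 3)

/-- The spatial part of a space-time point / frequency. -/
def spt (z : SpaceTime) : Space := (WithLp.equiv 2 (Fin 3 → ℝ)).symm fun i => z i.succ

/-- The space-time point `(t, x)`. -/
def stpt (t : ℝ) (x : Space) : SpaceTime :=
  (WithLp.equiv 2 (Fin 4 → ℝ)).symm fun μ => Fin.cases t (fun i => x i) μ

/-- Japanese bracket `⟨x⟩ = (1+x²)^{1/2}`. -/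
def jap (x : ℝ) : ℝ := Real.sqrt (1 + x ^ 2)

/-- The sign `±1` encoded by a boolean (`true ↦ +1`). -/
def sgnv (sg : Bool) : ℝ := if sg then 1 else -1

/-- Minkowski metric coefficient `η^{μμ}`, used to raise indices. -/
def mink (μ : Fin 4) : ℝ := if μ = 0 then -1 else 1

section Ops

variable {E : Type*} [NormedAddCommGroup E] [NormedSpace ℂ E]

/-- Space-time Fourier transform. -/
def FT (u : SpaceTime → E) : SpaceTime → E := fun ζ => 𝓕 u ζ

/-- Inverse space-time Fourier transform. -/
def FTinv (u : SpaceTime → E) : SpaceTime → E := fun x => 𝓕⁻ u x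

/-- Spatial Fourier transform. -/
def FT3 (u : Space → E) : Space → E := fun ξ => 𝓕 u ξ

/-- Inverse spatial Fourier transform. -/
def FT3inv (u : Space → E) : Space → E := fun x => 𝓕⁻ u x

/-- Weighted `L²`-norm (on the Fourier side). -/
def wnorm (w : SpaceTime → ℝ) (f : SpaceTime → E) : ℝ := (∫ ζ, (w ζ * ‖f ζ‖) ^ 2) ^ ((1:ℝ)/2)

/-- Finiteness of the weighted `L²`-norm. -/
def wfin (w : SpaceTime → ℝ) (f : SpaceTime → E) : Prop :=
  MeasureTheory.HasFiniteIntegral (fun ζ => (w ζ * ‖f ζ‖) ^ 2) volume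

/-- The weight of the wave-Sobolev space `H^{s,b}`. -/
def hWt (s b : ℝ) (ζ : SpaceTime) : ℝ := jap ‖spt ζ‖ ^ s * jap (|ζ 0| - ‖spt ζ‖) ^ b

/-- The weight of the space `X^{s,b}_±`. -/
def xWt (sg : Bool) (s b : ℝ) (ζ : SpaceTime) : ℝ :=
  jap ‖spt ζ‖ ^ s * jap (-(ζ 0) + sgnv sg * ‖spt ζ‖) ^ b

/-- The norm of the wave-Sobolev space `H^{s,b}`:
`‖u‖ = ‖⟨ξ⟩^s ⟨|τ|-|ξ|⟩^b ũ(τ,ξ)‖_{L²}`. -/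
def HsbNorm (s b : ℝ) (u : SpaceTime → E) : ℝ := wnorm (hWt s b) (FT u)

/-- Membership (finiteness of the norm) for `H^{s,b}`. -/
def HsbFin (s b : ℝ) (u : SpaceTime → E) : Prop := wfin (hWt s b) (FT u)

/-- The norm of `X^{s,b}_±` : `‖u‖ = ‖⟨ξ⟩^s ⟨-τ ± |ξ|⟩^b ũ(τ,ξ)‖_{L²}`. -/
def XsbNorm (sg : Bool) (s b : ℝ) (u : SpaceTime → E) : ℝ := wnorm (xWt sg s b) (FT u)

/-- Membership (finiteness of the norm) for `X^{s,b}_±`. -/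
def XsbFin (sg : Bool) (s b : ℝ) (u : SpaceTime → E) : Prop := wfin (xWt sg s b) (FT u)

/-- Fourier multiplier with (complex) symbol `m`. -/
def mult (m : SpaceTime → ℂ) (u : SpaceTime → E) : SpaceTime → E := FTinv fun ζ => m ζ • FT u ζ

/-- Fourier multiplier with real symbol `m`. -/
def rmult (m : SpaceTime → ℝ) (u : SpaceTime → E) : SpaceTime → E := mult (fun ζ => (m ζ : ℂ)) u

/-- `Λ^α`, the multiplier with symbol `⟨ξ⟩^α`. -/
def Lam (α : ℝ) (u : SpaceTime → E) : SpaceTime → E := rmult (fun ζ => jap ‖spt ζ‖ ^ α) u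

/-- `Λ₊^α`, the multiplier with symbol `⟨|τ|+|ξ|⟩^α`. -/
def LamPlus (α : ℝ) (u : SpaceTime → E) : SpaceTime → E := rmult (fun ζ => jap (|ζ 0| + ‖spt ζ‖) ^ α) u

/-- `Λ₋^α`, the multiplier with symbol `⟨|τ|-|ξ|⟩^α`. -/
def LamMinus (α : ℝ) (u : SpaceTime → E) : SpaceTime → E := rmult (fun ζ => jap (|ζ 0| - ‖spt ζ‖) ^ α) u

/-- `D^α`, the multiplier with symbol `|ξ|^α`. -/
def Dop (α : ℝ) (u : SpaceTime → E) : SpaceTime → E := rmult (fun ζ => ‖spt ζ‖ ^ α) u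

/-- `D₊^α`, the multiplier with symbol `(|τ|+|ξ|)^α`. -/
def DPlus (α : ℝ) (u : SpaceTime → E) : SpaceTime → E := rmult (fun ζ => (|ζ 0| + ‖spt ζ‖) ^ α) u

/-- `D₋^α`, the multiplier with symbol `||τ|-|ξ||^α`. -/
def DMinus (α : ℝ) (u : SpaceTime → E) : SpaceTime → E := rmult (fun ζ => |(|ζ 0| - ‖spt ζ‖)| ^ α) u

/-- `|∇|`, the multiplier with symbol `|ξ|`. -/
def absNabla (u : SpaceTime → E) : SpaceTime → E := Dop 1 u

/-- The partial derivative `∂_μ` on space-time. -/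
def pd (μ : Fin 4) (u : SpaceTime → E) : SpaceTime → E := fun x => fderiv ℝ u x (EuclideanSpace.single μ 1)

/-- The spatial partial derivative `∂_i` on `ℝ³`. -/
def pd3 (i : Fin 3) (u : Space → E) : Space → E := fun x => fderiv ℝ u x (EuclideanSpace.single i 1)

/-- The (inhomogeneous) Riesz transform `R_j = Λ^{-1} ∂_j`. -/
def Riesz (j : Fin 3) (u : SpaceTime → E) : SpaceTime → E := Lam (-1) (pd j.succ u)

/-- The d'Alembertian `□ = ∂_t² - Δ`. -/
def box (u : SpaceTime → E) : SpaceTime → E :=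
  fun x => pd 0 (pd 0 u) x - ∑ j : Fin 3, pd j.succ (pd j.succ u) x

/-- The `F^s` norm, `‖u‖_{F^s} = ‖Λ₊ u‖_{H^{s-1,3/4+ε}}`. -/
def FsNorm (ε s : ℝ) (u : SpaceTime → E) : ℝ := HsbNorm (s - 1) (3/4 + ε) (LamPlus 1 u)

/-- Membership in `F^s`. -/
def FsFin (ε s : ℝ) (u : SpaceTime → E) : Prop := HsbFin (s - 1) (3/4 + ε) (LamPlus 1 u)

/-- The `G^r` norm, `‖v‖_{G^r} = ‖Λ₊ v‖_{H^{r-1,1/2+ε}}`. -/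
def GrNorm (ε r : ℝ) (v : SpaceTime → E) : ℝ := HsbNorm (r - 1) (1/2 + ε) (LamPlus 1 v)

/-- Membership in `G^r`. -/
def GrFin (ε r : ℝ) (v : SpaceTime → E) : Prop := HsbFin (r - 1) (1/2 + ε) (LamPlus 1 v)

/-- The time slab `[0,T] × ℝ³`. -/
def slab (T : ℝ) : Set SpaceTime := {x | x 0 ∈ Set.Icc 0 T}

/-- `u` belongs to the restriction to `[0,T]` of the space with defining predicate `P`:
it has an extension lying in that space. -/
def MemRestrict (P : (SpaceTime → E) → Prop) (T : ℝ) (u : SpaceTime → E) : Prop :=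
  ∃ U : SpaceTime → E, P U ∧ Set.EqOn U u (slab T)

/-- The spatial Sobolev `H^s(ℝ³)` norm. -/
def HNorm (s : ℝ) (f : Space → E) : ℝ :=
  (∫ ξ, (jap ‖ξ‖ ^ s * ‖FT3 f ξ‖) ^ 2) ^ ((1:ℝ)/2)

/-- Membership in the spatial Sobolev space `H^s(ℝ³)`. -/
def MemHs (s : ℝ) (f : Space → E) : Prop :=
  MeasureTheory.HasFiniteIntegral (fun ξ => (jap ‖ξ‖ ^ s * ‖FT3 f ξ‖) ^ 2) volume

/-- Continuity with values in `H^s` on the time interval `[0,T]` (for a space-time function). -/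
def ContHsOn (s T : ℝ) (u : SpaceTime → E) : Prop :=
  (∀ t ∈ Set.Icc (0:ℝ) T, MemHs s fun ξ => u (stpt t ξ)) ∧
  ∀ t ∈ Set.Icc (0:ℝ) T,
    Filter.Tendsto (fun t' => HNorm s fun ξ => u (stpt t' ξ) - u (stpt t ξ))
      (nhdsWithin t (Set.Icc 0 T)) (nhds 0)

end Ops

/-- The angle weight `|∠(±₁ξ₁, ±₂ξ₂)|`. -/
def angleWt (sg1 sg2 : Bool) (η θ : SpaceTime) : ℝ :=
  |InnerProductGeometry.angle (sgnv sg1 • spt η) (sgnv sg2 • spt θ)|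

/-- The bilinear null-form operator `B_{±₁,±₂}`, defined by its space-time Fourier transform
`𝓕(B(u,v))(ζ) = ∫ |∠(±₁ξ₁, ±₂ξ₂)| ũ(ζ₁) ṽ(ζ-ζ₁) dζ₁`. -/
def Bop (sg1 sg2 : Bool) (u v : SpaceTime → ℂ) : SpaceTime → ℂ :=
  FTinv fun ζ => ∫ η, (angleWt sg1 sg2 η (ζ - η) : ℂ) * FT u η * FT v (ζ - η)

/-! ## Null forms -/

/-- The null form `Q₀(u,v) = ∂_α u ∂^α v`. -/
def Q0f (u v : SpaceTime → ℂ) : SpaceTime → ℂ := fun x => ∑ μ : Fin 4, mink μ • (pd μ u x * pd μ v x)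

/-- The null form `Q_{αβ}(u,v) = ∂_α u ∂_β v - ∂_β u ∂_α v`. -/
def Qf (α β : Fin 4) (u v : SpaceTime → ℂ) : SpaceTime → ℂ :=
  fun x => pd α u x * pd β v x - pd β u x * pd α v x

/-! ## Matrix-valued (Lie algebra) objects -/

/-- `n×n` complex matrices, the ambient space of `su(n,ℂ)`. -/
abbrev G (n : ℕ) : Type := Matrix (Fin n) (Fin n) ℂ

attribute [local instance] Matrix.frobeniusNormedAddCommGroup Matrix.frobeniusNormedSpace

/-- Membership in the Lie algebra `su(n,ℂ)` (trace-free skew-hermitian matrices). -/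
def IsSu {n : ℕ} (X : G n) : Prop := X.conjTranspose = -X ∧ X.trace = 0

/-- The matrix commutator `[X,Y] = XY - YX`. -/
def mcomm {n : ℕ} (X Y : G n) : G n := X * Y - Y * X

/-- The commutator null form `Q_{αβ}[u,v] = [∂_α u, ∂_β v] - [∂_β u, ∂_α v]`. -/
def Qc {n : ℕ} (α β : Fin 4) (u v : SpaceTime → G n) : SpaceTime → G n :=
  fun x => mcomm (pd α u x) (pd β v x) - mcomm (pd β u x) (pd α v x)

/-- The commutator null form `Q₀[u,v] = [∂_α u, ∂^α v]`. -/
def Q0c {n : ℕ} (u v : SpaceTime → G n) : SpaceTime → G n :=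
  fun x => ∑ μ : Fin 4, mink μ • mcomm (pd μ u x) (pd μ v x)

/-! ## Dirac operators -/

/-- The spinor space `ℂ⁴`. -/
abbrev C4 : Type := EuclideanSpace ℂ (Fin 4)

/-- A `4×4` matrix acting on `ℂ⁴`. -/
def matAct (M : Matrix (Fin 4) (Fin 4) ℂ) (v : C4) : C4 :=
  (WithLp.equiv 2 (Fin 4 → ℂ)).symm (M.mulVec ((WithLp.equiv 2 (Fin 4 → ℂ)) v))

/-- The Dirac matrices `α^0 = I`, `α^j = ((0,σ^j),(σ^j,0))`. -/
def alphaMat : Fin 4 → Matrix (Fin 4) (Fin 4) ℂ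
  | 0 => 1
  | 1 => !![0,0,0,1; 0,0,1,0; 0,1,0,0; 1,0,0,0]
  | 2 => !![0,0,0,-I; 0,0,I,0; 0,-I,0,0; I,0,0,0]
  | 3 => !![0,0,1,0; 0,0,0,-1; 1,0,0,0; 0,-1,0,0]

/-- Matrix-symbol Fourier multiplier on spinor fields (space-time). -/
def multM (m : SpaceTime → Matrix (Fin 4) (Fin 4) ℂ) (u : SpaceTime → C4) : SpaceTime → C4 :=
  FTinv fun ζ => matAct (m ζ) (FT u ζ)

/-- Matrix-symbol Fourier multiplier on spinor fields (space). -/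
def multM3 (m : Space → Matrix (Fin 4) (Fin 4) ℂ) (u : Space → C4) : Space → C4 :=
  FT3inv fun ξ => matAct (m ξ) (FT3 u ξ)

/-- The symbol `Π(±ξ) = ½(I ± ξ_j α^j / |ξ|)` of the Dirac projections. -/
def PiSymb (sg : Bool) (ξ : Space) : Matrix (Fin 4) (Fin 4) ℂ :=
  (2⁻¹ : ℂ) • (1 + ∑ j : Fin 3, ((sgnv sg * ξ j / ‖ξ‖ : ℝ) : ℂ) • alphaMat j.succ)

/-- The Dirac projection `Π_± = Π_±(∇/i)` (space-time version). -/
def PiProj (sg : Bool) (u : SpaceTime → C4) : SpaceTime → C4 := multM (fun ζ => PiSymb sg (spt ζ)) u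

/-- The Dirac projection `Π_± = Π_±(∇/i)` acting on functions of the space variable. -/
def PiProj3 (sg : Bool) (u : Space → C4) : Space → C4 := multM3 (fun ξ => PiSymb sg ξ) u

open scoped ENNReal

lemma lintegral_euclideanSpace {m : ℕ} (f : EuclideanSpace ℝ (Fin m) → ℝ≥0∞) :
    ∫⁻ x, f x = ∫⁻ p : Fin m → ℝ, f (WithLp.toLp 2 p) := by
  have h := (EuclideanSpace.volume_preserving_symm_measurableEquiv_toLp (Fin m)).symm
  exact (h.lintegral_comp_emb (MeasurableEquiv.measurableEmbedding _) f).symm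

lemma lintegral_pi_succ {m : ℕ} (f : (Fin (m + 1) → ℝ) → ℝ≥0∞) (hf : Measurable f) :
    ∫⁻ x, f x = ∫⁻ t : ℝ, ∫⁻ p : Fin m → ℝ, f (Fin.cons t p) := by
  have h := (volume_preserving_piFinSuccAbove (fun _ : Fin (m + 1) => ℝ) 0).symm
  rw [← h.lintegral_comp_emb (MeasurableEquiv.measurableEmbedding _) f]
  have hm : Measurable fun a : ℝ × (Fin m → ℝ) =>
      f ((MeasurableEquiv.piFinSuccAbove (fun _ : Fin (m + 1) => ℝ) 0).symm a) :=
    hf.comp (MeasurableEquiv.measurable _)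
  rw [Measure.volume_eq_prod, lintegral_prod _ hm.aemeasurable]
  refine lintegral_congr fun t => lintegral_congr fun p => ?_
  congr 1
  simp [MeasurableEquiv.piFinSuccAbove, Fin.insertNthEquiv]

lemma lintegral_spaceTime (f : SpaceTime → ℝ≥0∞) (hf : Measurable f) :
    ∫⁻ z, f z = ∫⁻ t : ℝ, ∫⁻ x : Space, f (stpt t x) := by
  rw [lintegral_euclideanSpace,
    lintegral_pi_succ (fun p => f (WithLp.toLp 2 p)) (hf.comp (by fun_prop))]
  refine lintegral_congr fun t => ?_
  rw [lintegral_euclideanSpace]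
  refine lintegral_congr fun p => ?_
  congr 1

@[simp] lemma stpt_zero (t : ℝ) (x : Space) : stpt t x 0 = t := rfl
@[simp] lemma spt_stpt (t : ℝ) (x : Space) : spt (stpt t x) = x := rfl

lemma spt_add (x y : SpaceTime) : spt (x + y) = spt x + spt y := rfl
lemma spt_sub (x y : SpaceTime) : spt (x - y) = spt x - spt y := rfl
lemma spt_neg (x : SpaceTime) : spt (-x) = -spt x := rfl

@[fun_prop] lemma continuous_spt : Continuous spt := by
  unfold spt
  exact (PiLp.continuous_toLp 2 _).comp (by fun_prop)

@[fun_prop] lemma measurable_spt : Measurable spt := continuous_spt.measurable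

@[fun_prop] lemma continuous_stpt : Continuous fun p : ℝ × Space => stpt p.1 p.2 := by
  unfold stpt
  refine (PiLp.continuous_toLp 2 _).comp (continuous_pi fun μ => ?_)
  refine Fin.cases ?_ (fun i => ?_) μ
  · simpa using continuous_fst
  · simp only [Fin.cases_succ]; fun_prop

@[fun_prop] lemma Measurable.stpt {α : Type*} [MeasurableSpace α] {f : α → ℝ} {g : α → Space}
    (hf : Measurable f) (hg : Measurable g) : Measurable fun a => stpt (f a) (g a) :=
  continuous_stpt.measurable.comp (hf.prodMk hg)

lemma lintegral_space (f : Space → ℝ≥0∞) (hf : Measurable f) :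
    ∫⁻ x, f x = ∫⁻ a : ℝ, ∫⁻ p : ℝ × ℝ, f !₂[a, p.1, p.2] := by
  rw [lintegral_euclideanSpace,
    lintegral_pi_succ (fun p => f (WithLp.toLp 2 p)) (hf.comp (by fun_prop))]
  refine lintegral_congr fun t => ?_
  rw [← (volume_preserving_finTwoArrow ℝ).symm.lintegral_comp_emb
    (MeasurableEquiv.measurableEmbedding _)]
  refine lintegral_congr fun p => ?_
  congr 1

lemma lintegral_Ioi_sq (g : ℝ → ℝ≥0∞) : ∫⁻ m in Set.Ioi (0:ℝ), g m =
    ∫⁻ x in Set.Ioi (0:ℝ), ENNReal.ofReal |2 * x| * g (x ^ 2) := by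
  have him : (fun x : ℝ => x ^ 2) '' Set.Ioi 0 = Set.Ioi 0 := by
    ext y
    constructor
    · rintro ⟨x, hx, rfl⟩; exact pow_pos (Set.mem_Ioi.1 hx) 2
    · intro hy
      exact ⟨√y, Real.sqrt_pos.2 hy, Real.sq_sqrt (le_of_lt hy)⟩
  conv_lhs => rw [← him]
  refine lintegral_image_eq_lintegral_abs_deriv_mul measurableSet_Ioi (f' := fun x => 2 * x)
    (fun x _ => ?_) ?_ g
  · simpa using (hasDerivAt_pow 2 x).hasDerivWithinAt
  · intro x hx y hy h
    exact (pow_left_inj₀ (le_of_lt hx) (le_of_lt hy) two_ne_zero).1 h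

/-- Integration in polar coordinates of a function of `a ^ 2 + b ^ 2`. -/
lemma lintegral_radial_plane (g : ℝ → ℝ≥0∞) (hg : Measurable g) :
    ∫⁻ p : ℝ × ℝ, g (p.1 ^ 2 + p.2 ^ 2) = ENNReal.ofReal Real.pi * ∫⁻ m in Set.Ioi (0:ℝ), g m := by
  rw [← lintegral_comp_polarCoord_symm]
  simp only [polarCoord_target, polarCoord_symm_apply]
  have : ∀ p : ℝ × ℝ, (p.1 * Real.cos p.2) ^ 2 + (p.1 * Real.sin p.2) ^ 2 = p.1 ^ 2 := by
    intro p
    have := Real.sin_sq_add_cos_sq p.2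
    linear_combination p.1 ^ 2 * this
  simp only [this]
  rw [Measure.volume_eq_prod, ← Measure.prod_restrict, lintegral_prod _ (by fun_prop), lintegral_Ioi_sq g]
  simp only [lintegral_const, smul_eq_mul, Measure.restrict_apply MeasurableSet.univ, Set.univ_inter, Real.volume_Ioo]
  rw [lintegral_mul_const _ (by fun_prop), mul_comm,
    ← lintegral_const_mul _ (by fun_prop), ← lintegral_const_mul _ (by fun_prop)]
  refine setLIntegral_congr_fun measurableSet_Ioi fun x hx => ?_
  have hx : (0:ℝ) < x := hx
  rw [← mul_assoc, ← mul_assoc, ← ENNReal.ofReal_mul (by linarith [Real.pi_pos]),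
    ← ENNReal.ofReal_mul Real.pi_pos.le, abs_of_pos (by linarith)]
  congr 2
  ring

/-- For an integrand depending only on `|y|` and `|x - y|`, integration over `ℝ³` is controlled by
integration in the two radii. -/
lemma lintegral_bipolar_le (g : ℝ → ℝ → ℝ≥0∞) (hg : Measurable (Function.uncurry g)) (x : Space)
    (hx : x ≠ 0) :
    ∫⁻ y : Space, g ‖y‖ ‖x - y‖ ≤ ENNReal.ofReal (Real.pi / (2 * ‖x‖)) *
      ∫⁻ u in Set.Ioi (0:ℝ), ∫⁻ v in Set.Ioi (0:ℝ), g √u √v := by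
  set R := ‖x‖ with hR
  have hRp : 0 < R := norm_pos_iff.2 hx
  set e : Space := !₂[R, 0, 0] with he
  have hen : ‖e‖ = R := by
    simp [he, EuclideanSpace.norm_eq, Fin.sum_univ_three, Real.sqrt_sq hRp.le]
  obtain ⟨T, hT⟩ : ∃ T : Space ≃ₗᵢ[ℝ] Space, T e = x := by
    refine ⟨(ℝ ∙ (e - x))ᗮ.reflection, Submodule.reflection_sub (by rw [hen])⟩
  have h1 : ∫⁻ y : Space, g ‖y‖ ‖x - y‖ = ∫⁻ y : Space, g ‖y‖ ‖e - y‖ := by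
    rw [← T.measurePreserving.lintegral_comp_emb T.toHomeomorph.measurableEmbedding]
    refine lintegral_congr fun y => ?_
    rw [← hT, ← map_sub, T.norm_map, T.norm_map]
  have hg' : ∀ (α : Type) [MeasurableSpace α] (a b : α → ℝ), Measurable a → Measurable b →
      Measurable fun z => g (a z) (b z) := fun α _ a b ha hb => hg.comp (ha.prodMk hb)
  rw [h1, lintegral_space _ (hg' _ _ _ (by fun_prop) (by fun_prop))]
  have h2 : ∀ a : ℝ, ∫⁻ p : ℝ × ℝ, g ‖!₂[a, p.1, p.2]‖ ‖e - !₂[a, p.1, p.2]‖ =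
      ENNReal.ofReal Real.pi * ∫⁻ u, (Set.Ioi (a ^ 2)).indicator
        (fun u => g √u √(u + R ^ 2 - 2 * R * a)) u := by
    intro a
    have : ∀ p : ℝ × ℝ, g ‖!₂[a, p.1, p.2]‖ ‖e - !₂[a, p.1, p.2]‖ =
        (fun m => g √(a ^ 2 + m) √((a - R) ^ 2 + m)) (p.1 ^ 2 + p.2 ^ 2) := by
      intro p
      simp only [EuclideanSpace.norm_eq, Fin.sum_univ_three, he]
      simp only [Real.norm_eq_abs, sq_abs]
      congr 2
      · simp; ring
      · simp; ring
    simp only [this]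
    rw [lintegral_radial_plane (fun m => g √(a ^ 2 + m) √((a - R) ^ 2 + m))
      (hg' _ _ _ (by fun_prop) (by fun_prop))]
    congr 1
    rw [← lintegral_indicator measurableSet_Ioi]
    rw [← lintegral_sub_right_eq_self _ (a ^ 2)]
    refine lintegral_congr fun u => ?_
    simp only [Set.indicator, Set.mem_Ioi, sub_pos]
    congr 3
    · ring
    · ring
  simp only [h2]
  have hmeas : Measurable fun p : ℝ × ℝ => (Set.Ioi (p.1 ^ 2)).indicator
        (fun u => g √u √(u + R ^ 2 - 2 * R * p.1)) p.2 := by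
    have : (fun p : ℝ × ℝ => (Set.Ioi (p.1 ^ 2)).indicator
        (fun u => g √u √(u + R ^ 2 - 2 * R * p.1)) p.2) = {p : ℝ × ℝ | p.1 ^ 2 < p.2}.indicator
        (fun p => g √p.2 √(p.2 + R ^ 2 - 2 * R * p.1)) := by
      ext p; simp [Set.indicator]
    rw [this]
    exact (hg' _ _ _ (by fun_prop) (by fun_prop)).indicator
      (measurableSet_lt (by fun_prop) (by fun_prop))
  rw [lintegral_const_mul _ hmeas.lintegral_prod_right', lintegral_lintegral_swap hmeas.aemeasurable]
  have h3 : ∀ u : ℝ, ∫⁻ a, (Set.Ioi (a ^ 2)).indicator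
        (fun u => g √u √(u + R ^ 2 - 2 * R * a)) u ≤ (Set.Ioi (0:ℝ)).indicator (fun u =>
          ENNReal.ofReal (1 / (2 * R)) * ∫⁻ v in Set.Ioi (0:ℝ), g √u √v) u := by
    intro u
    by_cases hu : 0 < u
    · have : ∀ a, (Set.Ioi (a ^ 2)).indicator (fun u => g √u √(u + R ^ 2 - 2 * R * a)) u ≤
          (Set.Ioi (0:ℝ)).indicator (fun v => g √u √v) (u + R ^ 2 - 2 * R * a) := by
        intro a
        simp only [Set.indicator, Set.mem_Ioi]
        split_ifs with h4 h5
        · exact le_rfl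
        · nlinarith [sq_nonneg (a - R)]
        · exact zero_le
        · exact zero_le
      refine (lintegral_mono this).trans ?_
      rw [Set.indicator_of_mem (by exact hu), ← lintegral_indicator measurableSet_Ioi]
      have hl : ∀ F : ℝ → ℝ≥0∞, ∫⁻ a, F (u + R ^ 2 - 2 * R * a) =
          ENNReal.ofReal (1 / (2 * R)) * ∫⁻ v, F v := by
        intro F
        have := lintegral_image_eq_lintegral_abs_deriv_mul (s := Set.univ)
          (f := fun a => u + R ^ 2 - 2 * R * a) (f' := fun _ => - (2 * R)) MeasurableSet.univ
          (fun a _ => by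
            simpa using ((hasDerivAt_id a).const_mul (2 * R)).const_sub (u + R ^ 2))
          (fun a _ b _ h => by
            have h : u + R ^ 2 - 2 * R * a = u + R ^ 2 - 2 * R * b := h
            exact mul_left_cancel₀ (by positivity : 2 * R ≠ 0) (by linarith)) F
        have him : (fun a => u + R ^ 2 - 2 * R * a) '' Set.univ = Set.univ := by
          rw [Set.image_univ]
          refine Set.range_eq_univ.2 fun v => ⟨(u + R ^ 2 - v) / (2 * R), ?_⟩
          field_simp
          ring
        rw [him] at this
        simp only [Measure.restrict_univ, abs_neg] at this
        rw [this, lintegral_const_mul' _ _ ENNReal.ofReal_ne_top, ← mul_assoc,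
          ← ENNReal.ofReal_mul (by positivity), abs_of_pos (by positivity)]
        rw [one_div_mul_cancel (by positivity), ENNReal.ofReal_one, one_mul]
      exact (hl _).le
    · have : ∀ a, (Set.Ioi (a ^ 2)).indicator (fun u => g √u √(u + R ^ 2 - 2 * R * a)) u = 0 := by
        intro a
        refine Set.indicator_of_notMem ?_ _
        simp only [Set.mem_Ioi, not_lt]
        nlinarith
      simp [this]
  refine (mul_le_mul_right (lintegral_mono h3) _).trans ?_
  rw [lintegral_indicator measurableSet_Ioi, lintegral_const_mul' _ _ ENNReal.ofReal_ne_top,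
    ← mul_assoc, ← ENNReal.ofReal_mul Real.pi_pos.le]
  refine le_of_eq ?_
  congr 2
  field_simp

@[fun_prop] lemma continuous_jap : Continuous jap := by unfold jap; fun_prop

@[fun_prop] lemma measurable_jap : Measurable jap := continuous_jap.measurable

lemma one_le_jap (x : ℝ) : 1 ≤ jap x := by
  unfold jap
  rw [Real.one_le_sqrt]
  nlinarith [sq_nonneg x]

lemma jap_pos (x : ℝ) : 0 < jap x := lt_of_lt_of_le one_pos (one_le_jap x)

lemma jap_sq (x : ℝ) : jap x ^ 2 = 1 + x ^ 2 := Real.sq_sqrt (by positivity)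

@[simp] lemma jap_neg (x : ℝ) : jap (-x) = jap x := by simp [jap]

lemma abs_le_jap (x : ℝ) : |x| ≤ jap x := by
  unfold jap
  exact Real.abs_le_sqrt (by linarith)

lemma jap_le_one_add (x : ℝ) : jap x ≤ 1 + |x| := by
  unfold jap
  rw [Real.sqrt_le_left (by positivity)]
  nlinarith [abs_nonneg x, sq_abs x]

lemma jap_le_jap {x y : ℝ} (h : |x| ≤ |y|) : jap x ≤ jap y := by
  unfold jap
  exact Real.sqrt_le_sqrt (by linarith [sq_le_sq.2 h])

lemma jap_add_le (x y : ℝ) : jap (x + y) ≤ jap x + |y| := by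
  have h1 := jap_sq x
  have h2 := abs_le_jap x
  have h3 := jap_pos x
  unfold jap at *
  rw [Real.sqrt_le_left (by positivity)]
  nlinarith [abs_nonneg y, sq_abs y, le_abs_self (x * y), abs_mul x y, abs_nonneg x]

lemma jap_add_le' (x y : ℝ) : jap (x + y) ≤ jap x + jap y :=
  (jap_add_le x y).trans (by linarith [abs_le_jap y])

/-- The `ℝ≥0∞`-valued weight `⟨x⟩ ^ (-β)`. -/
def japE (β x : ℝ) : ℝ≥0∞ := ENNReal.ofReal (jap x ^ (-β))

@[fun_prop] lemma measurable_japE (β : ℝ) : Measurable (japE β) := by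
  unfold japE
  fun_prop

lemma japE_neg (β x : ℝ) : japE β (-x) = japE β x := by simp [japE]

lemma japE_le_one {β : ℝ} (hβ : 0 ≤ β) (x : ℝ) : japE β x ≤ 1 := by
  unfold japE
  rw [← ENNReal.ofReal_one]
  exact ENNReal.ofReal_le_ofReal (Real.rpow_le_one_of_one_le_of_nonpos (one_le_jap x) (by linarith))

lemma japE_add (β γ x : ℝ) : japE (β + γ) x = japE β x * japE γ x := by
  unfold japE
  rw [← ENNReal.ofReal_mul (Real.rpow_nonneg (jap_pos x).le _), ← Real.rpow_add (jap_pos x)]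
  congr 2
  ring

lemma ofReal_abs_mul_japE (β x : ℝ) : ENNReal.ofReal |x| * japE (1 + β) x ≤ japE β x := by
  rw [japE_add, ← mul_assoc]
  conv_rhs => rw [← one_mul (japE β x)]
  gcongr
  unfold japE
  rw [← ENNReal.ofReal_mul (abs_nonneg x), ← ENNReal.ofReal_one]
  refine ENNReal.ofReal_le_ofReal ?_
  rw [Real.rpow_neg_one, ← div_eq_mul_inv, div_le_one (jap_pos x)]
  exact abs_le_jap x

lemma lintegral_japE_norm_lt_top {m : ℕ} {β : ℝ} (hβ : (m : ℝ) < β) :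
    ∫⁻ x : EuclideanSpace ℝ (Fin m), japE β ‖x‖ < ∞ := by
  have h := integrable_rpow_neg_one_add_norm_sq (E := EuclideanSpace ℝ (Fin m)) (μ := volume)
    (r := β) (by simpa using hβ)
  have h2 := h.lintegral_lt_top
  refine lt_of_eq_of_lt (lintegral_congr fun x => ?_) h2
  unfold japE jap
  rw [Real.sqrt_eq_rpow, ← Real.rpow_mul (by positivity)]
  congr 2
  ring

lemma lintegral_japE_lt_top {β : ℝ} (hβ : 1 < β) : ∫⁻ x : ℝ, japE β x < ∞ := by
  have h := integrable_rpow_neg_one_add_norm_sq (E := ℝ) (μ := volume)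
    (r := β) (by simpa using hβ)
  have h2 := h.lintegral_lt_top
  refine lt_of_eq_of_lt (lintegral_congr fun x => ?_) h2
  unfold japE jap
  rw [Real.sqrt_eq_rpow, ← Real.rpow_mul (by positivity), Real.norm_eq_abs, sq_abs]
  congr 2
  ring

lemma lintegral_japE_sub (β a : ℝ) : ∫⁻ x : ℝ, japE β (x - a) = ∫⁻ x : ℝ, japE β x :=
  lintegral_sub_right_eq_self (japE β) a

lemma lintegral_japE_sub_left (β a : ℝ) : ∫⁻ x : ℝ, japE β (a - x) = ∫⁻ x : ℝ, japE β x :=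
  lintegral_sub_left_eq_self (japE β) a

lemma japE_abs_sub_le (β t ρ : ℝ) : japE β (|t| - ρ) ≤ japE β (t - ρ) + japE β (t + ρ) := by
  rcases abs_cases t with ⟨h, _⟩ | ⟨h, _⟩
  · rw [h]; exact le_self_add
  · rw [h, ← japE_neg, neg_sub, sub_neg_eq_add, add_comm ρ]; exact le_add_self

lemma japE_mul_le {β : ℝ} (hβ : 0 ≤ β) (x y : ℝ) :
    japE β x * japE β y ≤ ENNReal.ofReal (2 ^ β) * japE β (x + y) * (japE β x + japE β y) := by
  have key : ∀ x y : ℝ, jap x ≤ jap y →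
      japE β x * japE β y ≤ ENNReal.ofReal (2 ^ β) * japE β (x + y) * japE β x := by
    intro x y h
    rw [mul_comm]
    gcongr
    unfold japE
    rw [← ENNReal.ofReal_mul (by positivity)]
    refine ENNReal.ofReal_le_ofReal ?_
    have h1 : jap (x + y) ≤ 2 * jap y := (jap_add_le' x y).trans (by linarith)
    have h2 := Real.rpow_le_rpow (jap_pos _).le h1 hβ
    rw [Real.mul_rpow zero_le_two (jap_pos _).le] at h2
    rw [Real.rpow_neg (jap_pos _).le, Real.rpow_neg (jap_pos _).le, ← div_eq_mul_inv,
      inv_le_comm₀ (Real.rpow_pos_of_pos (jap_pos _) _) (div_pos (by positivity)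
      (Real.rpow_pos_of_pos (jap_pos _) _)), inv_div,
      div_le_iff₀ (by positivity), mul_comm]
    exact h2
  rcases le_total (jap x) (jap y) with h | h
  · exact (key x y h).trans (by gcongr; exact le_self_add)
  · rw [mul_comm, add_comm x y]
    exact (key y x h).trans (by gcongr; exact le_add_self)

lemma lintegral_japE_mul_le {β : ℝ} (hβ : 0 ≤ β) (a b : ℝ) :
    ∫⁻ t : ℝ, japE β (t - a) * japE β (b - t) ≤
      ENNReal.ofReal (2 ^ β) * (2 * ∫⁻ x : ℝ, japE β x) * japE β (b - a) := by
  have : ∀ t, japE β (t - a) * japE β (b - t) ≤ ENNReal.ofReal (2 ^ β) * japE β (b - a) *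
      (japE β (t - a) + japE β (b - t)) := fun t => by
    refine (japE_mul_le hβ _ _).trans (le_of_eq ?_)
    congr 3; ring
  refine (lintegral_mono this).trans (le_of_eq ?_)
  rw [lintegral_const_mul _ (by fun_prop), lintegral_add_left (by fun_prop), lintegral_japE_sub,
    lintegral_japE_sub_left]
  ring

lemma lintegral_cone_mul_le {β : ℝ} (hβ : 0 ≤ β) (T p q : ℝ) :
    ∫⁻ t : ℝ, japE β (|t| - p) * japE β (|T - t| - q) ≤
      ENNReal.ofReal (2 ^ β) * (2 * ∫⁻ x : ℝ, japE β x) *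
        (japE β (T - p - q) + japE β (T - p + q) + (japE β (T + p - q) + japE β (T + p + q))) := by
  have : ∀ t, japE β (|t| - p) * japE β (|T - t| - q) ≤
      japE β (t - p) * japE β ((T - q) - t) + japE β (t - p) * japE β ((T + q) - t) +
      (japE β (t - (-p)) * japE β ((T - q) - t) + japE β (t - (-p)) * japE β ((T + q) - t)) := by
    intro t
    refine (mul_le_mul' (japE_abs_sub_le _ _ _) (japE_abs_sub_le _ _ _)).trans (le_of_eq ?_)
    rw [sub_neg_eq_add, sub_right_comm, show T - t + q = T + q - t by ring]
    ring
  refine (lintegral_mono this).trans ?_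
  rw [lintegral_add_left (by fun_prop), lintegral_add_left (by fun_prop),
    lintegral_add_left (by fun_prop)]
  refine (add_le_add (add_le_add (lintegral_japE_mul_le hβ _ _) (lintegral_japE_mul_le hβ _ _))
    (add_le_add (lintegral_japE_mul_le hβ _ _) (lintegral_japE_mul_le hβ _ _))).trans (le_of_eq ?_)
  rw [← mul_add, ← mul_add, ← mul_add, show T - q - p = T - p - q by ring,
    show T + q - p = T - p + q by ring, show T - q - -p = T + p - q by ring,
    show T + q - -p = T + p + q by ring]

lemma lintegral_Ioi_sqrt_japE_le (β : ℝ) : ∫⁻ u in Set.Ioi (0:ℝ), japE (1 + β) √u ≤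
    2 * ∫⁻ x : ℝ, japE β x := by
  rw [lintegral_Ioi_sq, ← lintegral_const_mul _ (by fun_prop)]
  refine (setLIntegral_mono (by fun_prop) fun x hx => ?_).trans (setLIntegral_le_lintegral _ _)
  have hx : (0:ℝ) < x := hx
  rw [Real.sqrt_sq hx.le, abs_mul, ENNReal.ofReal_mul (by positivity), mul_assoc]
  refine mul_le_mul' (by simp) (ofReal_abs_mul_japE β x)

lemma lintegral_Ioi_sqrt_japE_mul_le (f : ℝ → ℝ≥0∞) (hf : Measurable f) :
    ∫⁻ u in Set.Ioi (0:ℝ), japE 1 √u * f √u ≤ 2 * ∫⁻ x : ℝ, f x := by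
  rw [lintegral_Ioi_sq, ← lintegral_const_mul _ (by fun_prop)]
  refine (setLIntegral_mono (by fun_prop) fun x hx => ?_).trans (setLIntegral_le_lintegral _ _)
  have hx : (0:ℝ) < x := hx
  rw [Real.sqrt_sq hx.le, abs_mul, ENNReal.ofReal_mul (by positivity), mul_assoc, ← mul_assoc _ _ (f x)]
  refine mul_le_mul' (by simp) ?_
  conv_rhs => rw [← one_mul (f x)]
  gcongr
  have := ofReal_abs_mul_japE 0 x
  rw [add_zero] at this
  exact this.trans (japE_le_one le_rfl x)

/-- The spatial weight `⟨ξ⟩`. -/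
def nW (X : SpaceTime) : ℝ := jap ‖spt X‖
/-- The modulation weight `⟨|τ| - |ξ|⟩`. -/
def dW (X : SpaceTime) : ℝ := jap (|X 0| - ‖spt X‖)
/-- The elliptic weight `⟨|τ| + |ξ|⟩`. -/
def pW (X : SpaceTime) : ℝ := jap (|X 0| + ‖spt X‖)

@[fun_prop] lemma continuous_nW : Continuous nW := by unfold nW; fun_prop
@[fun_prop] lemma continuous_dW : Continuous dW := by unfold dW; fun_prop
@[fun_prop] lemma continuous_pW : Continuous pW := by unfold pW; fun_prop
@[fun_prop] lemma measurable_nW : Measurable nW := continuous_nW.measurable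
@[fun_prop] lemma measurable_dW : Measurable dW := continuous_dW.measurable
@[fun_prop] lemma measurable_pW : Measurable pW := continuous_pW.measurable
lemma nW_neg (X : SpaceTime) : nW (-X) = nW X := by simp [nW, spt_neg]
lemma one_le_nW (X : SpaceTime) : 1 ≤ nW X := one_le_jap _
lemma one_le_dW (X : SpaceTime) : 1 ≤ dW X := one_le_jap _
lemma one_le_pW (X : SpaceTime) : 1 ≤ pW X := one_le_jap _

/-- The weight `⟨ξ⟩ ^ (-α) ⟨|τ| - |ξ|⟩ ^ (-β)`. -/
def ndW (α β : ℝ) (X : SpaceTime) : ℝ≥0∞ := japE α ‖spt X‖ * japE β (|X 0| - ‖spt X‖)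

@[fun_prop] lemma measurable_ndW (α β : ℝ) : Measurable (ndW α β) := by
  unfold ndW
  fun_prop

lemma ndW_neg (α β : ℝ) (X : SpaceTime) : ndW α β (-X) = ndW α β X := by simp [ndW, spt_neg]

lemma ndW_stpt (α β t : ℝ) (x : Space) :
    ndW α β (stpt t x) = japE α ‖x‖ * japE β (|t| - ‖x‖) := by
  simp [ndW]

lemma lintegral_ndW_lt_top {α β : ℝ} (hα : 3 < α) (hβ : 1 < β) :
    ∫⁻ X : SpaceTime, ndW α β X < ∞ := by
  rw [lintegral_spaceTime _ (by fun_prop)]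
  simp only [ndW_stpt]
  rw [lintegral_lintegral_swap (Measurable.aemeasurable (by fun_prop))]
  have : ∀ x : Space, ∫⁻ t : ℝ, japE α ‖x‖ * japE β (|t| - ‖x‖) ≤
      japE α ‖x‖ * (2 * ∫⁻ x : ℝ, japE β x) := by
    intro x
    rw [lintegral_const_mul _ (by fun_prop)]
    gcongr
    refine (lintegral_mono fun t => japE_abs_sub_le β t ‖x‖).trans (le_of_eq ?_)
    rw [lintegral_add_left (by fun_prop), lintegral_japE_sub,
      lintegral_add_right_eq_self (japE β), two_mul]
  refine (lintegral_mono this).trans_lt ?_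
  rw [lintegral_mul_const _ (by fun_prop)]
  exact ENNReal.mul_lt_top (lintegral_japE_norm_lt_top (by exact_mod_cast hα))
    (ENNReal.mul_lt_top (by simp) (lintegral_japE_lt_top hβ))

/-- The convolution of two cone weights. -/
lemma exists_cone_convolution_le {β : ℝ} (hβ : 1 < β) : ∃ M : ℝ≥0∞, M ≠ ∞ ∧ ∀ X : SpaceTime,
    ENNReal.ofReal (nW X) * ∫⁻ Y, ndW (1 + β) β Y * ndW 1 β (X - Y) ≤ M := by
  have hβ0 : 0 ≤ β := by linarith
  set J := ∫⁻ x : ℝ, japE β x with hJ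
  have hJt : J < ∞ := lintegral_japE_lt_top hβ
  set C := ENNReal.ofReal (2 ^ β) * (2 * J) with hC
  have hCt : C < ∞ := ENNReal.mul_lt_top (by simp) (ENNReal.mul_lt_top (by simp) hJt)
  refine ⟨max (ENNReal.ofReal 4 * ∫⁻ Y, ndW (2 + β) β Y)
    (ENNReal.ofReal Real.pi * (C * (2 * J) * (4 * (2 * J)))), ?_, fun X => ?_⟩
  · refine (max_lt ?_ ?_).ne
    · exact ENNReal.mul_lt_top (by simp) (lintegral_ndW_lt_top (by linarith) hβ)
    · refine ENNReal.mul_lt_top (by simp) (ENNReal.mul_lt_top ?_ ?_)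
      · exact ENNReal.mul_lt_top hCt (ENNReal.mul_lt_top (by simp) hJt)
      · exact ENNReal.mul_lt_top (by simp) (ENNReal.mul_lt_top (by simp) hJt)
  rcases le_total ‖spt X‖ 1 with h | h
  · refine le_max_of_le_left ?_
    rw [← lintegral_const_mul' _ _ ENNReal.ofReal_ne_top,
      ← lintegral_const_mul' _ _ ENNReal.ofReal_ne_top]
    refine lintegral_mono fun Y => ?_
    have h1 : nW X ≤ 2 := by
      have := jap_le_one_add ‖spt X‖
      rw [abs_of_nonneg (norm_nonneg _)] at this
      unfold nW; linarith
    have h2 : nW Y ≤ 2 * nW (X - Y) := by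
      have h3 : ‖spt Y‖ ≤ ‖spt (X - Y)‖ + 1 := by
        rw [spt_sub]
        have := norm_sub_norm_le (spt Y) (spt X)
        rw [norm_sub_rev] at this
        linarith
      have h4 := (jap_le_jap (x := ‖spt Y‖) (y := ‖spt (X - Y)‖ + 1)
        (by rw [abs_of_nonneg (norm_nonneg _), abs_of_nonneg (by positivity)]; exact h3)).trans
        (jap_add_le _ _)
      have := one_le_nW (X - Y)
      unfold nW at *
      rw [abs_one] at h4
      linarith
    have h5 : ndW 1 β (X - Y) ≤ ENNReal.ofReal 2 * japE 1 ‖spt Y‖ := by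
      unfold ndW
      refine (mul_le_mul' le_rfl (japE_le_one hβ0 _)).trans ?_
      rw [mul_one]
      unfold japE
      rw [← ENNReal.ofReal_mul (by simp)]
      refine ENNReal.ofReal_le_ofReal ?_
      have p1 : 0 < jap ‖spt (X - Y)‖ := jap_pos _
      have p2 : 0 < jap ‖spt Y‖ := jap_pos _
      simp only [Real.rpow_neg_one]
      unfold nW at h2
      rw [← div_eq_mul_inv, inv_eq_one_div, div_le_div_iff₀ p1 p2]
      linarith
    calc ENNReal.ofReal (nW X) * (ndW (1 + β) β Y * ndW 1 β (X - Y))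
        ≤ ENNReal.ofReal 2 * (ndW (1 + β) β Y * (ENNReal.ofReal 2 * japE 1 ‖spt Y‖)) := by
          gcongr
      _ = ENNReal.ofReal 4 * ndW (2 + β) β Y := by
          unfold ndW
          rw [show 2 + β = (1 + β) + 1 by ring, japE_add (1 + β) 1,
            show (4:ℝ) = 2 * 2 by norm_num, ENNReal.ofReal_mul zero_le_two]
          ring
  · refine le_max_of_le_right ?_
    set R := ‖spt X‖ with hR
    have hRp : 0 < R := by linarith
    have hx : spt X ≠ 0 := norm_pos_iff.1 hRp
    set T := X 0 with hT
    set g : ℝ → ℝ → ℝ≥0∞ := fun p q => japE (1 + β) p * (japE 1 q * (C *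
        (japE β (T - p - q) + japE β (T - p + q) + (japE β (T + p - q) + japE β (T + p + q)))))
      with hg
    have hgm : Measurable (Function.uncurry g) := by
      simp only [hg, Function.uncurry_def]
      fun_prop
    have h1 : ∫⁻ Y, ndW (1 + β) β Y * ndW 1 β (X - Y) ≤ ∫⁻ y : Space, g ‖y‖ ‖spt X - y‖ := by
      rw [lintegral_spaceTime _ (by fun_prop)]
      have : ∀ (t : ℝ) (y : Space), ndW (1 + β) β (stpt t y) * ndW 1 β (X - stpt t y) =
          (japE (1 + β) ‖y‖ * japE 1 ‖spt X - y‖) *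
            (japE β (|t| - ‖y‖) * japE β (|T - t| - ‖spt X - y‖)) := by
        intro t y
        rw [ndW_stpt]
        simp only [ndW, spt_sub, spt_stpt, PiLp.sub_apply, stpt_zero, ← hT]
        ring
      simp only [this]
      rw [lintegral_lintegral_swap (Measurable.aemeasurable (by fun_prop))]
      refine lintegral_mono fun y => ?_
      rw [lintegral_const_mul _ (by fun_prop), hg]
      simp only
      rw [mul_assoc]
      gcongr
      exact lintegral_cone_mul_le hβ0 _ _ _
    have h2 : ∀ p : ℝ, ∫⁻ v in Set.Ioi (0:ℝ), g p √v ≤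
        japE (1 + β) p * (C * (2 * (4 * J))) := by
      intro p
      simp only [hg]
      rw [lintegral_const_mul _ (by fun_prop)]
      gcongr
      refine (lintegral_Ioi_sqrt_japE_mul_le (fun q => C * (japE β (T - p - q) +
        japE β (T - p + q) + (japE β (T + p - q) + japE β (T + p + q)))) (by fun_prop)).trans
        (le_of_eq ?_)
      rw [lintegral_const_mul _ (by fun_prop), lintegral_add_left (by fun_prop),
        lintegral_add_left (by fun_prop), lintegral_add_left (by fun_prop),
        lintegral_japE_sub_left, lintegral_japE_sub_left,
        lintegral_add_left_eq_self (japE β), lintegral_add_left_eq_self (japE β)]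
      ring
    have h3 : ∫⁻ y : Space, g ‖y‖ ‖spt X - y‖ ≤ ENNReal.ofReal (Real.pi / (2 * R)) *
        (2 * J * (C * (2 * (4 * J)))) := by
      refine (lintegral_bipolar_le g hgm (spt X) hx).trans ?_
      gcongr
      refine (lintegral_mono fun u => h2 √u).trans ?_
      rw [lintegral_mul_const _ (by fun_prop)]
      gcongr
      exact lintegral_Ioi_sqrt_japE_le β
    have h4 : nW X ≤ 2 * R := by
      have := jap_le_one_add ‖spt X‖
      rw [abs_of_nonneg (norm_nonneg _)] at this
      unfold nW; linarith
    calc ENNReal.ofReal (nW X) * ∫⁻ Y, ndW (1 + β) β Y * ndW 1 β (X - Y)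
        ≤ ENNReal.ofReal (2 * R) * (ENNReal.ofReal (Real.pi / (2 * R)) *
        (2 * J * (C * (2 * (4 * J))))) := by
          gcongr
          exact h1.trans h3
      _ = ENNReal.ofReal Real.pi * (C * (2 * J) * (4 * (2 * J))) := by
          rw [← mul_assoc, ← ENNReal.ofReal_mul (by positivity),
            mul_div_cancel₀ _ (by positivity)]
          ring

/-- The `L²` norm of an `ℝ≥0∞`-valued function. -/
def l2E {α : Type*} [MeasureSpace α] (f : α → ℝ≥0∞) : ℝ≥0∞ := (∫⁻ x, f x ^ 2) ^ (1 / 2 : ℝ)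

lemma l2E_sq {α : Type*} [MeasureSpace α] (f : α → ℝ≥0∞) : l2E f ^ 2 = ∫⁻ x, f x ^ 2 := by
  unfold l2E
  rw [← ENNReal.rpow_natCast, ← ENNReal.rpow_mul]
  simp

lemma lintegral_mul_le_l2E {α : Type*} [MeasureSpace α] (f g : α → ℝ≥0∞) (hf : Measurable f)
    (hg : Measurable g) : ∫⁻ x, f x * g x ≤ l2E f * l2E g := by
  have := ENNReal.lintegral_mul_le_Lp_mul_Lq (volume : Measure α) (p := 2) (q := 2)
    Real.HolderConjugate.two_two hf.aemeasurable hg.aemeasurable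
  simpa [l2E] using this

/-- Cauchy–Schwarz in both variables for an iterated integral. -/
lemma lintegral_kernel_le {α γ : Type*} [MeasureSpace α] [MeasureSpace γ]
    [SFinite (volume : Measure α)] [SFinite (volume : Measure γ)]
    (f : α → ℝ≥0∞) (J g : α → γ → ℝ≥0∞) (hf : Measurable f) (hJ : Measurable (Function.uncurry J))
    (hg : Measurable (Function.uncurry g)) (M : ℝ≥0∞) (hM : ∀ x, ∫⁻ y, J x y ^ 2 ≤ M) :
    ∫⁻ x, f x * ∫⁻ y, J x y * g x y ≤ M ^ (1 / 2 : ℝ) * l2E f * (∫⁻ x, ∫⁻ y, g x y ^ 2) ^ (1 / 2 : ℝ) := by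
  have hJx : ∀ x, Measurable (J x) := fun x => hJ.comp measurable_prodMk_left
  have hgx : ∀ x, Measurable (g x) := fun x => hg.comp measurable_prodMk_left
  have hl : Measurable fun x => l2E (g x) :=
    (Measurable.lintegral_prod_right' (f := fun p : α × γ => g p.1 p.2 ^ 2)
      (hg.pow_const 2)).pow_const _
  calc ∫⁻ x, f x * ∫⁻ y, J x y * g x y ≤ ∫⁻ x, f x * (M ^ (1 / 2 : ℝ) * l2E (g x)) := by
        gcongr with x
        refine (lintegral_mul_le_l2E _ _ (hJx x) (hgx x)).trans ?_
        gcongr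
        exact ENNReal.rpow_le_rpow (hM x) (by norm_num)
    _ = M ^ (1 / 2 : ℝ) * ∫⁻ x, f x * l2E (g x) := by
        rw [← lintegral_const_mul _ (f := fun x => f x * l2E (g x)) (hf.mul hl)]
        refine lintegral_congr fun x => ?_
        ring
    _ ≤ M ^ (1 / 2 : ℝ) * (l2E f * l2E fun x => l2E (g x)) := by
        gcongr
        exact lintegral_mul_le_l2E _ _ hf hl
    _ = _ := by
        rw [← mul_assoc]
        congr 1
        unfold l2E
        congr 1
        refine lintegral_congr fun x => ?_
        exact l2E_sq (g x)

/-- Boundedness on `L² × L² × L²` of the trilinear convolution form with kernel `K`. -/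
def TriBdd (K : SpaceTime → SpaceTime → ℝ≥0∞) : Prop :=
  ∃ C : ℝ≥0∞, C ≠ ∞ ∧ ∀ a b c : SpaceTime → ℝ≥0∞, Measurable a → Measurable b → Measurable c →
    ∫⁻ η, ∫⁻ θ, K η θ * (a η * b θ * c (η + θ)) ≤ C * (l2E a * l2E b * l2E c)

lemma TriBdd.mono {K L : SpaceTime → SpaceTime → ℝ≥0∞} (h : TriBdd L) (C : ℝ≥0∞) (hC : C ≠ ∞)
    (hKL : ∀ η θ, K η θ ≤ C * L η θ) : TriBdd K := by
  obtain ⟨D, hD, h⟩ := h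
  refine ⟨C * D, ENNReal.mul_ne_top hC hD, fun a b c ha hb hc => ?_⟩
  calc _ ≤ ∫⁻ η, ∫⁻ θ, C * (L η θ * (a η * b θ * c (η + θ))) := by
        refine lintegral_mono fun η => lintegral_mono fun θ => ?_
        exact (mul_le_mul' (hKL η θ) le_rfl).trans (mul_assoc _ _ _).le
    _ = C * ∫⁻ η, ∫⁻ θ, L η θ * (a η * b θ * c (η + θ)) := by
        simp_rw [lintegral_const_mul' _ _ hC]
    _ ≤ _ := by
        rw [mul_assoc]
        gcongr
        exact h a b c ha hb hc

lemma TriBdd.add {K L : SpaceTime → SpaceTime → ℝ≥0∞} (hKm : Measurable (Function.uncurry K))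
    (hK : TriBdd K) (hL : TriBdd L) : TriBdd fun η θ => K η θ + L η θ := by
  obtain ⟨C, hC, hK⟩ := hK
  obtain ⟨D, hD, hL⟩ := hL
  refine ⟨C + D, ENNReal.add_ne_top.2 ⟨hC, hD⟩, fun a b c ha hb hc => ?_⟩
  have hm : Measurable fun p : SpaceTime × SpaceTime => K p.1 p.2 * (a p.1 * b p.2 * c (p.1 + p.2)) :=
    hKm.mul (by fun_prop)
  rw [add_mul]
  refine le_trans (le_of_eq ?_) (add_le_add (hK a b c ha hb hc) (hL a b c ha hb hc))
  rw [← lintegral_add_left hm.lintegral_prod_right']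
  refine lintegral_congr fun η => ?_
  have hm' : Measurable fun θ => K η θ * (a η * b θ * c (η + θ)) := hm.comp measurable_prodMk_left
  simp only
  rw [← lintegral_add_left hm']
  refine lintegral_congr fun θ => ?_
  rw [add_mul]

lemma TriBdd.swap {K : SpaceTime → SpaceTime → ℝ≥0∞} (hKm : Measurable (Function.uncurry K))
    (h : TriBdd K) : TriBdd fun η θ => K θ η := by
  obtain ⟨C, hC, h⟩ := h
  refine ⟨C, hC, fun a b c ha hb hc => ?_⟩
  have hm : Measurable fun p : SpaceTime × SpaceTime => K p.2 p.1 * (a p.1 * b p.2 * c (p.1 + p.2)) :=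
    (hKm.comp measurable_swap).mul (by fun_prop)
  rw [lintegral_lintegral_swap hm.aemeasurable]
  refine le_trans (le_of_eq ?_) ((h b a c hb ha hc).trans (le_of_eq ?_))
  · refine lintegral_congr fun η => lintegral_congr fun θ => ?_
    rw [add_comm θ η, mul_comm (a θ)]
  · rw [mul_comm (l2E b)]

lemma lintegral_sq_mul_sq_add (b c : SpaceTime → ℝ≥0∞) (hb : Measurable b) (hc : Measurable c) :
    (∫⁻ η, ∫⁻ θ, (b θ * c (η + θ)) ^ 2) ^ (1 / 2 : ℝ) = l2E b * l2E c := by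
  rw [lintegral_lintegral_swap (Measurable.aemeasurable (by fun_prop))]
  simp_rw [mul_pow]
  have : ∀ θ, ∫⁻ η, b θ ^ 2 * c (η + θ) ^ 2 = b θ ^ 2 * ∫⁻ η, c η ^ 2 := fun θ => by
    rw [lintegral_const_mul _ (by fun_prop), lintegral_add_right_eq_self (fun η => c η ^ 2)]
  simp_rw [this]
  rw [lintegral_mul_const _ (by fun_prop), ENNReal.mul_rpow_of_nonneg _ _ (by norm_num)]
  rfl

lemma triBdd_of_left {K : SpaceTime → SpaceTime → ℝ≥0∞} (hKm : Measurable (Function.uncurry K))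
    {M : ℝ≥0∞} (hM : M ≠ ∞) (h : ∀ η, ∫⁻ θ, K η θ ^ 2 ≤ M) : TriBdd K := by
  refine ⟨M ^ (1 / 2 : ℝ), ENNReal.rpow_ne_top_of_nonneg (by norm_num) hM, fun a b c ha hb hc => ?_⟩
  have := lintegral_kernel_le a K (fun η θ => b θ * c (η + θ)) ha hKm
    (by simp only [Function.uncurry_def]; fun_prop) M h
  rw [lintegral_sq_mul_sq_add b c hb hc] at this
  refine le_trans (le_of_eq ?_) (this.trans (le_of_eq (by ring)))
  refine lintegral_congr fun η => ?_
  have hm' : Measurable fun θ => K η θ * (b θ * c (η + θ)) :=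
    Measurable.mul (hKm.comp measurable_prodMk_left) (by fun_prop)
  rw [← lintegral_const_mul _ hm']
  refine lintegral_congr fun θ => ?_
  ring

lemma lintegral_add_change (F : SpaceTime → SpaceTime → ℝ≥0∞) (hF : Measurable (Function.uncurry F)) :
    ∫⁻ η, ∫⁻ θ, F η θ = ∫⁻ ζ, ∫⁻ η, F η (ζ - η) := by
  have h1 : ∀ η, ∫⁻ θ, F η θ = ∫⁻ ζ, F η (ζ - η) := fun η =>
    (lintegral_sub_right_eq_self (F η) η).symm
  simp_rw [h1]
  rw [lintegral_lintegral_swap]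
  have : Measurable fun p : SpaceTime × SpaceTime => F p.1 (p.2 - p.1) :=
    hF.comp (f := fun p : SpaceTime × SpaceTime => (p.1, p.2 - p.1)) (by fun_prop)
  exact this.aemeasurable

lemma lintegral_form_le_of_sum {K : SpaceTime → SpaceTime → ℝ≥0∞}
    (hKm : Measurable (Function.uncurry K)) {M : ℝ≥0∞} (h : ∀ ζ, ∫⁻ η, K η (ζ - η) ^ 2 ≤ M)
    {a b c : SpaceTime → ℝ≥0∞} (ha : Measurable a) (hb : Measurable b) (hc : Measurable c) :
    ∫⁻ η, ∫⁻ θ, K η θ * (a η * b θ * c (η + θ)) ≤ M ^ (1 / 2 : ℝ) * (l2E a * l2E b * l2E c) := by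
  have hKm' : Measurable (Function.uncurry fun ζ η => K η (ζ - η)) :=
    hKm.comp (f := fun p : SpaceTime × SpaceTime => (p.2, p.1 - p.2)) (by fun_prop)
  have := lintegral_kernel_le c (fun ζ η => K η (ζ - η)) (fun ζ η => a η * b (ζ - η)) hc hKm'
    (by simp only [Function.uncurry_def]; fun_prop) M h
  rw [lintegral_add_change _ (hKm.mul (by fun_prop))]
  have hg : (∫⁻ ζ, ∫⁻ η, (a η * b (ζ - η)) ^ 2) ^ (1 / 2 : ℝ) = l2E a * l2E b := by
    rw [lintegral_lintegral_swap (Measurable.aemeasurable (by fun_prop))]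
    simp_rw [mul_pow]
    have : ∀ η, ∫⁻ ζ, a η ^ 2 * b (ζ - η) ^ 2 = a η ^ 2 * ∫⁻ ζ, b ζ ^ 2 := fun η => by
      rw [lintegral_const_mul _ (by fun_prop), lintegral_sub_right_eq_self (fun ζ => b ζ ^ 2)]
    simp_rw [this]
    rw [lintegral_mul_const _ (by fun_prop), ENNReal.mul_rpow_of_nonneg _ _ (by norm_num)]
    rfl
  rw [hg] at this
  refine le_trans (le_of_eq ?_) (this.trans (le_of_eq (by ring)))
  refine lintegral_congr fun ζ => ?_
  have hm' : Measurable fun η => K η (ζ - η) * (a η * b (ζ - η)) :=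
    Measurable.mul (hKm'.comp measurable_prodMk_left) (by fun_prop)
  rw [← lintegral_const_mul _ hm']
  refine lintegral_congr fun η => ?_
  rw [add_sub_cancel]
  ring

lemma triBdd_of_sum {K : SpaceTime → SpaceTime → ℝ≥0∞} (hKm : Measurable (Function.uncurry K))
    {M : ℝ≥0∞} (hM : M ≠ ∞) (h : ∀ ζ, ∫⁻ η, K η (ζ - η) ^ 2 ≤ M) : TriBdd K :=
  ⟨M ^ (1 / 2 : ℝ), ENNReal.rpow_ne_top_of_nonneg (by norm_num) hM,
    fun _ _ _ ha hb hc => lintegral_form_le_of_sum hKm h ha hb hc⟩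

/-- Square root of the weight `⟨X⟩ ⟨Y⟩ ^ (-1-β) ⟨Z⟩ ^ (-1)` with modulations of `Y` and `Z`. -/
def sK (β : ℝ) (X Y Z : SpaceTime) : ℝ :=
  nW X ^ (1 / 2 : ℝ) * (nW Y ^ (-((1 + β) / 2)) * dW Y ^ (-(β / 2)) *
    (nW Z ^ (-(1 / 2) : ℝ) * dW Z ^ (-(β / 2))))

/-- The weight `⟨Y⟩ ^ (-1-β/2)` with the modulation of `Z`. -/
def tK (β : ℝ) (Y Z : SpaceTime) : ℝ := nW Y ^ (-((2 + β) / 2)) * dW Z ^ (-(β / 2))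

@[fun_prop] lemma measurable_sK {α : Type*} [MeasurableSpace α] (β : ℝ) {f g h : α → SpaceTime}
    (hf : Measurable f) (hg : Measurable g) (hh : Measurable h) :
    Measurable fun x => sK β (f x) (g x) (h x) := by
  unfold sK
  fun_prop

@[fun_prop] lemma measurable_tK {α : Type*} [MeasurableSpace α] (β : ℝ) {f g : α → SpaceTime}
    (hf : Measurable f) (hg : Measurable g) :
    Measurable fun x => tK β (f x) (g x) := by
  unfold tK
  fun_prop

lemma ofReal_rpow_half_sq {x : ℝ} (hx : 1 ≤ x) (a : ℝ) :
    ENNReal.ofReal (x ^ (-(a / 2))) ^ 2 = ENNReal.ofReal (x ^ (-a)) := by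
  have hx : 0 < x := by linarith
  rw [← ENNReal.ofReal_pow (by positivity), ← Real.rpow_natCast, ← Real.rpow_mul hx.le]
  congr 2
  push_cast
  ring

lemma ofReal_sK_sq (β : ℝ) (X Y Z : SpaceTime) :
    ENNReal.ofReal (sK β X Y Z) ^ 2 = ENNReal.ofReal (nW X) * (ndW (1 + β) β Y * ndW 1 β Z) := by
  have hX := one_le_nW X
  have hY := one_le_nW Y
  have hZ := one_le_nW Z
  have hY' := one_le_dW Y
  have hZ' := one_le_dW Z
  unfold sK
  rw [ENNReal.ofReal_mul (by positivity), ENNReal.ofReal_mul (by positivity),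
    ENNReal.ofReal_mul (by positivity), ENNReal.ofReal_mul (by positivity)]
  simp only [mul_pow]
  rw [ofReal_rpow_half_sq hY, ofReal_rpow_half_sq hY', ofReal_rpow_half_sq hZ,
    ofReal_rpow_half_sq hZ']
  rw [show (1 / 2 : ℝ) = -(-1 / 2) by norm_num, ofReal_rpow_half_sq hX, neg_neg, Real.rpow_one]
  rfl

lemma ofReal_tK_sq (β : ℝ) (Y Z : SpaceTime) :
    ENNReal.ofReal (tK β Y Z) ^ 2 = ndW (2 + β) 0 Y * ndW 0 β Z := by
  have hY := one_le_nW Y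
  have hZ' := one_le_dW Z
  unfold tK
  rw [ENNReal.ofReal_mul (by positivity)]
  simp only [mul_pow]
  rw [ofReal_rpow_half_sq hY, ofReal_rpow_half_sq hZ']
  simp [ndW, japE, nW, dW]

lemma triBdd_sK_zero {β : ℝ} (hβ : 1 < β) :
    TriBdd fun η θ => ENNReal.ofReal (sK β (η + θ) η θ) := by
  obtain ⟨M, hM, h⟩ := exists_cone_convolution_le hβ
  refine triBdd_of_sum (by simp only [Function.uncurry_def]; fun_prop) hM fun ζ => ?_
  simp_rw [ofReal_sK_sq]
  simp only [add_sub_cancel]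
  rw [lintegral_const_mul' _ _ ENNReal.ofReal_ne_top]
  exact h ζ

lemma triBdd_sK_left {β : ℝ} (hβ : 1 < β) :
    TriBdd fun η θ => ENNReal.ofReal (sK β η (η + θ) θ) := by
  obtain ⟨M, hM, h⟩ := exists_cone_convolution_le hβ
  refine triBdd_of_left (by simp only [Function.uncurry_def]; fun_prop) hM fun η => ?_
  simp_rw [ofReal_sK_sq]
  rw [lintegral_const_mul' _ _ ENNReal.ofReal_ne_top]
  refine le_trans (le_of_eq ?_) (h η)
  congr 1
  rw [← lintegral_add_left_eq_self (fun Y => ndW (1 + β) β Y * ndW 1 β (η - Y)) η]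
  refine lintegral_congr fun θ => ?_
  rw [sub_add_cancel_left, ndW_neg]

lemma triBdd_sK_left' {β : ℝ} (hβ : 1 < β) :
    TriBdd fun η θ => ENNReal.ofReal (sK β η θ (η + θ)) := by
  obtain ⟨M, hM, h⟩ := exists_cone_convolution_le hβ
  refine triBdd_of_left (by simp only [Function.uncurry_def]; fun_prop) hM fun η => ?_
  simp_rw [ofReal_sK_sq]
  rw [lintegral_const_mul' _ _ ENNReal.ofReal_ne_top]
  refine le_trans (le_of_eq ?_) (h η)
  congr 1
  rw [← lintegral_neg_eq_self]
  refine lintegral_congr fun θ => ?_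
  rw [ndW_neg, sub_eq_add_neg]

lemma exists_ndW_convolution_le {β : ℝ} (hβ : 1 < β) : ∃ M : ℝ≥0∞, M ≠ ∞ ∧ ∀ X : SpaceTime,
    ∫⁻ Y, ndW (2 + β) 0 Y * ndW 0 β (X - Y) ≤ M := by
  set J := ∫⁻ x : ℝ, japE β x with hJ
  have hJt : J < ∞ := lintegral_japE_lt_top hβ
  refine ⟨(∫⁻ y : Space, japE (2 + β) ‖y‖) * (2 * J), ?_, fun X => ?_⟩
  · exact (ENNReal.mul_lt_top (lintegral_japE_norm_lt_top (by push_cast; linarith))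
      (ENNReal.mul_lt_top (by simp) hJt)).ne
  have h0 : ∀ x, japE 0 x = 1 := fun x => by simp [japE]
  rw [lintegral_spaceTime _ (by fun_prop)]
  simp only [ndW, spt_sub, spt_stpt, PiLp.sub_apply, stpt_zero, h0, mul_one, one_mul]
  rw [lintegral_lintegral_swap (Measurable.aemeasurable (by fun_prop)),
    ← lintegral_mul_const _ (by fun_prop)]
  refine lintegral_mono fun y => ?_
  rw [lintegral_const_mul _ (by fun_prop)]
  gcongr
  rw [lintegral_sub_left_eq_self (fun t => japE β (|t| - ‖spt X - y‖))]
  refine (lintegral_mono fun t => japE_abs_sub_le β t ‖spt X - y‖).trans (le_of_eq ?_)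
  rw [lintegral_add_left (by fun_prop), lintegral_japE_sub,
    lintegral_add_right_eq_self (japE β), two_mul]

lemma triBdd_tK_sum_right {β : ℝ} (hβ : 1 < β) :
    TriBdd fun η θ => ENNReal.ofReal (tK β (η + θ) θ) := by
  obtain ⟨M, hM, h⟩ := exists_ndW_convolution_le hβ
  refine triBdd_of_left (by simp only [Function.uncurry_def]; fun_prop) hM fun η => ?_
  simp_rw [ofReal_tK_sq]
  refine le_trans (le_of_eq ?_) (h η)
  rw [← lintegral_add_left_eq_self (fun Y => ndW (2 + β) 0 Y * ndW 0 β (η - Y)) η]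
  refine lintegral_congr fun θ => ?_
  rw [sub_add_cancel_left, ndW_neg]

lemma triBdd_tK_left_sum {β : ℝ} (hβ : 1 < β) :
    TriBdd fun η θ => ENNReal.ofReal (tK β η (η + θ)) := by
  obtain ⟨M, hM, h⟩ := exists_ndW_convolution_le hβ
  have : TriBdd fun θ η => ENNReal.ofReal (tK β η (η + θ)) := by
    refine triBdd_of_left (by simp only [Function.uncurry_def]; fun_prop) hM fun θ => ?_
    simp_rw [ofReal_tK_sq]
    refine le_trans (le_of_eq ?_) (h θ)
    rw [← lintegral_neg_eq_self]
    refine lintegral_congr fun η => ?_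
    rw [ndW_neg, neg_add_eq_sub]
  exact this.swap (by simp only [Function.uncurry_def]; fun_prop)

/-- If `f` expands distances on `S`, then the sublevel weights of `f` have bounded integral. -/
lemma lintegral_japE_expanding_le {β : ℝ} (hβ : 0 ≤ β) (S : Set ℝ) (f : ℝ → ℝ)
    (hf : ∀ x ∈ S, ∀ y ∈ S, |x - y| ≤ |f x - f y|) (A : ℝ) :
    ∫⁻ x, S.indicator (fun x => japE β (A - f x)) x ≤
      ENNReal.ofReal (4 ^ β) * ∫⁻ x : ℝ, japE β x := by
  rcases S.eq_empty_or_nonempty with rfl | hS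
  · simp
  obtain ⟨x₀, hx₀, hmin⟩ : ∃ x₀ ∈ S, ∀ x ∈ S, |A - f x₀| ≤ |A - f x| + 1 := by
    have hne : ((fun x => |A - f x|) '' S).Nonempty := hS.image _
    obtain ⟨_, ⟨x₀, hx₀, rfl⟩, hlt⟩ := exists_lt_of_csInf_lt hne
      (lt_add_one (sInf ((fun x => |A - f x|) '' S)))
    refine ⟨x₀, hx₀, fun x hx => ?_⟩
    have : sInf ((fun x => |A - f x|) '' S) ≤ |A - f x| :=
      csInf_le ⟨0, by rintro _ ⟨y, _, rfl⟩; positivity⟩ ⟨x, hx, rfl⟩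
    simp only at hlt
    linarith
  rw [← lintegral_japE_sub β x₀, ← lintegral_const_mul _ (by fun_prop)]
  refine lintegral_mono fun x => ?_
  by_cases hx : x ∈ S
  swap
  · rw [Set.indicator_of_notMem hx]; exact zero_le
  rw [Set.indicator_of_mem hx]
  unfold japE
  rw [← ENNReal.ofReal_mul (by positivity)]
  refine ENNReal.ofReal_le_ofReal ?_
  have h1 : |x - x₀| ≤ 2 * |A - f x| + 1 := by
    have h2 := hf x hx x₀ hx₀
    have h3 := abs_sub_le (f x) A (f x₀)
    rw [abs_sub_comm (f x) A] at h3
    have h4 := hmin x hx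
    linarith
  have h2 : jap (x - x₀) ≤ 4 * jap (A - f x) := by
    have h3 := jap_le_one_add (x - x₀)
    have h4 := abs_le_jap (A - f x)
    have h5 := one_le_jap (A - f x)
    linarith
  have h3 := Real.rpow_le_rpow (jap_pos _).le h2 hβ
  rw [Real.mul_rpow (by norm_num) (jap_pos _).le] at h3
  have p1 := Real.rpow_pos_of_pos (jap_pos (A - f x)) β
  have p2 := Real.rpow_pos_of_pos (jap_pos (x - x₀)) β
  rw [Real.rpow_neg (jap_pos _).le, Real.rpow_neg (jap_pos _).le, ← div_eq_mul_inv,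
    le_div_iff₀ p2, inv_mul_le_iff₀ p1, mul_comm]
  exact h3

lemma half_sub_le_sqrt_sub {a b m : ℝ} (ha : 0 < a) (hab : a ≤ b) (hm : 0 ≤ m)
    (hma : m ≤ 3 * a ^ 2) : (b - a) / 2 ≤ √(b ^ 2 + m) - √(a ^ 2 + m) := by
  have h1 : √(a ^ 2 + m) ≤ 2 * a := by
    rw [Real.sqrt_le_left (by linarith)]; nlinarith
  have h2 : √(b ^ 2 + m) ≤ 2 * b := by
    rw [Real.sqrt_le_left (by linarith)]; nlinarith
  have h3 : √(a ^ 2 + m) ≤ √(b ^ 2 + m) := Real.sqrt_le_sqrt (by nlinarith)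
  have h4 : √(a ^ 2 + m) ^ 2 = a ^ 2 + m := Real.sq_sqrt (by positivity)
  have h5 : √(b ^ 2 + m) ^ 2 = b ^ 2 + m := Real.sq_sqrt (by positivity)
  have h6 : (√(b ^ 2 + m) - √(a ^ 2 + m)) * (√(b ^ 2 + m) + √(a ^ 2 + m)) = (b - a) * (b + a) := by
    nlinarith
  by_contra hlt
  push Not at hlt
  have h7 : 0 < √(b ^ 2 + m) + √(a ^ 2 + m) := by
    have := Real.sqrt_pos.2 (show 0 < a ^ 2 + m by positivity)
    positivity
  nlinarith [mul_lt_mul_of_pos_right hlt h7]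

lemma lintegral_ball_ellipse_le {β : ℝ} (hβ : 0 ≤ β) {R : ℝ} (hR : 0 < R) (z ξ : Space)
    (hz : 10 * R ≤ ‖z‖) (hξ : ‖ξ‖ ≤ R) (A : ℝ) :
    ∫⁻ y : Space, (Metric.ball z R).indicator (fun y => japE β (A - (‖y‖ + ‖ξ - y‖))) y ≤
      ENNReal.ofReal (4 ^ β) * (∫⁻ x : ℝ, japE β x) * ENNReal.ofReal (4 * R ^ 2) := by
  set r := ‖z‖ with hr
  have hrp : 0 < r := by linarith
  set e : Space := !₂[r, 0, 0] with he
  have hen : ‖e‖ = r := by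
    simp [he, EuclideanSpace.norm_eq, Fin.sum_univ_three, Real.sqrt_sq hrp.le]
  obtain ⟨T, hT⟩ : ∃ T : Space ≃ₗᵢ[ℝ] Space, T e = z :=
    ⟨(ℝ ∙ (e - z))ᗮ.reflection, Submodule.reflection_sub (by rw [hen])⟩
  set x := T.symm ξ with hx
  have hxn : ‖x‖ ≤ R := by rw [hx, T.symm.norm_map]; exact hξ
  have hTx : T x = ξ := T.apply_symm_apply ξ
  have h1 : ∫⁻ y : Space, (Metric.ball z R).indicator (fun y => japE β (A - (‖y‖ + ‖ξ - y‖))) y =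
      ∫⁻ y : Space, (Metric.ball e R).indicator (fun y => japE β (A - (‖y‖ + ‖x - y‖))) y := by
    rw [← T.measurePreserving.lintegral_comp_emb T.toHomeomorph.measurableEmbedding]
    refine lintegral_congr fun y => ?_
    rw [← hT, ← hTx]
    simp only [Set.indicator, Metric.mem_ball, T.dist_map, T.norm_map, ← map_sub]
  have hm : Measurable ((Metric.ball e R).indicator (fun y => japE β (A - (‖y‖ + ‖x - y‖)))) :=
    Measurable.indicator (by fun_prop) Metric.isOpen_ball.measurableSet
  rw [h1, lintegral_space _ hm]
  have hcoord : ∀ (y : Space) (i : Fin 3), |y i| ≤ ‖y‖ := fun y i => by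
    simpa using PiLp.norm_apply_le y i
  have hball : ∀ a p q : ℝ, !₂[a, p, q] ∈ Metric.ball e R → |a - r| < R ∧ |p| < R ∧ |q| < R := by
    intro a p q h
    rw [Metric.mem_ball, dist_eq_norm] at h
    have h0 := (hcoord (!₂[a, p, q] - e) 0).trans_lt h
    have h1 := (hcoord (!₂[a, p, q] - e) 1).trans_lt h
    have h2 := (hcoord (!₂[a, p, q] - e) 2).trans_lt h
    simp [he] at h0 h1 h2
    exact ⟨h0, h1, h2⟩
  have hswap : Measurable fun q : ℝ × ℝ × ℝ =>
      (Metric.ball e R).indicator (fun y => japE β (A - (‖y‖ + ‖x - y‖))) !₂[q.1, q.2.1, q.2.2] := by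
    refine hm.comp ?_
    refine (PiLp.continuous_toLp 2 _).measurable.comp (measurable_pi_lambda _ fun i => ?_)
    fin_cases i <;> simp <;> fun_prop
  rw [lintegral_lintegral_swap hswap.aemeasurable]
  have hsec : ∀ p : ℝ × ℝ, ∫⁻ a : ℝ,
      (Metric.ball e R).indicator (fun y => japE β (A - (‖y‖ + ‖x - y‖))) !₂[a, p.1, p.2] ≤
      (Set.Ioo (-R) R ×ˢ Set.Ioo (-R) R).indicator
        (fun _ => ENNReal.ofReal (4 ^ β) * (∫⁻ x : ℝ, japE β x)) p := by
    rintro ⟨p, q⟩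
    by_cases hpq : |p| < R ∧ |q| < R
    · rw [Set.indicator_of_mem (by simp only [Set.mem_prod, Set.mem_Ioo, ← abs_lt]; exact hpq)]
      refine le_trans (le_of_eq ?_) (lintegral_japE_expanding_le hβ
        {a : ℝ | !₂[a, p, q] ∈ Metric.ball e R}
        (fun a => ‖!₂[a, p, q]‖ + ‖x - !₂[a, p, q]‖) ?_ A)
      · rfl
      have hn1 : ∀ a : ℝ, ‖!₂[a, p, q]‖ = √(a ^ 2 + (p ^ 2 + q ^ 2)) := fun a => by
        simp [EuclideanSpace.norm_eq, Fin.sum_univ_three, add_assoc]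
      have hn2 : ∀ a : ℝ, ‖x - !₂[a, p, q]‖ =
          √((a - x 0) ^ 2 + ((x 1 - p) ^ 2 + (x 2 - q) ^ 2)) := fun a => by
        simp [EuclideanSpace.norm_eq, Fin.sum_univ_three, add_assoc]
        congr 2
        ring
      have key : ∀ a b : ℝ, a ∈ {a : ℝ | !₂[a, p, q] ∈ Metric.ball e R} → a ≤ b →
          |a - b| ≤ |(‖!₂[a, p, q]‖ + ‖x - !₂[a, p, q]‖) - (‖!₂[b, p, q]‖ + ‖x - !₂[b, p, q]‖)| := by
        intro a b ha hab
        have hc := hball a p q ha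
        have hx0 := (hcoord x 0).trans hxn
        have hx1 := (hcoord x 1).trans hxn
        have hx2 := (hcoord x 2).trans hxn
        rw [abs_lt] at hc
        rw [abs_lt, abs_lt] at hc
        rw [abs_le] at hx0 hx1 hx2
        obtain ⟨⟨c1, c2⟩, ⟨c3, c4⟩, c5, c6⟩ := hc
        have s1 := half_sub_le_sqrt_sub (a := a) (b := b) (m := p ^ 2 + q ^ 2) (by linarith) hab
          (by positivity) (by nlinarith)
        have s2 := half_sub_le_sqrt_sub (a := a - x 0) (b := b - x 0)
          (m := (x 1 - p) ^ 2 + (x 2 - q) ^ 2) (by linarith) (by linarith)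
          (by positivity) (by
            have e1 : (x 1 - p) ^ 2 ≤ (2 * R) ^ 2 := sq_le_sq' (by linarith) (by linarith)
            have e2 : (x 2 - q) ^ 2 ≤ (2 * R) ^ 2 := sq_le_sq' (by linarith) (by linarith)
            nlinarith)
        rw [abs_sub_comm a b, abs_of_nonneg (by linarith), abs_sub_comm]
        refine le_trans ?_ (le_abs_self _)
        rw [hn1, hn1, hn2, hn2]
        linarith
      intro a ha b hb
      rcases le_total a b with hab | hab
      · exact key a b ha hab
      · rw [abs_sub_comm, abs_sub_comm (‖_‖ + _)]
        exact key b a hb hab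
    · have : ∀ a : ℝ, (Metric.ball e R).indicator
          (fun y => japE β (A - (‖y‖ + ‖x - y‖))) !₂[a, p, q] = 0 := fun a =>
        Set.indicator_of_notMem (fun h => hpq (hball a p q h).2) _
      simp [this]
  refine (lintegral_mono hsec).trans (le_of_eq ?_)
  rw [lintegral_indicator (measurableSet_Ioo.prod measurableSet_Ioo), setLIntegral_const,
    Measure.volume_eq_prod, Measure.prod_prod, Real.volume_Ioo, ← ENNReal.ofReal_mul (by linarith)]
  congr 2
  ring

/-- The set where both frequencies lie on the same side, the sum has frequency below `R` and the
first one has frequency at least `16 R`. -/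
def hhlSet (R : ℝ) : Set (SpaceTime × SpaceTime) :=
  {p | 0 ≤ p.1 0 * p.2 0 ∧ ‖spt (p.1 + p.2)‖ < R ∧ 16 * R ≤ nW p.1}

lemma measurableSet_hhlSet (R : ℝ) : MeasurableSet (hhlSet R) := by
  have h1 : MeasurableSet {p : SpaceTime × SpaceTime | 0 ≤ p.1 0 * p.2 0} :=
    measurableSet_le (by fun_prop) (by fun_prop)
  have h2 : MeasurableSet {p : SpaceTime × SpaceTime | ‖spt (p.1 + p.2)‖ < R} :=
    measurableSet_lt (by fun_prop) (by fun_prop)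
  have h3 : MeasurableSet {p : SpaceTime × SpaceTime | 16 * R ≤ nW p.1} :=
    measurableSet_le (by fun_prop) (by fun_prop)
  exact h1.inter (h2.inter h3)

/-- The modulation weights of both factors, restricted to `hhlSet R`. -/
def hhlK (β R : ℝ) (η θ : SpaceTime) : ℝ≥0∞ :=
  (hhlSet R).indicator (fun p => ENNReal.ofReal (dW p.1 ^ (-(β / 2))) *
    ENNReal.ofReal (dW p.2 ^ (-(β / 2)))) (η, θ)

lemma measurable_hhlK (β R : ℝ) : Measurable (Function.uncurry (hhlK β R)) := by
  unfold hhlK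
  simp only [Function.uncurry_def, Prod.mk.eta]
  exact Measurable.indicator (by fun_prop) (measurableSet_hhlSet R)

lemma lintegral_same_side_le {β : ℝ} (hβ : 0 ≤ β) (T p q : ℝ) :
    ∫⁻ t : ℝ, {t | 0 ≤ t * (T - t)}.indicator
      (fun t => japE β (|t| - p) * japE β (|T - t| - q)) t ≤
      ENNReal.ofReal (2 ^ β) * (2 * ∫⁻ x : ℝ, japE β x) *
        (japE β (T - (p + q)) + japE β (-T - (p + q))) := by
  have : ∀ t, {t | 0 ≤ t * (T - t)}.indicator
      (fun t => japE β (|t| - p) * japE β (|T - t| - q)) t ≤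
      japE β (t - p) * japE β ((T - q) - t) + japE β (t - (-p)) * japE β ((T + q) - t) := by
    intro t
    by_cases ht : t ∈ {t | 0 ≤ t * (T - t)}
    swap
    · rw [Set.indicator_of_notMem ht]; exact zero_le
    rw [Set.indicator_of_mem ht]
    rcases mul_nonneg_iff.1 (show 0 ≤ t * (T - t) from ht) with ⟨h1, h2⟩ | ⟨h1, h2⟩
    · rw [abs_of_nonneg h1, abs_of_nonneg h2, sub_right_comm]
      exact le_self_add
    · rw [abs_of_nonpos h1, abs_of_nonpos h2, ← japE_neg β (-t - p), ← japE_neg β (-(T - t) - q),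
        show -(-t - p) = t - -p by ring, show -(-(T - t) - q) = T + q - t by ring]
      exact le_add_self
  refine (lintegral_mono this).trans ?_
  rw [lintegral_add_left (by fun_prop)]
  refine (add_le_add (lintegral_japE_mul_le hβ _ _) (lintegral_japE_mul_le hβ _ _)).trans
    (le_of_eq ?_)
  rw [← mul_add, show T - q - p = T - (p + q) by ring,
    show T + q - -p = -(-T - (p + q)) by ring, japE_neg]

lemma lintegral_hhlK_ball_le {β : ℝ} (hβ : 1 < β) {R : ℝ} (hR : 1 ≤ R) (z : Space) (ζ : SpaceTime) :
    ∫⁻ η, (hhlK β R η (ζ - η) * (Metric.ball z R).indicator 1 (spt η)) ^ 2 ≤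
      ENNReal.ofReal (2 ^ β) * (2 * ∫⁻ x : ℝ, japE β x) * (2 * (ENNReal.ofReal (4 ^ β) *
        (∫⁻ x : ℝ, japE β x) * ENNReal.ofReal (4 * R ^ 2))) := by
  by_cases hz : ‖spt ζ‖ < R ∧ 10 * R ≤ ‖z‖
  · obtain ⟨hξ, hz⟩ := hz
    have h1 : ∀ η, (hhlK β R η (ζ - η) * (Metric.ball z R).indicator 1 (spt η)) ^ 2 ≤
        (Metric.ball z R).indicator 1 (spt η) * {t | 0 ≤ t * (ζ 0 - t)}.indicator
          (fun t => japE β (|t| - ‖spt η‖) * japE β (|ζ 0 - t| - ‖spt ζ - spt η‖)) (η 0) := by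
      intro η
      by_cases hb : spt η ∈ Metric.ball z R
      swap
      · simp [hb]
      rw [Set.indicator_of_mem hb, Pi.one_apply, mul_one, one_mul]
      unfold hhlK
      by_cases hs : (η, ζ - η) ∈ hhlSet R
      swap
      · simp [hs]
      rw [Set.indicator_of_mem hs, Set.indicator_of_mem (show η 0 ∈ {t | 0 ≤ t * (ζ 0 - t)} from hs.1),
        mul_pow, ofReal_rpow_half_sq (one_le_dW _), ofReal_rpow_half_sq (one_le_dW _)]
      rfl
    refine (lintegral_mono h1).trans ?_
    have hmb : Measurable ((Metric.ball z R).indicator (1 : Space → ℝ≥0∞)) :=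
      Measurable.indicator measurable_one Metric.isOpen_ball.measurableSet
    have hm2 : Measurable fun p : ℝ × Space => {t | 0 ≤ t * (ζ 0 - t)}.indicator
          (fun t => japE β (|t| - ‖p.2‖) * japE β (|ζ 0 - t| - ‖spt ζ - p.2‖)) p.1 := by
      have : (fun p : ℝ × Space => {t | 0 ≤ t * (ζ 0 - t)}.indicator
          (fun t => japE β (|t| - ‖p.2‖) * japE β (|ζ 0 - t| - ‖spt ζ - p.2‖)) p.1) =
          {p : ℝ × Space | 0 ≤ p.1 * (ζ 0 - p.1)}.indicator
          (fun p => japE β (|p.1| - ‖p.2‖) * japE β (|ζ 0 - p.1| - ‖spt ζ - p.2‖)) := by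
        ext p; simp [Set.indicator]
      rw [this]
      exact Measurable.indicator (by fun_prop) (measurableSet_le (by fun_prop) (by fun_prop))
    have hmF : Measurable fun η : SpaceTime => (Metric.ball z R).indicator 1 (spt η) *
        {t | 0 ≤ t * (ζ 0 - t)}.indicator
          (fun t => japE β (|t| - ‖spt η‖) * japE β (|ζ 0 - t| - ‖spt ζ - spt η‖)) (η 0) :=
      (hmb.comp measurable_spt).mul
        (hm2.comp (f := fun η : SpaceTime => (η 0, spt η)) (by fun_prop))
    have hmG : Measurable fun p : ℝ × Space => (Metric.ball z R).indicator 1 p.2 *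
        {t | 0 ≤ t * (ζ 0 - t)}.indicator
          (fun t => japE β (|t| - ‖p.2‖) * japE β (|ζ 0 - t| - ‖spt ζ - p.2‖)) p.1 :=
      (hmb.comp measurable_snd).mul hm2
    rw [lintegral_spaceTime _ hmF]
    simp only [spt_stpt, stpt_zero]
    rw [lintegral_lintegral_swap hmG.aemeasurable]
    have h2 : ∀ y : Space, ∫⁻ t : ℝ, (Metric.ball z R).indicator 1 y *
        {t | 0 ≤ t * (ζ 0 - t)}.indicator
          (fun t => japE β (|t| - ‖y‖) * japE β (|ζ 0 - t| - ‖spt ζ - y‖)) t ≤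
        ENNReal.ofReal (2 ^ β) * (2 * ∫⁻ x : ℝ, japE β x) *
        ((Metric.ball z R).indicator (fun y => japE β (ζ 0 - (‖y‖ + ‖spt ζ - y‖))) y +
          (Metric.ball z R).indicator (fun y => japE β (-(ζ 0) - (‖y‖ + ‖spt ζ - y‖))) y) := by
      intro y
      by_cases hb : y ∈ Metric.ball z R
      · simp only [Set.indicator_of_mem hb, Pi.one_apply, one_mul]
        exact lintegral_same_side_le (by linarith) _ _ _
      · simp [hb]
    refine (lintegral_mono h2).trans ?_
    have hc : ENNReal.ofReal (2 ^ β) * (2 * ∫⁻ x : ℝ, japE β x) ≠ ∞ :=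
      ENNReal.mul_ne_top ENNReal.ofReal_ne_top
        (ENNReal.mul_ne_top ENNReal.ofNat_ne_top (lintegral_japE_lt_top hβ).ne)
    have hm3 : ∀ A, Measurable
        ((Metric.ball z R).indicator (fun y => japE β (A - (‖y‖ + ‖spt ζ - y‖)))) := fun A =>
      Measurable.indicator (by fun_prop) Metric.isOpen_ball.measurableSet
    rw [lintegral_const_mul' _ _ hc, lintegral_add_left (hm3 _)]
    gcongr
    rw [two_mul]
    exact add_le_add (lintegral_ball_ellipse_le (by linarith) (by linarith) z _ hz hξ.le _)
      (lintegral_ball_ellipse_le (by linarith) (by linarith) z _ hz hξ.le _)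
  · have : ∀ η, (hhlK β R η (ζ - η) * (Metric.ball z R).indicator 1 (spt η)) ^ 2 = 0 := by
      intro η
      by_cases hb : spt η ∈ Metric.ball z R
      swap
      · simp [hb]
      unfold hhlK
      rw [Set.indicator_of_notMem]
      · simp
      rintro ⟨_, h2, h3⟩
      simp only [add_sub_cancel] at h2
      refine hz ⟨h2, ?_⟩
      have h4 := jap_le_one_add ‖spt η‖
      rw [abs_of_nonneg (norm_nonneg _)] at h4
      simp only [nW] at h3
      rw [Metric.mem_ball, dist_eq_norm] at hb
      have := norm_sub_norm_le (spt η) z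
      linarith
    simp [this]

lemma measurable_ball_indicator (R : ℝ) :
    Measurable fun p : Space × Space => (Metric.ball p.1 R).indicator (1 : Space → ℝ≥0∞) p.2 := by
  have h : MeasurableSet {p : Space × Space | dist p.2 p.1 < R} :=
    measurableSet_lt (by fun_prop) (by fun_prop)
  exact Measurable.indicator (f := fun _ => (1 : ℝ≥0∞)) measurable_const h

lemma lintegral_ball_indicator (R : ℝ) (x : Space) :
    ∫⁻ z : Space, (Metric.ball z R).indicator (1 : Space → ℝ≥0∞) x =
      volume (Metric.ball (0 : Space) R) := by
  have : ∀ z : Space, (Metric.ball z R).indicator (1 : Space → ℝ≥0∞) x =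
      (Metric.ball x R).indicator 1 z := fun z => by
    simp only [Set.indicator, Metric.mem_ball, dist_comm, Pi.one_apply]
  simp_rw [this]
  rw [lintegral_indicator_one Metric.isOpen_ball.measurableSet, Measure.addHaar_ball_center]

lemma lintegral_l2E_ball_sq {a : SpaceTime → ℝ≥0∞} (ha : Measurable a) (R : ℝ) :
    ∫⁻ z : Space, l2E (fun η => a η * (Metric.ball z R).indicator 1 (spt η)) ^ 2 =
      volume (Metric.ball (0 : Space) R) * l2E a ^ 2 := by
  have hm : Measurable fun p : Space × SpaceTime =>
      (a p.2 * (Metric.ball p.1 R).indicator 1 (spt p.2)) ^ 2 := by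
    refine Measurable.pow_const (Measurable.mul (by fun_prop) ?_) 2
    exact (measurable_ball_indicator R).comp (g := fun p : Space × Space =>
      (Metric.ball p.1 R).indicator (1 : Space → ℝ≥0∞) p.2)
      (f := fun p : Space × SpaceTime => (p.1, spt p.2)) (by fun_prop)
  simp_rw [l2E_sq]
  rw [lintegral_lintegral_swap hm.aemeasurable]
  have : ∀ η, ∫⁻ z : Space, (a η * (Metric.ball z R).indicator 1 (spt η)) ^ 2 =
      volume (Metric.ball (0 : Space) R) * a η ^ 2 := fun η => by
    have h : ∀ z : Space, (a η * (Metric.ball z R).indicator 1 (spt η)) ^ 2 =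
        (Metric.ball z R).indicator 1 (spt η) * a η ^ 2 := fun z => by
      by_cases hb : spt η ∈ Metric.ball z R <;> simp [hb]
    simp_rw [h]
    rw [lintegral_mul_const, lintegral_ball_indicator]
    exact (measurable_ball_indicator R).comp (g := fun p : Space × Space =>
      (Metric.ball p.1 R).indicator (1 : Space → ℝ≥0∞) p.2)
      (f := fun z : Space => (z, spt η)) (by fun_prop)
  simp_rw [this]
  rw [lintegral_const_mul _ (by fun_prop)]

lemma exists_hhlK_form_le {β : ℝ} (hβ : 1 < β) : ∃ C : ℝ≥0∞, C ≠ ∞ ∧ ∀ R : ℝ, 1 ≤ R →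
    ∀ a b c : SpaceTime → ℝ≥0∞, Measurable a → Measurable b → Measurable c →
    ∫⁻ η, ∫⁻ θ, hhlK β R η θ * (a η * b θ * c (η + θ)) ≤
      C * ENNReal.ofReal R * (l2E a * l2E b * l2E c) := by
  set J : ℝ≥0∞ := ∫⁻ x : ℝ, japE β x with hJ
  have hJt : J ≠ ∞ := (lintegral_japE_lt_top hβ).ne
  set C₀ : ℝ≥0∞ := ENNReal.ofReal (2 ^ β) * (2 * J) * (2 * (ENNReal.ofReal (4 ^ β) * J * 4)) with hC₀
  have hC₀t : C₀ ≠ ∞ := by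
    rw [hC₀]
    finiteness
  refine ⟨C₀ ^ (1 / 2 : ℝ) * 8 ^ (1 / 2 : ℝ), ENNReal.mul_ne_top
    (ENNReal.rpow_ne_top_of_nonneg (by norm_num) hC₀t)
    (ENNReal.rpow_ne_top_of_nonneg (by norm_num) (by norm_num)), fun R hR a b c ha hb hc => ?_⟩
  set V := volume (Metric.ball (0 : Space) R) with hV
  have hV0 : V ≠ 0 := (Metric.measure_ball_pos volume _ (by linarith)).ne'
  have hVt : V ≠ ∞ := measure_ball_lt_top.ne
  have hV2 : volume (Metric.ball (0 : Space) (2 * R)) = 8 * V := by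
    rw [hV, Measure.addHaar_ball _ _ (by linarith : 0 ≤ 2 * R), Measure.addHaar_ball _ _ (by linarith : 0 ≤ R),
      mul_pow, ENNReal.ofReal_mul (by positivity), mul_assoc]
    congr 1
    simp
    norm_num
  have hcompη : Measurable fun p : Space × SpaceTime =>
      (Metric.ball p.1 R).indicator (1 : Space → ℝ≥0∞) (spt p.2) :=
    (measurable_ball_indicator R).comp (g := fun p : Space × Space =>
      (Metric.ball p.1 R).indicator (1 : Space → ℝ≥0∞) p.2)
      (f := fun p : Space × SpaceTime => (p.1, spt p.2)) (by fun_prop)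
  have hcomp2 : Measurable fun p : Space × SpaceTime =>
      (Metric.ball (-p.1) (2 * R)).indicator (1 : Space → ℝ≥0∞) (spt p.2) :=
    (measurable_ball_indicator (2 * R)).comp (g := fun p : Space × Space =>
      (Metric.ball p.1 (2 * R)).indicator (1 : Space → ℝ≥0∞) p.2)
      (f := fun p : Space × SpaceTime => (-p.1, spt p.2)) (by fun_prop)
  set A : Space → SpaceTime → ℝ≥0∞ := fun z η => a η * (Metric.ball z R).indicator 1 (spt η) with hA
  set B : Space → SpaceTime → ℝ≥0∞ := fun z θ => b θ * (Metric.ball (-z) (2 * R)).indicator 1 (spt θ)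
    with hB
  have hAm : Measurable (Function.uncurry A) := Measurable.mul (by fun_prop) hcompη
  have hBm : Measurable (Function.uncurry B) := Measurable.mul (by fun_prop) hcomp2
  have hAz : ∀ z, Measurable (A z) := fun z => hAm.comp measurable_prodMk_left
  have hBz : ∀ z, Measurable (B z) := fun z => hBm.comp measurable_prodMk_left
  have hlA : Measurable fun z => l2E (A z) := by
    unfold l2E
    refine Measurable.pow_const ?_ _
    exact Measurable.lintegral_prod_right' (f := fun p : Space × SpaceTime => A p.1 p.2 ^ 2)
      (hAm.pow_const 2)
  have hlB : Measurable fun z => l2E (B z) := by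
    unfold l2E
    refine Measurable.pow_const ?_ _
    exact Measurable.lintegral_prod_right' (f := fun p : Space × SpaceTime => B p.1 p.2 ^ 2)
      (hBm.pow_const 2)
  have hKz : ∀ z : Space, Measurable (Function.uncurry fun η θ =>
      hhlK β R η θ * (Metric.ball z R).indicator 1 (spt η)) := fun z =>
    (measurable_hhlK β R).mul (hcompη.comp (f := fun p : SpaceTime × SpaceTime => (z, p.1))
      (by fun_prop))
  have hform : ∀ z, ∫⁻ η, ∫⁻ θ, hhlK β R η θ * (Metric.ball z R).indicator 1 (spt η) *
      (A z η * B z θ * c (η + θ)) ≤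
      (C₀ ^ (1 / 2 : ℝ) * ENNReal.ofReal R) * (l2E (A z) * l2E (B z) * l2E c) := by
    intro z
    refine (lintegral_form_le_of_sum (hKz z) (M := C₀ * ENNReal.ofReal (R ^ 2)) (fun ζ => ?_)
      (hAz z) (hBz z) hc).trans (le_of_eq ?_)
    · refine (lintegral_hhlK_ball_le hβ hR z ζ).trans (le_of_eq ?_)
      rw [hC₀, ENNReal.ofReal_mul (by norm_num)]
      simp only [ENNReal.ofReal_ofNat]
      ring
    · rw [ENNReal.mul_rpow_of_nonneg _ _ (by norm_num), ENNReal.ofReal_rpow_of_nonneg (by positivity)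
        (by norm_num), ← Real.sqrt_eq_rpow, Real.sqrt_sq (by linarith)]
  have hCS : ∫⁻ z : Space, l2E (A z) * l2E (B z) ≤ (8 : ℝ≥0∞) ^ (1 / 2 : ℝ) * V * (l2E a * l2E b) := by
    refine (lintegral_mul_le_l2E _ _ hlA hlB).trans (le_of_eq ?_)
    have e1 : ∫⁻ z : Space, l2E (A z) ^ 2 = V * l2E a ^ 2 := lintegral_l2E_ball_sq ha R
    have e2 : ∫⁻ z : Space, l2E (B z) ^ 2 = 8 * V * l2E b ^ 2 := by
      rw [← hV2, ← lintegral_l2E_ball_sq hb (2 * R)]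
      exact lintegral_neg_eq_self (fun z : Space =>
        l2E (fun η => b η * (Metric.ball z (2 * R)).indicator 1 (spt η)) ^ 2)
    have hs : ∀ x : ℝ≥0∞, (x ^ 2) ^ (1 / 2 : ℝ) = x := fun x => by
      rw [← ENNReal.rpow_natCast, ← ENNReal.rpow_mul]
      simp
    rw [l2E, l2E, e1, e2]
    simp only [ENNReal.mul_rpow_of_nonneg _ _ (show (0 : ℝ) ≤ 1 / 2 by norm_num), hs]
    calc _ = (8 : ℝ≥0∞) ^ (1 / 2 : ℝ) * (V ^ (1 / 2 : ℝ) * V ^ (1 / 2 : ℝ)) * (l2E a * l2E b) := by ring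
      _ = _ := by
        rw [← ENNReal.rpow_add_of_nonneg _ _ (by norm_num) (by norm_num)]
        norm_num
  have hpt : ∀ η θ, V * (hhlK β R η θ * (a η * b θ * c (η + θ))) =
      ∫⁻ z : Space, hhlK β R η θ * (Metric.ball z R).indicator 1 (spt η) *
        (A z η * B z θ * c (η + θ)) := by
    intro η θ
    by_cases hs : (η, θ) ∈ hhlSet R
    swap
    · have : hhlK β R η θ = 0 := Set.indicator_of_notMem hs _
      simp [this]
    have : ∀ z : Space, hhlK β R η θ * (Metric.ball z R).indicator 1 (spt η) *
        (A z η * B z θ * c (η + θ)) = (Metric.ball z R).indicator 1 (spt η) *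
        (hhlK β R η θ * (a η * b θ * c (η + θ))) := by
      intro z
      by_cases hz : spt η ∈ Metric.ball z R
      · have hz2 : spt θ ∈ Metric.ball (-z) (2 * R) := by
          have h2 := hs.2.1
          simp only [spt_add] at h2
          rw [Metric.mem_ball, dist_eq_norm] at hz ⊢
          calc ‖spt θ - -z‖ = ‖(spt η + spt θ) - (spt η - z)‖ := by congr 1; abel
            _ ≤ ‖spt η + spt θ‖ + ‖spt η - z‖ := norm_sub_le _ _
            _ < 2 * R := by linarith
        simp [hA, hB, hz, hz2]
      · simp [hz]
    simp_rw [this]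
    have hz : Measurable fun z : Space => (Metric.ball z R).indicator (1 : Space → ℝ≥0∞) (spt η) :=
      hcompη.comp (f := fun z : Space => (z, η)) (by fun_prop)
    rw [lintegral_mul_const _ hz, lintegral_ball_indicator]
  have hmain : V * ∫⁻ η, ∫⁻ θ, hhlK β R η θ * (a η * b θ * c (η + θ)) ≤
      V * (C₀ ^ (1 / 2 : ℝ) * 8 ^ (1 / 2 : ℝ) * ENNReal.ofReal R * (l2E a * l2E b * l2E c)) := by
    have hbig : Measurable fun p : (SpaceTime × SpaceTime) × Space =>
        hhlK β R p.1.1 p.1.2 * (Metric.ball p.2 R).indicator 1 (spt p.1.1) *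
        (A p.2 p.1.1 * B p.2 p.1.2 * c (p.1.1 + p.1.2)) := by
      refine Measurable.mul (Measurable.mul ?_ ?_) (Measurable.mul (Measurable.mul ?_ ?_) (by fun_prop))
      · exact (measurable_hhlK β R).comp measurable_fst
      · exact hcompη.comp (f := fun p : (SpaceTime × SpaceTime) × Space => (p.2, p.1.1)) (by fun_prop)
      · exact hAm.comp (f := fun p : (SpaceTime × SpaceTime) × Space => (p.2, p.1.1)) (by fun_prop)
      · exact hBm.comp (f := fun p : (SpaceTime × SpaceTime) × Space => (p.2, p.1.2)) (by fun_prop)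
    calc _ = ∫⁻ η, ∫⁻ θ, ∫⁻ z : Space, hhlK β R η θ * (Metric.ball z R).indicator 1 (spt η) *
          (A z η * B z θ * c (η + θ)) := by
          simp_rw [← hpt]
          rw [← lintegral_const_mul' _ _ hVt]
          refine lintegral_congr fun η => ?_
          rw [← lintegral_const_mul' _ _ hVt]
      _ = ∫⁻ z : Space, ∫⁻ η, ∫⁻ θ, hhlK β R η θ * (Metric.ball z R).indicator 1 (spt η) *
          (A z η * B z θ * c (η + θ)) := by
          have h1 : ∀ η, ∫⁻ θ, ∫⁻ z : Space, hhlK β R η θ * (Metric.ball z R).indicator 1 (spt η) *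
              (A z η * B z θ * c (η + θ)) = ∫⁻ z : Space, ∫⁻ θ, hhlK β R η θ *
              (Metric.ball z R).indicator 1 (spt η) * (A z η * B z θ * c (η + θ)) := fun η =>
            lintegral_lintegral_swap (hbig.comp (f := fun p : SpaceTime × Space => ((η, p.1), p.2))
              (by fun_prop)).aemeasurable
          simp_rw [h1]
          refine lintegral_lintegral_swap (Measurable.aemeasurable ?_)
          exact Measurable.lintegral_prod_right' (f := fun p : (SpaceTime × Space) × SpaceTime =>
            hhlK β R p.1.1 p.2 * (Metric.ball p.1.2 R).indicator 1 (spt p.1.1) *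
            (A p.1.2 p.1.1 * B p.1.2 p.2 * c (p.1.1 + p.2)))
            (hbig.comp (f := fun p : (SpaceTime × Space) × SpaceTime => ((p.1.1, p.2), p.1.2))
              (by fun_prop))
      _ ≤ ∫⁻ z : Space, (C₀ ^ (1 / 2 : ℝ) * ENNReal.ofReal R * l2E c) * (l2E (A z) * l2E (B z)) :=
          lintegral_mono fun z => (hform z).trans (le_of_eq (by ring))
      _ = (C₀ ^ (1 / 2 : ℝ) * ENNReal.ofReal R * l2E c) * ∫⁻ z : Space, l2E (A z) * l2E (B z) :=
          lintegral_const_mul _ (hlA.mul hlB)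
      _ ≤ _ := (mul_le_mul_right hCS _).trans (le_of_eq (by ring))
  exact (ENNReal.mul_le_mul_iff_right hV0 hVt).1 hmain

/-- Interaction of two same-side high frequencies with low-frequency output. -/
def oK (β : ℝ) (η θ : SpaceTime) : ℝ≥0∞ :=
  {p : SpaceTime × SpaceTime | 0 ≤ p.1 0 * p.2 0 ∧ 32 * nW (p.1 + p.2) ≤ nW p.1}.indicator
    (fun p => ENNReal.ofReal (nW (p.1 + p.2) ^ (-((1 + β) / 2)) *
      (dW p.1 ^ (-(β / 2)) * dW p.2 ^ (-(β / 2))))) (η, θ)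

lemma measurable_oK (β : ℝ) : Measurable (Function.uncurry (oK β)) := by
  unfold oK
  simp only [Function.uncurry_def, Prod.mk.eta]
  have h1 : MeasurableSet {p : SpaceTime × SpaceTime | 0 ≤ p.1 0 * p.2 0} :=
    measurableSet_le (by fun_prop) (by fun_prop)
  have h2 : MeasurableSet {p : SpaceTime × SpaceTime | 32 * nW (p.1 + p.2) ≤ nW p.1} :=
    measurableSet_le (by fun_prop) (by fun_prop)
  exact Measurable.indicator (by fun_prop) (h1.inter h2)

lemma oK_le_tsum {β : ℝ} (hβ : 1 < β) (η θ : SpaceTime) : oK β η θ ≤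
    ∑' k : ℕ, ENNReal.ofReal ((2 : ℝ) ^ (-((1 + β) / 2) * k)) * hhlK β (2 ^ (k + 1)) η θ := by
  unfold oK
  by_cases hs : (η, θ) ∈ {p : SpaceTime × SpaceTime | 0 ≤ p.1 0 * p.2 0 ∧ 32 * nW (p.1 + p.2) ≤ nW p.1}
  swap
  · rw [Set.indicator_of_notMem hs]; exact zero_le
  rw [Set.indicator_of_mem hs]
  obtain ⟨h1, h2⟩ := hs
  simp only at h1 h2 ⊢
  obtain ⟨k, hk1, hk2⟩ := exists_nat_pow_near (one_le_nW (η + θ)) (by norm_num : (1 : ℝ) < 2)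
  refine le_trans ?_ (ENNReal.le_tsum k)
  have hmem : (η, θ) ∈ hhlSet (2 ^ (k + 1)) := by
    refine ⟨h1, ?_, ?_⟩
    · have := abs_le_jap ‖spt (η + θ)‖
      rw [abs_of_nonneg (norm_nonneg _)] at this
      exact this.trans_lt hk2
    · simp only
      rw [pow_succ]
      linarith
  rw [hhlK, Set.indicator_of_mem hmem, ENNReal.ofReal_mul (by have := one_le_nW (η + θ); positivity),
    ENNReal.ofReal_mul (by have := one_le_dW η; positivity)]
  gcongr
  rw [mul_comm, Real.rpow_mul (by norm_num), Real.rpow_natCast]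
  exact Real.rpow_le_rpow_of_nonpos (by positivity) hk1 (by linarith)

lemma triBdd_oK {β : ℝ} (hβ : 1 < β) : TriBdd (oK β) := by
  obtain ⟨C, hC, h⟩ := exists_hhlK_form_le hβ
  set q : ℝ := 2 ^ ((1 - β) / 2) with hq
  have hq0 : 0 < q := by positivity
  have hq1 : q < 1 := Real.rpow_lt_one_of_one_lt_of_neg (by norm_num) (by linarith)
  refine ⟨∑' k : ℕ, C * ENNReal.ofReal 2 * ENNReal.ofReal q ^ k, ?_, fun a b c ha hb hc => ?_⟩
  · rw [ENNReal.tsum_mul_left, ENNReal.tsum_geometric]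
    refine ENNReal.mul_ne_top (ENNReal.mul_ne_top hC ENNReal.ofReal_ne_top) (ENNReal.inv_ne_top.2 ?_)
    rw [← ENNReal.ofReal_one, ← ENNReal.ofReal_sub _ hq0.le]
    exact (ENNReal.ofReal_pos.2 (by linarith)).ne'
  have hKm : ∀ k : ℕ, Measurable fun p : SpaceTime × SpaceTime =>
      ENNReal.ofReal ((2 : ℝ) ^ (-((1 + β) / 2) * k)) *
        (hhlK β (2 ^ (k + 1)) p.1 p.2 * (a p.1 * b p.2 * c (p.1 + p.2))) := fun k =>
    ((measurable_hhlK β _).mul (by fun_prop)).const_mul _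
  calc ∫⁻ η, ∫⁻ θ, oK β η θ * (a η * b θ * c (η + θ))
      ≤ ∫⁻ η, ∫⁻ θ, ∑' k : ℕ, ENNReal.ofReal ((2 : ℝ) ^ (-((1 + β) / 2) * k)) *
        (hhlK β (2 ^ (k + 1)) η θ * (a η * b θ * c (η + θ))) := by
        refine lintegral_mono fun η => lintegral_mono fun θ => ?_
        refine (mul_le_mul_left (oK_le_tsum hβ η θ) _).trans (le_of_eq ?_)
        rw [← ENNReal.tsum_mul_right]
        simp_rw [mul_assoc]
    _ = ∑' k : ℕ, ENNReal.ofReal ((2 : ℝ) ^ (-((1 + β) / 2) * k)) *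
        ∫⁻ η, ∫⁻ θ, hhlK β (2 ^ (k + 1)) η θ * (a η * b θ * c (η + θ)) := by
        have h1 : ∀ η, ∫⁻ θ, ∑' k : ℕ, ENNReal.ofReal ((2 : ℝ) ^ (-((1 + β) / 2) * k)) *
            (hhlK β (2 ^ (k + 1)) η θ * (a η * b θ * c (η + θ))) =
            ∑' k : ℕ, ∫⁻ θ, ENNReal.ofReal ((2 : ℝ) ^ (-((1 + β) / 2) * k)) *
            (hhlK β (2 ^ (k + 1)) η θ * (a η * b θ * c (η + θ))) := fun η =>
          lintegral_tsum fun k => ((hKm k).comp measurable_prodMk_left).aemeasurable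
        simp_rw [h1]
        rw [lintegral_tsum fun k => (Measurable.lintegral_prod_right' (hKm k)).aemeasurable]
        refine tsum_congr fun k => ?_
        rw [← lintegral_const_mul' _ _ ENNReal.ofReal_ne_top]
        refine lintegral_congr fun η => ?_
        rw [← lintegral_const_mul' _ _ ENNReal.ofReal_ne_top]
    _ ≤ ∑' k : ℕ, (C * ENNReal.ofReal 2 * ENNReal.ofReal q ^ k) * (l2E a * l2E b * l2E c) := by
        refine ENNReal.tsum_le_tsum fun k => ?_
        refine (mul_le_mul_right (h (2 ^ (k + 1)) (one_le_pow₀ (by norm_num)) a b c ha hb hc) _).trans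
          (le_of_eq ?_)
        have : ENNReal.ofReal ((2 : ℝ) ^ (-((1 + β) / 2) * k)) * ENNReal.ofReal (2 ^ (k + 1)) =
            ENNReal.ofReal 2 * ENNReal.ofReal q ^ k := by
          rw [← ENNReal.ofReal_mul (by positivity), ← ENNReal.ofReal_pow hq0.le,
            ← ENNReal.ofReal_mul (by norm_num)]
          congr 1
          rw [hq, ← Real.rpow_natCast, ← Real.rpow_natCast, ← Real.rpow_add (by norm_num),
            ← Real.rpow_mul (by norm_num)]
          rw [show -((1 + β) / 2) * (k : ℝ) + ((k + 1 : ℕ) : ℝ) = 1 + (1 - β) / 2 * k by push_cast; ring,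
            Real.rpow_add (by norm_num), Real.rpow_one]
        calc _ = C * (ENNReal.ofReal ((2 : ℝ) ^ (-((1 + β) / 2) * k)) * ENNReal.ofReal (2 ^ (k + 1))) *
              (l2E a * l2E b * l2E c) := by ring
          _ = _ := by rw [this]; ring
    _ = _ := ENNReal.tsum_mul_right

section LogKernel

/-- Relations between the logarithms of the frequencies `n`, modulations `d`, elliptic weights `p`
of the output `0` and the inputs `1`, `2`, and the logarithm `l` of the null symbol; `sg` says
that the inputs lie on the same side of the light cone. -/
structure LogRel (c : ℝ) (sg : Prop) (n0 n1 n2 d0 d1 d2 p0 p1 p2 l : ℝ) : Prop where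
  n0_nonneg : 0 ≤ n0
  n1_nonneg : 0 ≤ n1
  n2_nonneg : 0 ≤ n2
  d0_nonneg : 0 ≤ d0
  d1_nonneg : 0 ≤ d1
  d2_nonneg : 0 ≤ d2
  n1_le_p1 : n1 ≤ p1
  n2_le_p2 : n2 ≤ p2
  d0_le_p0 : d0 ≤ p0
  n0_le : n0 ≤ n1 + c ∨ n0 ≤ n2 + c
  n1_le : n1 ≤ n0 + c ∨ n1 ≤ n2 + c
  n2_le : n2 ≤ n0 + c ∨ n2 ≤ n1 + c
  p0_le : p0 ≤ p1 + c ∨ p0 ≤ p2 + c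
  d0_le_left : d0 ≤ n1 + d1 + d2 + c
  d0_le_right : d0 ≤ n2 + d1 + d2 + c
  l_le : l ≤ p1 + p2
  l_le_max : l ≤ p0 + d0 + c ∧ p1 + d1 ≤ p0 + d0 ∧ p2 + d2 ≤ p0 + d0 ∨ l ≤ p1 + d1 + c ∨
    l ≤ p2 + d2 + c
  p0_le_of_not : ¬ sg → p0 ≤ n0 + c ∨ p0 ≤ d1 + c ∨ p0 ≤ d2 + c

/-- All the logarithms of the model kernels lie below `t`. -/
structure LogBelow (ε o : ℝ) (sg : Prop) (n0 n1 n2 d0 d1 d2 t : ℝ) : Prop where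
  s012 : 1 / 2 * n0 - (1 + ε) * n1 - (1 / 2 + ε) * d1 - 1 / 2 * n2 - (1 / 2 + ε) * d2 < t
  s021 : 1 / 2 * n0 - (1 + ε) * n2 - (1 / 2 + ε) * d2 - 1 / 2 * n1 - (1 / 2 + ε) * d1 < t
  s102 : 1 / 2 * n1 - (1 + ε) * n0 - (1 / 2 + ε) * d0 - 1 / 2 * n2 - (1 / 2 + ε) * d2 < t
  s201 : 1 / 2 * n2 - (1 + ε) * n0 - (1 / 2 + ε) * d0 - 1 / 2 * n1 - (1 / 2 + ε) * d1 < t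
  s120 : 1 / 2 * n1 - (1 + ε) * n2 - (1 / 2 + ε) * d2 - 1 / 2 * n0 - (1 / 2 + ε) * d0 < t
  s210 : 1 / 2 * n2 - (1 + ε) * n1 - (1 / 2 + ε) * d1 - 1 / 2 * n0 - (1 / 2 + ε) * d0 < t
  t10 : -(3 / 2 + ε) * n1 - (1 / 2 + ε) * d0 < t
  t20 : -(3 / 2 + ε) * n2 - (1 / 2 + ε) * d0 < t
  t01 : -(3 / 2 + ε) * n0 - (1 / 2 + ε) * d1 < t
  t02 : -(3 / 2 + ε) * n0 - (1 / 2 + ε) * d2 < t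
  o12 : sg → n0 + o ≤ n1 → -(1 + ε) * n0 - (1 / 2 + ε) * d1 - (1 / 2 + ε) * d2 < t
  o21 : sg → n0 + o ≤ n2 → -(1 + ε) * n0 - (1 / 2 + ε) * d1 - (1 / 2 + ε) * d2 < t

/-- Logarithm of the kernel of the null form estimate. -/
def logKer (ε s r n0 n1 n2 d0 d1 d2 p1 p2 l : ℝ) : ℝ :=
  (r - 1) * n0 - (1 / 2 - 2 * ε) * d0 + l - (s - 1) * (n1 + n2) - p1 - p2 -
    (3 / 4 + ε) * (d1 + d2)

variable {c o ε s r n0 n1 n2 d0 d1 d2 p0 p1 p2 l t : ℝ} {sg : Prop}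

lemma logKer_swap : logKer ε s r n0 n2 n1 d0 d2 d1 p2 p1 l =
    logKer ε s r n0 n1 n2 d0 d1 d2 p1 p2 l := by
  unfold logKer; ring

lemma LogRel.swap (h : LogRel c sg n0 n1 n2 d0 d1 d2 p0 p1 p2 l) :
    LogRel c sg n0 n2 n1 d0 d2 d1 p0 p2 p1 l where
  n0_nonneg := h.n0_nonneg
  n1_nonneg := h.n2_nonneg
  n2_nonneg := h.n1_nonneg
  d0_nonneg := h.d0_nonneg
  d1_nonneg := h.d2_nonneg
  d2_nonneg := h.d1_nonneg
  n1_le_p1 := h.n2_le_p2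
  n2_le_p2 := h.n1_le_p1
  d0_le_p0 := h.d0_le_p0
  n0_le := h.n0_le.symm
  n1_le := h.n2_le
  n2_le := h.n1_le
  p0_le := h.p0_le.symm
  d0_le_left := by linarith [h.d0_le_right]
  d0_le_right := by linarith [h.d0_le_left]
  l_le := by linarith [h.l_le]
  l_le_max := by have := h.l_le_max; tauto
  p0_le_of_not := by have := h.p0_le_of_not; tauto

lemma LogBelow.swap (h : LogBelow ε o sg n0 n1 n2 d0 d1 d2 t) :
    LogBelow ε o sg n0 n2 n1 d0 d2 d1 t where
  s012 := h.s021
  s021 := h.s012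
  s102 := h.s201
  s201 := h.s102
  s120 := h.s210
  s210 := h.s120
  t10 := h.t20
  t20 := h.t10
  t01 := h.t02
  t02 := h.t01
  o12 := fun h1 h2 => by linarith [h.o21 h1 h2]
  o21 := fun h1 h2 => by linarith [h.o12 h1 h2]

/-- The case where the first input dominates the null symbol. -/
lemma logKer_le_of_left (hc : 0 ≤ c) (hε : 0 < ε) (hε' : ε ≤ 1 / 10000)
    (h : LogRel c sg n0 n1 n2 d0 d1 d2 p0 p1 p2 l) (hl : l ≤ p1 + d1 + c) :
    logKer ε s r n0 n1 n2 d0 d1 d2 p1 p2 l ≤ (r - 1) * n0 + (1 - s) * n1 +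
      (1 / 4 - s + 5 * ε) * n2 - (1 / 2 + ε) * d0 - (3 / 4 - 2 * ε) * d2 + 2 * c := by
  have e1 := mul_le_mul_of_nonneg_left hl (show 0 ≤ 3 / 4 - 2 * ε by linarith)
  have e2 := mul_le_mul_of_nonneg_left h.l_le (show 0 ≤ 1 / 4 + 2 * ε by linarith)
  have e3 := mul_le_mul_of_nonneg_left h.n2_le_p2 (show 0 ≤ 3 / 4 - 2 * ε by linarith)
  have e4 := mul_le_mul_of_nonneg_left h.d0_le_right hε.le
  have e5 := mul_nonneg hε.le hc
  have e6 := mul_le_mul_of_nonneg_right hε' hc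
  unfold logKer
  nlinarith

/-- The case where the output dominates the null symbol. -/
lemma logKer_le_of_zero (hc : 0 ≤ c) (hε : 0 < ε) (hε' : ε ≤ 1 / 10000)
    (h : LogRel c sg n0 n1 n2 d0 d1 d2 p0 p1 p2 l) (hl : l ≤ p0 + d0 + c) :
    logKer ε s r n0 n1 n2 d0 d1 d2 p1 p2 l ≤ (r - 1) * n0 + (1 - s) * (n1 + n2) -
      (1 / 2 - 2 * ε) * min n1 n2 - (3 / 4 + ε) * (d1 + d2) + 2 * c := by
  have hm : p0 - p1 - p2 ≤ - min n1 n2 + c := by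
    rcases h.p0_le with hp | hp
    · linarith [min_le_right n1 n2, h.n2_le_p2]
    · linarith [min_le_left n1 n2, h.n1_le_p1]
  have e1 := mul_le_mul_of_nonneg_left hl (show 0 ≤ 1 / 2 - 2 * ε by linarith)
  have e2 := mul_le_mul_of_nonneg_left h.l_le (show 0 ≤ 1 / 2 + 2 * ε by linarith)
  have e3 := mul_le_mul_of_nonneg_left hm (show 0 ≤ 1 / 2 - 2 * ε by linarith)
  have e5 := mul_nonneg hε.le hc
  unfold logKer
  linarith

/-- The model kernels dominate at the first endpoint if the first input is dominant. -/
lemma false_of_left₀ (hc : 0 ≤ c) (hε : 0 < ε) (hε' : ε ≤ 1 / 10000)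
    (h : LogRel c sg n0 n1 n2 d0 d1 d2 p0 p1 p2 l)
    (hb : LogBelow ε o sg n0 n1 n2 d0 d1 d2 (t - 10 * c)) (hl : l ≤ p1 + d1 + c)
    (ht : t ≤ logKer ε (3 / 2 + 100 * ε) (3 / 2 + 100 * ε) n0 n1 n2 d0 d1 d2 p1 p2 l) : False := by
  have hK := ht.trans (logKer_le_of_left hc hε hε' h hl)
  obtain ⟨a0, a1, a2, b0, b1, b2, -, -, -, hn0, hn1, hn2, -, -, -, -, -, -⟩ := h
  obtain ⟨-, -, s102, -, s120, -, t10, -, -, -, -, -⟩ := hb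
  have a0' := mul_nonneg hε.le a0
  have a1' := mul_nonneg hε.le a1
  have a2' := mul_nonneg hε.le a2
  have b2' := mul_nonneg hε.le b2
  have hc' := mul_nonneg hε.le hc
  have c1 := mul_le_mul_of_nonneg_right hε' hc
  have c2 := mul_le_mul_of_nonneg_right hε' b2
  have c3 := mul_le_mul_of_nonneg_right hε' a2
  rcases hn0 with hn0 | hn0
  · have hn0' := mul_le_mul_of_nonneg_left hn0 hε.le
    rcases hn1 with hn1 | hn1
    · have hn1' := mul_le_mul_of_nonneg_left hn1 hε.le
      nlinarith
    · have hn1' := mul_le_mul_of_nonneg_left hn1 hε.le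
      nlinarith
  · have hn0' := mul_le_mul_of_nonneg_left hn0 hε.le
    rcases le_total (3 / 4 * n2) n1 with hh | hh
    · have hh' := mul_le_mul_of_nonneg_left hh hε.le
      rcases hn2 with hn2 | hn2
      · have hn2' := mul_le_mul_of_nonneg_left hn2 hε.le
        nlinarith
      · have hn2' := mul_le_mul_of_nonneg_left hn2 hε.le
        nlinarith
    · have hh' := mul_le_mul_of_nonneg_left hh hε.le
      nlinarith

/-- The model kernels dominate at the second endpoint if the first input is dominant. -/
lemma false_of_left₁ (hc : 0 ≤ c) (hε : 0 < ε) (hε' : ε ≤ 1 / 10000)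
    (h : LogRel c sg n0 n1 n2 d0 d1 d2 p0 p1 p2 l)
    (hb : LogBelow ε o sg n0 n1 n2 d0 d1 d2 (t - 10 * c)) (hl : l ≤ p1 + d1 + c)
    (ht : t ≤ logKer ε (3 / 4 + 100 * ε) (100 * ε) n0 n1 n2 d0 d1 d2 p1 p2 l) : False := by
  have hK := ht.trans (logKer_le_of_left hc hε hε' h hl)
  obtain ⟨a0, a1, a2, b0, b1, b2, -, -, -, hn0, hn1, hn2, -, -, -, -, -, -⟩ := h
  obtain ⟨-, -, s102, -, s120, -, t10, -, -, -, -, -⟩ := hb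
  have a0' := mul_nonneg hε.le a0
  have a1' := mul_nonneg hε.le a1
  have a2' := mul_nonneg hε.le a2
  have b2' := mul_nonneg hε.le b2
  have hc' := mul_nonneg hε.le hc
  have c1 := mul_le_mul_of_nonneg_right hε' hc
  have c2 := mul_le_mul_of_nonneg_right hε' b2
  have c3 := mul_le_mul_of_nonneg_right hε' a2
  have c4 := mul_le_mul_of_nonneg_right hε' a0
  have c5 := mul_le_mul_of_nonneg_right hε' a1
  rcases le_total n2 n0 with hh | hh
  · have hh' := mul_le_mul_of_nonneg_left hh hε.le
    rcases hn1 with hn1 | hn1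
    · have hn1' := mul_le_mul_of_nonneg_left hn1 hε.le
      nlinarith
    · have hn1' := mul_le_mul_of_nonneg_left hn1 hε.le
      nlinarith
  · have hh' := mul_le_mul_of_nonneg_left hh hε.le
    rcases hn2 with hn2 | hn2
    · have hn2' := mul_le_mul_of_nonneg_left hn2 hε.le
      rcases le_total (1 / 2 * n2) n1 with hx | hx
      · have hx' := mul_le_mul_of_nonneg_left hx hε.le
        nlinarith
      · have hx' := mul_le_mul_of_nonneg_left hx hε.le
        nlinarith
    · have hn2' := mul_le_mul_of_nonneg_left hn2 hε.le
      rcases hn1 with hn1 | hn1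
      · have hn1' := mul_le_mul_of_nonneg_left hn1 hε.le
        nlinarith
      · have hn1' := mul_le_mul_of_nonneg_left hn1 hε.le
        nlinarith

/-- The model kernels dominate at the first endpoint if the output is dominant. -/
lemma false_of_zero₀ (hc : 0 ≤ c) (hε : 0 < ε) (hε' : ε ≤ 1 / 10000)
    (h : LogRel c sg n0 n1 n2 d0 d1 d2 p0 p1 p2 l)
    (hb : LogBelow ε o sg n0 n1 n2 d0 d1 d2 (t - 10 * c)) (hl : l ≤ p0 + d0 + c)
    (ht : t ≤ logKer ε (3 / 2 + 100 * ε) (3 / 2 + 100 * ε) n0 n1 n2 d0 d1 d2 p1 p2 l) : False := by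
  have hK := ht.trans (logKer_le_of_zero hc hε hε' h hl)
  obtain ⟨a0, a1, a2, b0, b1, b2, -, -, -, hn0, hn1, hn2, -, -, -, -, -, -⟩ := h
  obtain ⟨s012, s021, -, -, -, -, -, -, -, -, -, -⟩ := hb
  have a0' := mul_nonneg hε.le a0
  have a1' := mul_nonneg hε.le a1
  have a2' := mul_nonneg hε.le a2
  have hc' := mul_nonneg hε.le hc
  have c1 := mul_le_mul_of_nonneg_right hε' hc
  rcases le_total n1 n2 with hh | hh
  · have hh' := mul_le_mul_of_nonneg_left hh hε.le
    rw [min_eq_left hh] at hK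
    rcases hn0 with hn0 | hn0
    · have hn0' := mul_le_mul_of_nonneg_left hn0 hε.le
      nlinarith
    · have hn0' := mul_le_mul_of_nonneg_left hn0 hε.le
      nlinarith
  · have hh' := mul_le_mul_of_nonneg_left hh hε.le
    rw [min_eq_right hh] at hK
    rcases hn0 with hn0 | hn0
    · have hn0' := mul_le_mul_of_nonneg_left hn0 hε.le
      nlinarith
    · have hn0' := mul_le_mul_of_nonneg_left hn0 hε.le
      nlinarith

/-- The model kernels dominate at the second endpoint if the output is dominant. -/
lemma false_of_zero₁ (hc : 0 ≤ c) (hco : c < o) (hoc : o ≤ 5 * c) (hε : 0 < ε) (hε' : ε ≤ 1 / 10000)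
    (h : LogRel c sg n0 n1 n2 d0 d1 d2 p0 p1 p2 l)
    (hb : LogBelow ε o sg n0 n1 n2 d0 d1 d2 (t - 30 * c)) (hl : l ≤ p0 + d0 + c)
    (hl1 : p1 + d1 ≤ p0 + d0) (hl2 : p2 + d2 ≤ p0 + d0)
    (ht : t ≤ logKer ε (3 / 4 + 100 * ε) (100 * ε) n0 n1 n2 d0 d1 d2 p1 p2 l) : False := by
  have hK := ht.trans (logKer_le_of_zero hc hε hε' h hl)
  obtain ⟨a0, a1, a2, b0, b1, b2, np1, np2, dp0, hn0, hn1, hn2, hp0, -, -, hlp, -, hop⟩ := h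
  obtain ⟨s012, s021, -, -, -, -, -, -, t01, t02, o12, o21⟩ := hb
  have a0' := mul_nonneg hε.le a0
  have a1' := mul_nonneg hε.le a1
  have a2' := mul_nonneg hε.le a2
  have hc' := mul_nonneg hε.le hc
  have c1 := mul_le_mul_of_nonneg_right hε' hc
  have c4 := mul_le_mul_of_nonneg_right hε' a0
  have c5 := mul_le_mul_of_nonneg_right hε' a1
  have c6 := mul_le_mul_of_nonneg_right hε' a2
  have c7 := mul_le_mul_of_nonneg_left hoc hε.le
  by_cases hcomp : n1 < n0 + o ∧ n2 < n0 + o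
  · obtain ⟨k1, k2⟩ := hcomp
    have k1' := mul_le_mul_of_nonneg_left k1.le (show 0 ≤ 3 / 4 - 97 * ε by linarith)
    have k2' := mul_le_mul_of_nonneg_left k2.le (show 0 ≤ 3 / 4 - 97 * ε by linarith)
    have c8 := mul_nonneg hε.le (show 0 ≤ o by linarith)
    rcases le_total n1 n2 with hh | hh
    · rw [min_eq_left hh] at hK
      linarith
    · rw [min_eq_right hh] at hK
      linarith
  have key : n0 + o ≤ n1 ∨ n0 + o ≤ n2 := by
    by_contra hcon
    push Not at hcon
    exact hcomp hcon
  have hle : n1 ≤ n2 + c ∧ n2 ≤ n1 + c := by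
    rcases key with k | k
    · refine ⟨?_, ?_⟩
      · rcases hn1 with hn1 | hn1 <;> linarith
      · rcases hn2 with hn2 | hn2 <;> linarith
    · refine ⟨?_, ?_⟩
      · rcases hn1 with hn1 | hn1 <;> linarith
      · rcases hn2 with hn2 | hn2 <;> linarith
  obtain ⟨m1, m2⟩ := hle
  have m1' := mul_le_mul_of_nonneg_left m1 hε.le
  have m2' := mul_le_mul_of_nonneg_left m2 hε.le
  have k : n0 ≤ n1 + c ∧ n0 ≤ n2 + c := by
    rcases key with k | k <;> constructor <;> linarith
  obtain ⟨k1, k2⟩ := k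
  have k1' := mul_le_mul_of_nonneg_left k1 hε.le
  have k2' := mul_le_mul_of_nonneg_left k2 hε.le
  have hmin : n1 - c ≤ min n1 n2 := le_min (by linarith) (by linarith)
  have hmin' := mul_le_mul_of_nonneg_left hmin (show 0 ≤ 1 / 2 - 2 * ε by linarith)
  have b1' := mul_nonneg hε.le b1
  have b2' := mul_nonneg hε.le b2
  by_cases hsg : sg
  · rcases key with k | k
    · have := o12 hsg k
      linarith
    · have := o21 hsg k
      linarith
  rcases hop hsg with hp | hp | hp
  · have e0 : d0 ≤ n0 + c := by linarith
    have e0' := mul_le_mul_of_nonneg_left e0 hε.le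
    have dl : l ≤ n0 + d0 + 2 * c := by linarith
    unfold logKer at ht
    linarith
  · have e1 : n1 - 2 * c ≤ d1 := by linarith
    have e1' := mul_le_mul_of_nonneg_left e1 hε.le
    linarith
  · have e1 : n2 - 2 * c ≤ d2 := by linarith
    have e1' := mul_le_mul_of_nonneg_left e1 hε.le
    linarith

lemma LogBelow.mono {t' : ℝ} (h : LogBelow ε o sg n0 n1 n2 d0 d1 d2 t) (ht : t ≤ t') :
    LogBelow ε o sg n0 n1 n2 d0 d1 d2 t' where
  s012 := h.s012.trans_le ht
  s021 := h.s021.trans_le ht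
  s102 := h.s102.trans_le ht
  s201 := h.s201.trans_le ht
  s120 := h.s120.trans_le ht
  s210 := h.s210.trans_le ht
  t10 := h.t10.trans_le ht
  t20 := h.t20.trans_le ht
  t01 := h.t01.trans_le ht
  t02 := h.t02.trans_le ht
  o12 := fun h1 h2 => (h.o12 h1 h2).trans_le ht
  o21 := fun h1 h2 => (h.o21 h1 h2).trans_le ht

lemma false_of_endpoint₀ (hc : 0 ≤ c) (hε : 0 < ε) (hε' : ε ≤ 1 / 10000)
    (h : LogRel c sg n0 n1 n2 d0 d1 d2 p0 p1 p2 l)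
    (hb : LogBelow ε o sg n0 n1 n2 d0 d1 d2 (t - 30 * c))
    (ht : t ≤ logKer ε (3 / 2 + 100 * ε) (3 / 2 + 100 * ε) n0 n1 n2 d0 d1 d2 p1 p2 l) : False := by
  have hb' := hb.mono (show t - 30 * c ≤ t - 10 * c by linarith)
  rcases h.l_le_max with hl | hl | hl
  · exact false_of_zero₀ hc hε hε' h hb' hl.1 ht
  · exact false_of_left₀ hc hε hε' h hb' hl ht
  · exact false_of_left₀ hc hε hε' h.swap hb'.swap hl (ht.trans logKer_swap.ge)

lemma false_of_endpoint₁ (hc : 0 ≤ c) (hco : c < o) (hoc : o ≤ 5 * c) (hε : 0 < ε)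
    (hε' : ε ≤ 1 / 10000) (h : LogRel c sg n0 n1 n2 d0 d1 d2 p0 p1 p2 l)
    (hb : LogBelow ε o sg n0 n1 n2 d0 d1 d2 (t - 30 * c))
    (ht : t ≤ logKer ε (3 / 4 + 100 * ε) (100 * ε) n0 n1 n2 d0 d1 d2 p1 p2 l) : False := by
  have hb' := hb.mono (show t - 30 * c ≤ t - 10 * c by linarith)
  rcases h.l_le_max with hl | hl | hl
  · exact false_of_zero₁ hc hco hoc hε hε' h hb hl.1 hl.2.1 hl.2.2 ht
  · exact false_of_left₁ hc hε hε' h hb' hl ht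
  · exact false_of_left₁ hc hε hε' h.swap hb'.swap hl (ht.trans logKer_swap.ge)

lemma false_of_logBelow (hc : 0 ≤ c) (hco : c < o) (hoc : o ≤ 5 * c) (hε : 0 < ε)
    (hε' : ε ≤ 1 / 10000) (hsr : r ≤ s) (h1 : 3 / 2 + 100 * ε ≤ 2 * s - r) (h2 : 3 / 4 + 100 * ε ≤ s)
    (h : LogRel c sg n0 n1 n2 d0 d1 d2 p0 p1 p2 l)
    (hb : LogBelow ε o sg n0 n1 n2 d0 d1 d2
      (logKer ε s r n0 n1 n2 d0 d1 d2 p1 p2 l - (30 + 2 * |s| + |r| + 2) * c)) : False := by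
  have a0 := h.n0_nonneg
  have hn : n0 - n1 - n2 ≤ c := by
    rcases h.n0_le with hn | hn <;> linarith [h.n1_nonneg, h.n2_nonneg]
  have hs := le_abs_self s
  have hr := neg_abs_le r
  by_cases hp : 3 / 4 ≤ s - r
  · refine false_of_endpoint₁
      (t := logKer ε s r n0 n1 n2 d0 d1 d2 p1 p2 l - (2 * |s| + |r| + 2) * c)
      hc hco hoc hε hε' h (hb.mono (by linarith)) ?_
    have e1 := mul_le_mul_of_nonneg_left hn (show 0 ≤ s - 3 / 4 - 100 * ε by linarith)
    have e2 := mul_nonneg (show 0 ≤ s - 3 / 4 - r by linarith) a0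
    have e3 := mul_le_mul_of_nonneg_right (show s - 3 / 4 - 100 * ε ≤ 2 * |s| + |r| + 2 by
      linarith [abs_nonneg r]) hc
    unfold logKer
    linarith
  · push Not at hp
    set a := logKer ε (3 / 2 + 100 * ε) (3 / 2 + 100 * ε) n0 n1 n2 d0 d1 d2 p1 p2 l with ha
    set b := logKer ε (3 / 4 + 100 * ε) (100 * ε) n0 n1 n2 d0 d1 d2 p1 p2 l with hb'
    have e1 := mul_le_mul_of_nonneg_left hn (show 0 ≤ 2 * s - r - 3 / 2 - 100 * ε by linarith)
    have e3 := mul_le_mul_of_nonneg_right (show 2 * s - r - 3 / 2 - 100 * ε ≤ 2 * |s| + |r| + 2 by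
      linarith) hc
    have key : logKer ε s r n0 n1 n2 d0 d1 d2 p1 p2 l - (2 * |s| + |r| + 2) * c ≤
        (1 - 4 / 3 * (s - r)) * a + 4 / 3 * (s - r) * b := by
      rw [ha, hb']
      unfold logKer
      linarith
    rcases le_total a b with hab | hab
    · have := mul_le_mul_of_nonneg_left hab (show 0 ≤ 1 - 4 / 3 * (s - r) by linarith)
      exact false_of_endpoint₁
        (t := logKer ε s r n0 n1 n2 d0 d1 d2 p1 p2 l - (2 * |s| + |r| + 2) * c)
        hc hco hoc hε hε' h (hb.mono (by linarith)) (by linarith)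
    · have := mul_le_mul_of_nonneg_left hab (show 0 ≤ 4 / 3 * (s - r) by linarith)
      exact false_of_endpoint₀
        (t := logKer ε s r n0 n1 n2 d0 d1 d2 p1 p2 l - (2 * |s| + |r| + 2) * c)
        hc hε hε' h (hb.mono (by linarith)) (by linarith)

end LogKernel

/-- The symbol of the null form `Q₀`. -/
def nullQ (η θ : SpaceTime) : ℝ := ⟪spt η, spt θ⟫ - η 0 * θ 0

@[fun_prop] lemma continuous_nullQ : Continuous (Function.uncurry nullQ) := by
  unfold nullQ Function.uncurry
  fun_prop

@[fun_prop] lemma measurable_nullQ : Measurable (Function.uncurry nullQ) :=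
  continuous_nullQ.measurable

lemma nullQ_eq (η θ : SpaceTime) : 2 * nullQ η θ =
    (‖spt (η + θ)‖ ^ 2 - (η + θ) 0 ^ 2) - (‖spt η‖ ^ 2 - η 0 ^ 2) - (‖spt θ‖ ^ 2 - θ 0 ^ 2) := by
  have h : (η + θ) 0 = η 0 + θ 0 := rfl
  rw [spt_add, norm_add_sq_real, h, nullQ]
  ring

lemma abs_sq_sub_sq_le (X : SpaceTime) : |‖spt X‖ ^ 2 - X 0 ^ 2| ≤ pW X * dW X := by
  have h : ‖spt X‖ ^ 2 - X 0 ^ 2 = -((|X 0| + ‖spt X‖) * (|X 0| - ‖spt X‖)) := by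
    rw [← sq_abs (X 0)]
    ring
  rw [h, abs_neg, abs_mul]
  exact mul_le_mul (abs_le_jap _) (abs_le_jap _) (abs_nonneg _) (jap_pos _).le

lemma nW_le_pW (X : SpaceTime) : nW X ≤ pW X :=
  jap_le_jap (by
    rw [abs_of_nonneg (norm_nonneg _), abs_of_nonneg (by positivity)]
    linarith [abs_nonneg (X 0)])

lemma dW_le_pW (X : SpaceTime) : dW X ≤ pW X :=
  jap_le_jap (by
    rw [abs_of_nonneg (by positivity : 0 ≤ |X 0| + ‖spt X‖), abs_le]
    constructor <;> linarith [abs_nonneg (X 0), norm_nonneg (spt X)])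

lemma nW_add_le (η θ : SpaceTime) : nW (η + θ) ≤ nW η + nW θ := by
  unfold nW
  refine (jap_le_jap ?_).trans (jap_add_le' ‖spt η‖ ‖spt θ‖)
  rw [abs_of_nonneg (norm_nonneg _), abs_of_nonneg (by positivity), spt_add]
  exact norm_add_le _ _

lemma nW_le_add_left (η θ : SpaceTime) : nW η ≤ nW (η + θ) + nW θ := by
  simpa [nW_neg] using nW_add_le (η + θ) (-θ)

lemma pW_add_le (η θ : SpaceTime) : pW (η + θ) ≤ pW η + pW θ := by
  unfold pW
  refine (jap_le_jap ?_).trans (jap_add_le' _ _)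
  have h : (η + θ) 0 = η 0 + θ 0 := rfl
  rw [abs_of_nonneg (by positivity : 0 ≤ |(η + θ) 0| + ‖spt (η + θ)‖),
    abs_of_nonneg (by positivity : 0 ≤ |η 0| + ‖spt η‖ + (|θ 0| + ‖spt θ‖)), spt_add, h]
  linarith [norm_add_le (spt η) (spt θ), abs_add_le (η 0) (θ 0)]

lemma dW_add_le (η θ : SpaceTime) : dW (η + θ) ≤ 5 * (nW η * dW η * dW θ) := by
  have h1 : dW (η + θ) ≤ 1 + (2 * nW η + dW η + dW θ) := by
    refine (jap_le_one_add _).trans ?_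
    have a1 : |(|η 0| - ‖spt η‖)| ≤ dW η := abs_le_jap _
    have a2 : |(|θ 0| - ‖spt θ‖)| ≤ dW θ := abs_le_jap _
    have a3 : ‖spt η‖ ≤ nW η := (le_abs_self _).trans (abs_le_jap _)
    have h : (η + θ) 0 = η 0 + θ 0 := rfl
    have b1 := norm_add_le (spt η) (spt θ)
    have b2 : ‖spt θ‖ ≤ ‖spt η + spt θ‖ + ‖spt η‖ := by
      simpa using norm_sub_le (spt η + spt θ) (spt η)
    have b3 := abs_add_le (η 0) (θ 0)
    have b4 : |θ 0| ≤ |η 0 + θ 0| + |η 0| := by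
      simpa using abs_sub (η 0 + θ 0) (η 0)
    rw [h, spt_add]
    rw [abs_le] at a1 a2
    have : |(|η 0 + θ 0| - ‖spt η + spt θ‖)| ≤ 2 * nW η + dW η + dW θ := by
      rw [abs_le]
      constructor <;> linarith
    linarith
  have e1 := one_le_nW η
  have e2 := one_le_dW η
  have e3 := one_le_dW θ
  have f1 : 1 ≤ dW η * dW θ := one_le_mul_of_one_le_of_one_le e2 e3
  have f2 : 1 ≤ nW η * dW θ := one_le_mul_of_one_le_of_one_le e1 e3
  have f3 : 1 ≤ nW η * dW η := one_le_mul_of_one_le_of_one_le e1 e2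
  nlinarith

lemma abs_nullQ_le_mul (η θ : SpaceTime) : |nullQ η θ| ≤ pW η * pW θ := by
  have h1 := abs_real_inner_le_norm (spt η) (spt θ)
  have h2 : |nullQ η θ| ≤ ‖spt η‖ * ‖spt θ‖ + |η 0| * |θ 0| := by
    unfold nullQ
    rw [← abs_mul]
    exact (abs_sub _ _).trans (by linarith)
  have a1 : |η 0| + ‖spt η‖ ≤ pW η := (le_abs_self _).trans (abs_le_jap _)
  have a2 : |θ 0| + ‖spt θ‖ ≤ pW θ := (le_abs_self _).trans (abs_le_jap _)
  have := mul_le_mul a1 a2 (by positivity) (jap_pos _).le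
  nlinarith [mul_nonneg (abs_nonneg (η 0)) (norm_nonneg (spt θ)),
    mul_nonneg (abs_nonneg (θ 0)) (norm_nonneg (spt η))]

lemma abs_nullQ_le (η θ : SpaceTime) : 2 * |nullQ η θ| ≤
    pW (η + θ) * dW (η + θ) + pW η * dW η + pW θ * dW θ := by
  have h : 2 * |nullQ η θ| = |2 * nullQ η θ| := by rw [abs_mul, abs_two]
  rw [h, nullQ_eq]
  have h0 := abs_sq_sub_sq_le (η + θ)
  have h1 := abs_sq_sub_sq_le η
  have h2 := abs_sq_sub_sq_le θ
  exact (abs_sub _ _).trans (add_le_add ((abs_sub _ _).trans (add_le_add h0 h1)) h2)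

lemma pW_add_le_of_neg {η θ : SpaceTime} (h : ¬ 0 ≤ η 0 * θ 0) :
    pW (η + θ) ≤ 1 + (2 * nW (η + θ) + dW η + dW θ) := by
  refine (jap_le_one_add _).trans ?_
  have a1 : |(|η 0| - ‖spt η‖)| ≤ dW η := abs_le_jap _
  have a2 : |(|θ 0| - ‖spt θ‖)| ≤ dW θ := abs_le_jap _
  have a3 : ‖spt (η + θ)‖ ≤ nW (η + θ) := (le_abs_self _).trans (abs_le_jap _)
  have h' : (η + θ) 0 = η 0 + θ 0 := rfl
  have b1 : ‖spt η‖ ≤ ‖spt (η + θ)‖ + ‖spt θ‖ := by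
    rw [spt_add]; simpa using norm_sub_le (spt η + spt θ) (spt θ)
  have b2 : ‖spt θ‖ ≤ ‖spt (η + θ)‖ + ‖spt η‖ := by
    rw [spt_add]; simpa using norm_sub_le (spt η + spt θ) (spt η)
  have b3 : |η 0 + θ 0| ≤ |(|η 0| - |θ 0|)| := by
    rcases le_total 0 (η 0) with u | u <;> rcases le_total 0 (θ 0) with v | v
    · exact absurd (mul_nonneg u v) h
    · rw [abs_of_nonneg u, abs_of_nonpos v, sub_neg_eq_add]
    · rw [abs_of_nonpos u, abs_of_nonneg v, abs_sub_comm, sub_neg_eq_add, add_comm]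
    · exact absurd (mul_nonneg_of_nonpos_of_nonpos u v) h
  rw [abs_le] at a1 a2
  have b4 : |(|η 0| - |θ 0|)| ≤ ‖spt (η + θ)‖ + dW η + dW θ := by
    rw [abs_le]
    constructor <;> linarith
  rw [abs_of_nonneg (by positivity : 0 ≤ |(η + θ) 0| + ‖spt (η + θ)‖), h']
  linarith

lemma log_le_log_add {x y c : ℝ} (hx : 0 < x) (hy : 0 < y) (hc : 0 < c) (h : x ≤ c * y) :
    Real.log x ≤ Real.log y + Real.log c := by
  rw [add_comm, ← Real.log_mul hc.ne' hy.ne']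
  exact Real.log_le_log hx h

lemma log_le_or_of_le_add {x y z : ℝ} (hx : 0 < x) (hy : 0 < y) (hz : 0 < z) (h : x ≤ y + z) :
    Real.log x ≤ Real.log y + Real.log 8 ∨ Real.log x ≤ Real.log z + Real.log 8 := by
  rcases le_total y z with u | u
  · exact .inr (log_le_log_add hx hz (by norm_num) (by linarith))
  · exact .inl (log_le_log_add hx hy (by norm_num) (by linarith))

lemma nW_pos (X : SpaceTime) : 0 < nW X := jap_pos _
lemma dW_pos (X : SpaceTime) : 0 < dW X := jap_pos _
lemma pW_pos (X : SpaceTime) : 0 < pW X := jap_pos _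

lemma logRel_nullQ {η θ : SpaceTime} (hq : nullQ η θ ≠ 0) :
    LogRel (Real.log 8) (0 ≤ η 0 * θ 0) (Real.log (nW (η + θ))) (Real.log (nW η))
      (Real.log (nW θ)) (Real.log (dW (η + θ))) (Real.log (dW η)) (Real.log (dW θ))
      (Real.log (pW (η + θ))) (Real.log (pW η)) (Real.log (pW θ)) (Real.log |nullQ η θ|) where
  n0_nonneg := Real.log_nonneg (one_le_nW _)
  n1_nonneg := Real.log_nonneg (one_le_nW _)
  n2_nonneg := Real.log_nonneg (one_le_nW _)
  d0_nonneg := Real.log_nonneg (one_le_dW _)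
  d1_nonneg := Real.log_nonneg (one_le_dW _)
  d2_nonneg := Real.log_nonneg (one_le_dW _)
  n1_le_p1 := Real.log_le_log (nW_pos _) (nW_le_pW _)
  n2_le_p2 := Real.log_le_log (nW_pos _) (nW_le_pW _)
  d0_le_p0 := Real.log_le_log (dW_pos _) (dW_le_pW _)
  n0_le := log_le_or_of_le_add (nW_pos _) (nW_pos _) (nW_pos _) (nW_add_le η θ)
  n1_le := log_le_or_of_le_add (nW_pos _) (nW_pos _) (nW_pos _) (nW_le_add_left η θ)
  n2_le := log_le_or_of_le_add (nW_pos _) (nW_pos _) (nW_pos _) (by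
    rw [add_comm η θ]; exact nW_le_add_left θ η)
  p0_le := log_le_or_of_le_add (pW_pos _) (pW_pos _) (pW_pos _) (pW_add_le η θ)
  d0_le_left := by
    have := dW_add_le η θ
    have e1 := nW_pos η
    have e2 := dW_pos η
    have e3 := dW_pos θ
    have h : 0 < nW η * dW η * dW θ := by positivity
    rw [← Real.log_mul e1.ne' e2.ne', ← Real.log_mul (mul_pos e1 e2).ne' e3.ne']
    exact log_le_log_add (dW_pos _) h (by norm_num) (by linarith)
  d0_le_right := by
    have := dW_add_le θ η
    have e1 := nW_pos θ
    have e2 := dW_pos η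
    have e3 := dW_pos θ
    have h : 0 < nW θ * dW η * dW θ := by positivity
    rw [← Real.log_mul e1.ne' e2.ne', ← Real.log_mul (mul_pos e1 e2).ne' e3.ne']
    rw [add_comm θ η] at this
    exact log_le_log_add (dW_pos _) h (by norm_num) (by linarith)
  l_le := by
    rw [← Real.log_mul (pW_pos _).ne' (pW_pos _).ne']
    exact Real.log_le_log (abs_pos.2 hq) (abs_nullQ_le_mul η θ)
  l_le_max := by
    have h := abs_nullQ_le η θ
    have hl := abs_pos.2 hq
    have g0 := mul_pos (pW_pos (η + θ)) (dW_pos (η + θ))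
    have g1 := mul_pos (pW_pos η) (dW_pos η)
    have g2 := mul_pos (pW_pos θ) (dW_pos θ)
    rw [← Real.log_mul (pW_pos _).ne' (dW_pos _).ne', ← Real.log_mul (pW_pos _).ne' (dW_pos _).ne',
      ← Real.log_mul (pW_pos _).ne' (dW_pos _).ne']
    by_cases u : pW η * dW η ≤ pW (η + θ) * dW (η + θ)
    · by_cases v : pW θ * dW θ ≤ pW (η + θ) * dW (η + θ)
      · exact .inl ⟨log_le_log_add hl g0 (by norm_num) (by linarith), Real.log_le_log g1 u,
          Real.log_le_log g2 v⟩
      · exact .inr (.inr (log_le_log_add hl g2 (by norm_num) (by linarith)))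
    · rcases le_total (pW η * dW η) (pW θ * dW θ) with v | v
      · exact .inr (.inr (log_le_log_add hl g2 (by norm_num) (by linarith)))
      · exact .inr (.inl (log_le_log_add hl g1 (by norm_num) (by linarith)))
  p0_le_of_not hn := by
    have h := pW_add_le_of_neg hn
    have e0 := one_le_nW (η + θ)
    have e1 := nW_pos (η + θ)
    have e2 := dW_pos η
    have e3 := dW_pos θ
    have e4 := pW_pos (η + θ)
    by_cases u : dW η ≤ nW (η + θ)
    · by_cases v : dW θ ≤ nW (η + θ)
      · exact .inl (log_le_log_add e4 e1 (by norm_num) (by linarith))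
      · exact .inr (.inr (log_le_log_add e4 e3 (by norm_num) (by linarith)))
    · rcases le_total (dW η) (dW θ) with v | v
      · exact .inr (.inr (log_le_log_add e4 e3 (by norm_num) (by linarith)))
      · exact .inr (.inl (log_le_log_add e4 e2 (by norm_num) (by linarith)))

/-- The Fourier weight of the space `F^s`. -/
def fW (ε s : ℝ) (X : SpaceTime) : ℝ := nW X ^ (s - 1) * dW X ^ (3 / 4 + ε) * pW X

lemma fW_pos (ε s : ℝ) (X : SpaceTime) : 0 < fW ε s X :=
  mul_pos (mul_pos (Real.rpow_pos_of_pos (nW_pos X) _) (Real.rpow_pos_of_pos (dW_pos X) _))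
    (pW_pos X)

/-- The Fourier weight of the left-hand side of the null form estimate. -/
def gW (ε r : ℝ) (X : SpaceTime) : ℝ := nW X ^ (r - 1) * dW X ^ (2 * ε - 1 / 2)

lemma gW_pos (ε r : ℝ) (X : SpaceTime) : 0 < gW ε r X :=
  mul_pos (Real.rpow_pos_of_pos (nW_pos X) _) (Real.rpow_pos_of_pos (dW_pos X) _)

@[fun_prop] lemma measurable_fW (ε s : ℝ) : Measurable (fW ε s) := by
  unfold fW
  fun_prop

@[fun_prop] lemma measurable_gW (ε s : ℝ) : Measurable (gW ε s) := by
  unfold gW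
  fun_prop

/-- The kernel of the null form estimate. -/
def nullK (ε s r : ℝ) (η θ : SpaceTime) : ℝ :=
  gW ε r (η + θ) * |nullQ η θ| / (fW ε s η * fW ε s θ)

lemma rpow_eq_exp_mul_log {x : ℝ} (hx : 0 < x) (a : ℝ) : x ^ a = Real.exp (a * Real.log x) := by
  rw [Real.rpow_def_of_pos hx, mul_comm]

lemma nullK_eq_exp {ε s r : ℝ} {η θ : SpaceTime} (hq : nullQ η θ ≠ 0) :
    nullK ε s r η θ = Real.exp (logKer ε s r (Real.log (nW (η + θ))) (Real.log (nW η))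
      (Real.log (nW θ)) (Real.log (dW (η + θ))) (Real.log (dW η)) (Real.log (dW θ))
      (Real.log (pW η)) (Real.log (pW θ)) (Real.log |nullQ η θ|)) := by
  unfold nullK gW fW
  simp only [rpow_eq_exp_mul_log (nW_pos _), rpow_eq_exp_mul_log (dW_pos _)]
  nth_rw 1 [← Real.exp_log (abs_pos.2 hq), ← Real.exp_log (pW_pos η), ← Real.exp_log (pW_pos θ)]
  simp only [← Real.exp_add, ← Real.exp_sub]
  congr 1
  unfold logKer
  ring

lemma sK_eq_exp (ε : ℝ) (X Y Z : SpaceTime) : sK (1 + 2 * ε) X Y Z = Real.exp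
    (1 / 2 * Real.log (nW X) - (1 + ε) * Real.log (nW Y) - (1 / 2 + ε) * Real.log (dW Y)
      - 1 / 2 * Real.log (nW Z) - (1 / 2 + ε) * Real.log (dW Z)) := by
  unfold sK
  simp only [rpow_eq_exp_mul_log (nW_pos _), rpow_eq_exp_mul_log (dW_pos _), ← Real.exp_add]
  congr 1
  ring

lemma tK_eq_exp (ε : ℝ) (Y Z : SpaceTime) : tK (1 + 2 * ε) Y Z = Real.exp
    (-(3 / 2 + ε) * Real.log (nW Y) - (1 / 2 + ε) * Real.log (dW Z)) := by
  unfold tK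
  simp only [rpow_eq_exp_mul_log (nW_pos _), rpow_eq_exp_mul_log (dW_pos _), ← Real.exp_add]
  congr 1
  ring

lemma oK_eq_exp (ε : ℝ) {η θ : SpaceTime} (h : 0 ≤ η 0 * θ 0)
    (h' : Real.log (nW (η + θ)) + Real.log 32 ≤ Real.log (nW η)) :
    oK (1 + 2 * ε) η θ = ENNReal.ofReal (Real.exp (-(1 + ε) * Real.log (nW (η + θ))
      - (1 / 2 + ε) * Real.log (dW η) - (1 / 2 + ε) * Real.log (dW θ))) := by
  have h2 : 32 * nW (η + θ) ≤ nW η := by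
    rw [add_comm, ← Real.log_mul (by norm_num) (nW_pos _).ne'] at h'
    exact (Real.log_le_log_iff (mul_pos (by norm_num) (nW_pos _)) (nW_pos _)).1 h'
  unfold oK
  rw [Set.indicator_of_mem (by exact ⟨h, h2⟩)]
  congr 1
  simp only [rpow_eq_exp_mul_log (nW_pos _), rpow_eq_exp_mul_log (dW_pos _), ← Real.exp_add]
  congr 1
  ring

/-- The sum of the model kernels dominating the kernel of the null form estimate. -/
def modelK (β : ℝ) (η θ : SpaceTime) : ℝ≥0∞ :=
  ENNReal.ofReal (sK β (η + θ) η θ) + ENNReal.ofReal (sK β η (η + θ) θ) +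
    ENNReal.ofReal (sK β η θ (η + θ)) + ENNReal.ofReal (tK β (η + θ) θ) +
    ENNReal.ofReal (tK β η (η + θ)) + oK β η θ

lemma measurable_modelK (β : ℝ) : Measurable (Function.uncurry (modelK β)) := by
  have := measurable_oK β
  unfold modelK Function.uncurry at *
  fun_prop

lemma triBdd_modelK {β : ℝ} (hβ : 1 < β) : TriBdd (modelK β) := by
  unfold modelK
  refine TriBdd.add ?_ (TriBdd.add ?_ (TriBdd.add ?_ (TriBdd.add ?_ (TriBdd.add ?_
    (triBdd_sK_zero hβ) (triBdd_sK_left hβ)) (triBdd_sK_left' hβ)) (triBdd_tK_sum_right hβ))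
    (triBdd_tK_left_sum hβ)) (triBdd_oK hβ) <;> unfold Function.uncurry <;> fun_prop

lemma lt_sub_of_mul_lt {B K L : ℝ} {M : ℝ≥0∞} (h : ENNReal.ofReal (Real.exp B) * M <
    ENNReal.ofReal (Real.exp K)) (hL : ENNReal.ofReal (Real.exp L) ≤ M) : L < K - B := by
  have h1 : ENNReal.ofReal (Real.exp B) * ENNReal.ofReal (Real.exp L) <
    ENNReal.ofReal (Real.exp K) := lt_of_le_of_lt (mul_le_mul_right hL _) h
  rw [← ENNReal.ofReal_mul (Real.exp_pos _).le, ← Real.exp_add,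
    ENNReal.ofReal_lt_ofReal_iff (Real.exp_pos _), Real.exp_lt_exp] at h1
  linarith

lemma nullK_le_modelK {ε s r : ℝ} (hε : 0 < ε) (hε' : ε ≤ 1 / 10000) (hsr : r ≤ s)
    (h1 : 3 / 2 + 100 * ε ≤ 2 * s - r) (h2 : 3 / 4 + 100 * ε ≤ s) (η θ : SpaceTime) :
    ENNReal.ofReal (nullK ε s r η θ) ≤
      ENNReal.ofReal (Real.exp ((30 + 2 * |s| + |r| + 2) * Real.log 8)) *
        (modelK (1 + 2 * ε) η θ + modelK (1 + 2 * ε) θ η) := by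
  by_cases hq : nullQ η θ = 0
  · simp [nullK, hq]
  by_contra! hlt
  rw [nullK_eq_exp hq] at hlt
  have hm : ∀ {L : ℝ}, ENNReal.ofReal (Real.exp L) ≤ modelK (1 + 2 * ε) η θ → L < _ := fun h =>
    lt_sub_of_mul_lt hlt (h.trans le_self_add)
  have hm' : ∀ {L : ℝ}, ENNReal.ofReal (Real.exp L) ≤ modelK (1 + 2 * ε) θ η → L < _ := fun h =>
    lt_sub_of_mul_lt hlt (h.trans le_add_self)
  have u1 : ∀ η θ, ENNReal.ofReal (sK (1 + 2 * ε) (η + θ) η θ) ≤ modelK (1 + 2 * ε) η θ :=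
    fun η θ => by
      unfold modelK; simp only [add_assoc]; exact le_self_add
  have u2 : ∀ η θ, ENNReal.ofReal (sK (1 + 2 * ε) η (η + θ) θ) ≤ modelK (1 + 2 * ε) η θ :=
    fun η θ => by
      unfold modelK; simp only [add_assoc]; exact le_add_left le_self_add
  have u3 : ∀ η θ, ENNReal.ofReal (sK (1 + 2 * ε) η θ (η + θ)) ≤ modelK (1 + 2 * ε) η θ :=
    fun η θ => by
      unfold modelK; simp only [add_assoc]; exact le_add_left (le_add_left le_self_add)
  have u4 : ∀ η θ, ENNReal.ofReal (tK (1 + 2 * ε) (η + θ) θ) ≤ modelK (1 + 2 * ε) η θ :=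
    fun η θ => by
      unfold modelK; simp only [add_assoc]
      exact le_add_left (le_add_left (le_add_left le_self_add))
  have u5 : ∀ η θ, ENNReal.ofReal (tK (1 + 2 * ε) η (η + θ)) ≤ modelK (1 + 2 * ε) η θ :=
    fun η θ => by
      unfold modelK; simp only [add_assoc]
      exact le_add_left (le_add_left (le_add_left (le_add_left le_self_add)))
  have u6 : ∀ η θ, oK (1 + 2 * ε) η θ ≤ modelK (1 + 2 * ε) η θ :=
    fun η θ => le_add_self
  have hc : Real.log 8 < Real.log 32 := Real.log_lt_log (by norm_num) (by norm_num)
  have hco : Real.log 32 ≤ 5 * Real.log 8 := by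
    have : (5 : ℝ) * Real.log 8 = Real.log (8 ^ 5) := by rw [Real.log_pow]; norm_num
    rw [this]
    exact Real.log_le_log (by norm_num) (by norm_num)
  refine false_of_logBelow (Real.log_nonneg (by norm_num)) hc hco hε hε' hsr h1 h2
    (logRel_nullQ hq) ⟨?_, ?_, ?_, ?_, ?_, ?_, ?_, ?_, ?_, ?_, ?_, ?_⟩
  · refine hm (le_trans ?_ (u1 η θ)); rw [sK_eq_exp]
  · refine hm' (le_trans ?_ (u1 θ η)); rw [sK_eq_exp, add_comm θ η]
  · refine hm (le_trans ?_ (u2 η θ)); rw [sK_eq_exp]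
  · refine hm' (le_trans ?_ (u2 θ η)); rw [sK_eq_exp, add_comm θ η]
  · refine hm (le_trans ?_ (u3 η θ)); rw [sK_eq_exp]
  · refine hm' (le_trans ?_ (u3 θ η)); rw [sK_eq_exp, add_comm θ η]
  · refine hm (le_trans ?_ (u5 η θ)); rw [tK_eq_exp]
  · refine hm' (le_trans ?_ (u5 θ η)); rw [tK_eq_exp, add_comm θ η]
  · refine hm' (le_trans ?_ (u4 θ η)); rw [tK_eq_exp, add_comm θ η]
  · refine hm (le_trans ?_ (u4 η θ)); rw [tK_eq_exp]
  · intro hs hn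
    refine hm (le_trans ?_ (u6 η θ)); rw [oK_eq_exp ε hs hn]
  · intro hs hn
    refine hm' (le_trans ?_ (u6 θ η))
    rw [oK_eq_exp ε (by rwa [mul_comm]) (by rwa [add_comm θ η]), add_comm θ η]
    refine ENNReal.ofReal_le_ofReal (Real.exp_le_exp.2 (le_of_eq ?_))
    ring

/-- The trilinear form with kernel `nullK` is bounded on `L²`. -/
lemma triBdd_nullK {ε s r : ℝ} (hε : 0 < ε) (hε' : ε ≤ 1 / 10000) (hsr : r ≤ s)
    (h1 : 3 / 2 + 100 * ε ≤ 2 * s - r) (h2 : 3 / 4 + 100 * ε ≤ s) :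
    TriBdd fun η θ => ENNReal.ofReal (nullK ε s r η θ) := by
  have hβ : 1 < 1 + 2 * ε := by linarith
  exact TriBdd.mono (TriBdd.add (measurable_modelK _) (triBdd_modelK hβ)
    (TriBdd.swap (measurable_modelK _) (triBdd_modelK hβ))) _ ENNReal.ofReal_ne_top
    (nullK_le_modelK hε hε' hsr h1 h2)

open scoped ContDiff in
lemma hasTemperateGrowth_rpow_of_one_le {D : Type*} [NormedAddCommGroup D] [NormedSpace ℝ D]
    {f : D → ℝ} (hf : f.HasTemperateGrowth) (h1 : ∀ x, 1 ≤ f x) (r : ℝ) :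
    (fun x => f x ^ r).HasTemperateGrowth := by
  set t := {y : ℝ | 1 / 2 < y}
  have ht : Set.range f ⊆ t := by
    rintro - ⟨y, rfl⟩
    exact lt_of_lt_of_le (by norm_num) (h1 y)
  have hdiff : ContDiffOn ℝ ∞ (fun x ↦ x ^ r) t :=
    contDiffOn_fun_id.rpow_const_of_ne fun x hx ↦ (lt_trans (by norm_num) hx).ne'
  have hunique : UniqueDiffOn ℝ t := (isOpen_lt' (1 / 2)).uniqueDiffOn
  refine Function.HasTemperateGrowth.comp' (g := fun x : ℝ => x ^ r) ht hunique hdiff ?_ hf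
  intro N
  obtain ⟨k, hk⟩ := exists_nat_ge (max r <| (N - r) * Real.log 2 / (Real.log (3 / 2)))
  have hk₁ : r ≤ k := le_sup_left.trans hk
  have hl : 0 < Real.log (3 / 2) := Real.log_pos (by norm_num)
  have hk₂ : Real.log 2 * (N - r) ≤ (Real.log (3 / 2)) * k := by
    have := le_sup_right.trans hk
    rw [div_le_iff₀ hl] at this
    linarith
  refine ⟨k, ∑ k ∈ Finset.range (N + 1), ‖Polynomial.eval r (descPochhammer ℝ k)‖,
    by positivity, fun n hn x hx => ?_⟩
  have hx' : 1 / 2 < x := hx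
  have hx'' : 0 < x := lt_of_lt_of_le (by norm_num) hx'.le
  have : ContDiffAt ℝ n (fun x ↦ x ^ r) x :=
    Real.contDiffAt_rpow_const <| Or.inl hx''.ne'
  rw [norm_iteratedFDerivWithin_eq_norm_iteratedDerivWithin,
    iteratedDerivWithin_eq_iteratedDeriv hunique this hx, iteratedDeriv_eq_iterate,
    Real.iter_deriv_rpow_const, norm_mul]
  gcongr 1
  · have : n ∈ Finset.range (N + 1) := by grind
    apply Finset.single_le_sum (fun _ _ ↦ by positivity) this
  simp only [Real.norm_eq_abs]
  apply (Real.abs_rpow_le_abs_rpow _ _).trans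
  by_cases! h : 0 ≤ r - n
  · have : r - n ≤ k := by simpa using hk₁.trans (by simp)
    rw [← Real.rpow_natCast]
    exact (Real.rpow_le_rpow (by positivity) (by simp) h).trans
      (Real.rpow_le_rpow_of_exponent_le (by simp) this)
  have h : 0 < n - r := by grind
  have hnN : (n : ℝ) ≤ N := by exact_mod_cast hn
  calc
    _ = x ^ (-(n - r)) := by
      rw [neg_sub, abs_of_pos hx'']
    _ ≤ (2 : ℝ) ^ (n - r) := by
      rw [Real.rpow_neg_eq_inv_rpow]
      refine Real.rpow_le_rpow (by positivity) ?_ h.le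
      rw [inv_le_comm₀ hx'' (by norm_num)]
      linarith
    _ = Real.exp (Real.log 2 * (n - r)) := by
      rw [Real.rpow_def_of_pos]
      norm_num
    _ ≤ Real.exp (Real.log (3 / 2) * k) := by
      gcongr 1
      apply le_trans _ hk₂
      gcongr
    _ ≤ (3 / 2) ^ k := by
      rw [← Real.rpow_natCast, Real.rpow_def_of_pos]
      norm_num
    _ ≤ _ := by
      gcongr
      rw [abs_of_pos hx'']
      linarith

/-- The even part of the symbol of `Λ₊`, squared. -/
def evenSq (ζ : SpaceTime) : ℝ :=
  (1 + ‖ζ‖ ^ 2 + (1 + 2 * ‖ζ‖ ^ 2 + (2 * ζ 0 ^ 2 - ‖ζ‖ ^ 2) ^ 2) ^ (1 / 2 : ℝ)) / 2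

lemma norm_sq_spaceTime (ζ : SpaceTime) : ‖ζ‖ ^ 2 = ζ 0 ^ 2 + ‖spt ζ‖ ^ 2 := by
  rw [EuclideanSpace.norm_sq_eq, EuclideanSpace.norm_sq_eq, Fin.sum_univ_succ]
  simp [spt]

lemma one_le_evenSq (ζ : SpaceTime) : 1 ≤ evenSq ζ := by
  unfold evenSq
  have : 1 ≤ (1 + 2 * ‖ζ‖ ^ 2 + (2 * ζ 0 ^ 2 - ‖ζ‖ ^ 2) ^ 2) ^ (1 / 2 : ℝ) :=
    Real.one_le_rpow (by nlinarith [sq_nonneg ‖ζ‖, sq_nonneg (2 * ζ 0 ^ 2 - ‖ζ‖ ^ 2)])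
      (by norm_num)
  nlinarith [sq_nonneg ‖ζ‖]

lemma hasTemperateGrowth_coord (i : Fin 4) : (fun ζ : SpaceTime => ζ i).HasTemperateGrowth :=
  (EuclideanSpace.proj (𝕜 := ℝ) i : SpaceTime →L[ℝ] ℝ).hasTemperateGrowth

lemma hasTemperateGrowth_evenSq : evenSq.HasTemperateGrowth := by
  have h0 := hasTemperateGrowth_coord 0
  have h1 : (fun ζ : SpaceTime => 1 + 2 * ‖ζ‖ ^ 2 + (2 * ζ 0 ^ 2 - ‖ζ‖ ^ 2) ^ 2).HasTemperateGrowth := by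
    fun_prop
  have h2 := hasTemperateGrowth_rpow_of_one_le h1 (fun ζ => by
    nlinarith [sq_nonneg ‖ζ‖, sq_nonneg (2 * ζ 0 ^ 2 - ‖ζ‖ ^ 2)]) (1 / 2)
  unfold evenSq
  simp only [div_eq_mul_inv _ (2 : ℝ)]
  fun_prop

lemma pW_eq (ζ : SpaceTime) :
    pW ζ = evenSq ζ ^ (1 / 2 : ℝ) + |ζ 0| * ‖spt ζ‖ * evenSq ζ ^ (-(1 / 2) : ℝ) := by
  have hE := one_le_evenSq ζ
  set a := |ζ 0|
  set b := ‖spt ζ‖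
  have ha : 0 ≤ a := abs_nonneg _
  have hb : 0 ≤ b := norm_nonneg _
  set e := Real.sqrt (evenSq ζ) with he
  have he1 : 1 ≤ e := by rw [he, Real.one_le_sqrt]; exact hE
  have hep : 0 < e := by linarith
  have he2 : e ^ 2 = evenSq ζ := Real.sq_sqrt (by linarith)
  rw [Real.rpow_neg (by linarith), ← Real.sqrt_eq_rpow, ← he]
  have hk : (2 * e ^ 2 - (1 + a ^ 2 + b ^ 2)) ^ 2 = (1 + a ^ 2 + b ^ 2) ^ 2 - 4 * (a * b) ^ 2 := by
    have h2 : 2 * e ^ 2 - (1 + a ^ 2 + b ^ 2) =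
        Real.sqrt (1 + 2 * ‖ζ‖ ^ 2 + (2 * ζ 0 ^ 2 - ‖ζ‖ ^ 2) ^ 2) := by
      rw [he2, Real.sqrt_eq_rpow, evenSq, norm_sq_spaceTime, ← sq_abs (ζ 0)]
      ring
    rw [h2, Real.sq_sqrt (by positivity), norm_sq_spaceTime, ← sq_abs (ζ 0)]
    ring
  have hm : (e + a * b * e⁻¹) ^ 2 = 1 + (a + b) ^ 2 := by
    have h3 : e ^ 4 + (a * b) ^ 2 = (1 + a ^ 2 + b ^ 2) * e ^ 2 := by nlinarith
    field_simp
    nlinarith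
  unfold pW jap
  rw [← hm, Real.sqrt_sq (by positivity)]

lemma one_sub_cos_nonneg (x : ℝ) : 0 ≤ 1 - Real.cos x := by linarith [Real.cos_le_one x]

lemma one_sub_cos_le (x : ℝ) : 1 - Real.cos x ≤ 2 * min 1 (x ^ 2) := by
  rw [mul_min_of_nonneg _ _ (by norm_num)]
  exact le_min (by linarith [Real.neg_one_le_cos x])
    (by nlinarith [Real.one_sub_sq_div_two_le_cos (x := x), sq_nonneg x])

section Homogeneous

variable {E : Type*} [NormedAddCommGroup E] [InnerProductSpace ℝ E]

/-- The Lévy density `‖y‖ ^ (-d-1)`. -/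
def levyW (y : E) : ℝ := (‖y‖ ^ (Module.finrank ℝ E + 1))⁻¹

lemma levyW_nonneg (y : E) : 0 ≤ levyW y := by unfold levyW; positivity

lemma one_sub_cos_inner_le (y z : E) :
    1 - Real.cos (2 * Real.pi * ⟪y, z⟫) ≤
      2 * (1 + (2 * Real.pi) ^ 2 * ‖z‖ ^ 2) * min 1 (‖y‖ ^ 2) := by
  refine (one_sub_cos_le _).trans ?_
  rw [mul_assoc (2 : ℝ) (1 + _) (min _ _)]
  refine mul_le_mul_of_nonneg_left ?_ (by norm_num)
  have h0 : 0 ≤ 1 + (2 * Real.pi) ^ 2 * ‖z‖ ^ 2 := by positivity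
  rw [mul_min_of_nonneg _ _ h0]
  have h1 : 0 ≤ (2 * Real.pi) ^ 2 * ‖z‖ ^ 2 := by positivity
  refine min_le_min (by linarith) ?_
  have h2 : ⟪y, z⟫ ^ 2 ≤ ‖y‖ ^ 2 * ‖z‖ ^ 2 := by
    rw [← mul_pow, ← sq_abs]
    exact pow_le_pow_left₀ (abs_nonneg _) (abs_real_inner_le_norm y z) 2
  have h3 : (0 : ℝ) ≤ (2 * Real.pi) ^ 2 := by positivity
  nlinarith [mul_le_mul_of_nonneg_left h2 h3, sq_nonneg ‖y‖]

variable [MeasurableSpace E] [BorelSpace E]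

@[fun_prop] lemma measurable_levyW : Measurable (levyW : E → ℝ) := by
  unfold levyW
  fun_prop

variable [FiniteDimensional ℝ E]

lemma integrable_min_mul_levyW [Nontrivial E] :
    Integrable fun y : E => min 1 (‖y‖ ^ 2) * levyW y := by
  have hd : 0 < Module.finrank ℝ E := Module.finrank_pos
  have h : ∀ y ∈ Set.Ioi (0 : ℝ), y ^ (Module.finrank ℝ E - 1) •
      (min 1 (y ^ 2) * (y ^ (Module.finrank ℝ E + 1))⁻¹) = min (y ^ (-2 : ℝ)) 1 := by
    intro y hy
    have hy' : 0 < y := hy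
    obtain ⟨k, hk⟩ := Nat.exists_eq_succ_of_ne_zero hd.ne'
    rw [hk, Real.rpow_neg hy'.le, Real.rpow_two]
    simp only [Nat.succ_eq_add_one, Nat.add_sub_cancel, smul_eq_mul]
    have e : y ^ k * (min 1 (y ^ 2) * (y ^ (k + 1 + 1))⁻¹) = min 1 (y ^ 2) * (y ^ 2)⁻¹ := by
      have h2 : y ^ (k + 1 + 1) = y ^ k * y ^ 2 := by ring
      rw [h2]
      field_simp
    rw [e, min_mul_of_nonneg _ _ (by positivity), one_mul, mul_inv_cancel₀ (by positivity)]
  have := integrable_fun_norm_addHaar (E := E) volume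
    (f := fun y : ℝ => min 1 (y ^ 2) * (y ^ (Module.finrank ℝ E + 1))⁻¹)
  unfold levyW
  rw [this, integrableOn_congr_fun h measurableSet_Ioi, ← Set.Ioc_union_Ioi_eq_Ioi zero_le_one]
  refine IntegrableOn.union ?_ ?_
  · refine Measure.integrableOn_of_bounded (M := 1) (by simp) (by fun_prop) ?_
    refine Filter.Eventually.of_forall fun y => ?_
    rw [Real.norm_eq_abs, abs_le]
    refine ⟨?_, min_le_right _ _⟩
    by_cases hy : y ^ (-2 : ℝ) ≤ 1
    · rw [min_eq_left hy, Real.rpow_neg_ofNat]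
      have : 0 ≤ y ^ (-2 : ℤ) := by rw [zpow_neg]; positivity
      linarith
    · rw [min_eq_right (not_le.1 hy).le]; norm_num
  · refine Integrable.mono' (integrableOn_Ioi_rpow_of_lt (by norm_num : (-2 : ℝ) < -1) one_pos)
      (by fun_prop) ?_
    filter_upwards [ae_restrict_mem measurableSet_Ioi] with y hy
    have hy' : 0 < y := lt_trans one_pos hy
    rw [Real.norm_eq_abs, abs_of_nonneg (by positivity)]
    exact min_le_left _ _

lemma integrable_levy [Nontrivial E] (z : E) :
    Integrable fun y : E => (1 - Real.cos (2 * Real.pi * ⟪y, z⟫)) * levyW y := by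
  refine Integrable.mono' (integrable_min_mul_levyW.const_mul
    (2 * (1 + (2 * Real.pi) ^ 2 * ‖z‖ ^ 2))) (by fun_prop) ?_
  refine Filter.Eventually.of_forall fun y => ?_
  rw [Real.norm_eq_abs, abs_of_nonneg (mul_nonneg (one_sub_cos_nonneg _) (levyW_nonneg y)),
    ← mul_assoc]
  exact mul_le_mul_of_nonneg_right (one_sub_cos_inner_le y z) (levyW_nonneg y)

/-- The Lévy–Khintchine integral of the norm. -/
def levyInt (z : E) : ℝ := ∫ y : E, (1 - Real.cos (2 * Real.pi * ⟪y, z⟫)) * levyW y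

lemma levyInt_map (A : E ≃ₗᵢ[ℝ] E) (z : E) : levyInt (A z) = levyInt z := by
  unfold levyInt
  rw [← A.measurePreserving.integral_comp A.toHomeomorph.measurableEmbedding]
  simp [levyW]

lemma levyInt_smul {t : ℝ} (ht : 0 < t) (z : E) : levyInt (t • z) = t * levyInt z := by
  unfold levyInt
  have h := Measure.integral_comp_smul_of_nonneg (volume : Measure E)
    (fun y : E => (1 - Real.cos (2 * Real.pi * ⟪y, z⟫)) * levyW y) t (hR := ht.le)
  have h2 : ∀ y : E, (1 - Real.cos (2 * Real.pi * ⟪t • y, z⟫)) * levyW (t • y) =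
      (t ^ (Module.finrank ℝ E + 1))⁻¹ *
        ((1 - Real.cos (2 * Real.pi * ⟪y, t • z⟫)) * levyW y) := by
    intro y
    rw [inner_smul_left, inner_smul_right, levyW, levyW, norm_smul, Real.norm_eq_abs,
      abs_of_pos ht, mul_pow, mul_inv]
    simp only [conj_trivial]
    ring
  simp only [h2] at h
  rw [integral_const_mul, smul_eq_mul] at h
  have h3 : (t ^ (Module.finrank ℝ E + 1)) ≠ 0 := by positivity
  have h4 : (t ^ (Module.finrank ℝ E)) ≠ 0 := by positivity
  field_simp at h
  rw [pow_succ] at h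
  apply mul_left_cancel₀ h4
  linarith

lemma levyInt_pos [Nontrivial E] {z : E} (hz : z ≠ 0) : 0 < levyInt z := by
  unfold levyInt
  rw [integral_pos_iff_support_of_nonneg
    (fun y => mul_nonneg (one_sub_cos_nonneg _) (levyW_nonneg y)) (integrable_levy z)]
  have hz2 : 0 < ⟪z, z⟫ := real_inner_self_pos.2 hz
  have hopen : IsOpen {y : E | 0 < ⟪y, z⟫ ∧ ⟪y, z⟫ < 1} :=
    isOpen_Ioo.preimage (f := fun y : E => ⟪y, z⟫) (by fun_prop)
  refine lt_of_lt_of_le (hopen.measure_pos volume ⟨(2 * ⟪z, z⟫)⁻¹ • z, ?_, ?_⟩)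
    (measure_mono fun y hy => ?_)
  · rw [inner_smul_left]; simp only [conj_trivial]; positivity
  · rw [inner_smul_left]; simp only [conj_trivial]
    rw [mul_inv, mul_assoc, inv_mul_cancel₀ hz2.ne']; norm_num
  · have hy0 : y ≠ 0 := by rintro rfl; simp at hy
    refine mul_ne_zero ?_ (by unfold levyW; positivity)
    intro h
    have h1 : Real.cos (2 * Real.pi * ⟪y, z⟫) = 1 := by linarith
    rw [Real.cos_eq_one_iff] at h1
    obtain ⟨k, hk⟩ := h1
    have h2 : (k : ℝ) = ⟪y, z⟫ := by
      have := Real.pi_pos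
      apply mul_right_cancel₀ (b := 2 * Real.pi) (by positivity)
      linarith
    have h3 : (0 : ℝ) < k ∧ (k : ℝ) < 1 := by rw [h2]; exact hy
    have h4 : 0 < k := by exact_mod_cast h3.1
    have h5 : k < 1 := by exact_mod_cast h3.2
    omega

variable (E) in
lemma exists_norm_eq_levyInt [Nontrivial E] : ∃ c : ℝ, ∀ z : E, ‖z‖ = c * levyInt z := by
  obtain ⟨e, he⟩ := exists_ne (0 : E)
  have hep := norm_pos_iff.2 he
  refine ⟨‖e‖ / levyInt e, fun z => ?_⟩
  by_cases hz : z = 0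
  · simp [hz, levyInt]
  have hzp := norm_pos_iff.2 hz
  set w : E := (‖e‖ / ‖z‖) • z
  have hw : ‖w‖ = ‖e‖ := by
    rw [norm_smul, Real.norm_eq_abs, abs_of_pos (by positivity)]
    field_simp
  have h1 : levyInt e = levyInt w := by
    rw [← levyInt_map ((ℝ ∙ (w - e))ᗮ.reflection) w]
    congr 1
    exact (Submodule.reflection_sub hw).symm
  rw [h1, levyInt_smul (by positivity)]
  have := (levyInt_pos hz).ne'
  field_simp

end Homogeneous

section Wiener

variable {F : Type*} [NormedAddCommGroup F] [NormedSpace ℂ F]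

/-- The `L¹` norm of the inverse Fourier transform. -/
def wienerE (f : SpaceTime → F) : ℝ≥0∞ := ∫⁻ x, ‖𝓕⁻ f x‖ₑ

lemma wienerE_average {Ω : Type*} [MeasurableSpace Ω] (ν : Measure Ω) [SFinite ν]
    {k : Ω → SpaceTime → ℂ} {f : SpaceTime → F}
    (hm : StronglyMeasurable (Function.uncurry fun ω ζ => k ω ζ • f ζ))
    (hi : Integrable (Function.uncurry fun ω ζ => k ω ζ • f ζ) (ν.prod volume)) :
    wienerE (fun ζ => (∫ ω, k ω ζ ∂ν) • f ζ) ≤ ∫⁻ ω, wienerE (fun ζ => k ω ζ • f ζ) ∂ν := by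
  by_cases hF : CompleteSpace F
  swap
  · simp [wienerE, Real.fourierInv_eq', integral, hF]
  have he : Continuous fun p : SpaceTime × SpaceTime =>
      Complex.exp (((2 * Real.pi * ⟪p.1, p.2⟫ : ℝ) : ℂ) * Complex.I) := by fun_prop
  have hn : ∀ x ζ : SpaceTime, ‖Complex.exp (((2 * Real.pi * ⟪ζ, x⟫ : ℝ) : ℂ) * Complex.I)‖ = 1 :=
    fun x ζ => Complex.norm_exp_ofReal_mul_I _
  have h1 : ∀ x, 𝓕⁻ (fun ζ => (∫ ω, k ω ζ ∂ν) • f ζ) x =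
      ∫ ω, 𝓕⁻ (fun ζ => k ω ζ • f ζ) x ∂ν := by
    intro x
    simp only [Real.fourierInv_eq']
    rw [integral_integral_swap]
    · refine integral_congr_ae (Filter.Eventually.of_forall fun ζ => ?_)
      simp only
      rw [← integral_smul_const, ← integral_smul]
    · refine (integrable_norm_iff ?_).1 ?_
      · refine AEStronglyMeasurable.smul (f := fun p : Ω × SpaceTime => Complex.exp
          (((2 * Real.pi * ⟪p.2, x⟫ : ℝ) : ℂ) * Complex.I)) ?_ hm.aestronglyMeasurable
        exact (by fun_prop : Measurable fun p : Ω × SpaceTime => Complex.exp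
          (((2 * Real.pi * ⟪p.2, x⟫ : ℝ) : ℂ) * Complex.I)).aestronglyMeasurable
      · refine hi.norm.congr (Filter.Eventually.of_forall fun p => ?_)
        simp only [Function.uncurry]
        rw [norm_smul (Complex.exp _), hn, one_mul]
  unfold wienerE
  rw [lintegral_lintegral_swap]
  · refine lintegral_mono fun x => ?_
    rw [h1]
    exact enorm_integral_le_lintegral_enorm _
  · refine StronglyMeasurable.aestronglyMeasurable ?_ |>.enorm
    simp only [Real.fourierInv_eq']
    refine StronglyMeasurable.integral_prod_right (f := fun p : Ω × SpaceTime => fun ζ =>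
      Complex.exp (((2 * Real.pi * ⟪ζ, p.2⟫ : ℝ) : ℂ) * Complex.I) • k p.1 ζ • f ζ) ?_
    refine StronglyMeasurable.smul (f := fun p : (Ω × SpaceTime) × SpaceTime => Complex.exp
      (((2 * Real.pi * ⟪p.2, p.1.2⟫ : ℝ) : ℂ) * Complex.I)) ?_ ?_
    · exact (by fun_prop : Measurable fun p : (Ω × SpaceTime) × SpaceTime => Complex.exp
        (((2 * Real.pi * ⟪p.2, p.1.2⟫ : ℝ) : ℂ) * Complex.I)).stronglyMeasurable
    · exact hm.comp_measurable (g := fun p : (Ω × SpaceTime) × SpaceTime => (p.1.1, p.2))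
        (by fun_prop)

/-- The plane wave `ζ ↦ exp (2πi⟪h,ζ⟫)`. -/
def pwave (h ζ : SpaceTime) : ℂ := Complex.exp (((2 * Real.pi * ⟪h, ζ⟫ : ℝ) : ℂ) * Complex.I)

@[fun_prop] lemma continuous_pwave (h : SpaceTime) : Continuous (pwave h) := by
  unfold pwave
  fun_prop

@[simp] lemma norm_pwave (h ζ : SpaceTime) : ‖pwave h ζ‖ = 1 := Complex.norm_exp_ofReal_mul_I _

lemma wienerE_pwave (h : SpaceTime) (f : SpaceTime → F) :
    wienerE (fun ζ => pwave h ζ • f ζ) = wienerE f := by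
  have h1 : ∀ x, 𝓕⁻ (fun ζ => pwave h ζ • f ζ) x = 𝓕⁻ f (x + h) := by
    intro x
    simp only [Real.fourierInv_eq', pwave, smul_smul, ← Complex.exp_add]
    congr 1
    ext ζ
    congr 2
    rw [inner_add_right, real_inner_comm h ζ]
    push_cast
    ring
  unfold wienerE
  simp only [h1]
  exact lintegral_add_right_eq_self (fun x => ‖𝓕⁻ f x‖ₑ) h

lemma wienerE_const_smul (c : ℂ) (f : SpaceTime → F) :
    wienerE (fun ζ => c • f ζ) = ‖c‖ₑ * wienerE f := by
  have h1 : ∀ x, 𝓕⁻ (fun ζ => c • f ζ) x = c • 𝓕⁻ f x := by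
    intro x
    simp only [Real.fourierInv_eq', smul_comm _ c]
    rw [integral_smul]
  unfold wienerE
  simp only [h1, enorm_smul]
  rw [lintegral_const_mul' _ _ (by simp)]

lemma integrable_smul_of_norm_le {k : SpaceTime → ℂ} (hk : Measurable k) {f : SpaceTime → F}
    (hf : Integrable f) (C : ℝ) (hC : ∀ ζ, ‖k ζ‖ ≤ C) : Integrable fun ζ => k ζ • f ζ := by
  refine Integrable.mono' (hf.norm.const_mul C) (hk.aestronglyMeasurable.smul hf.1) ?_
  refine Filter.Eventually.of_forall fun ζ => ?_
  rw [norm_smul]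
  exact mul_le_mul_of_nonneg_right (hC ζ) (norm_nonneg _)

lemma integrable_pwave_smul (h : SpaceTime) {f : SpaceTime → F} (hf : Integrable f) :
    Integrable fun ζ => pwave h ζ • f ζ :=
  integrable_smul_of_norm_le (by fun_prop) hf 1 fun ζ => by simp

lemma fourierInv_eq_pwave (f : SpaceTime → F) (x : SpaceTime) :
    𝓕⁻ f x = ∫ ζ, pwave x ζ • f ζ := by
  simp only [Real.fourierInv_eq', pwave, real_inner_comm]

lemma continuous_fourierInv {f : SpaceTime → F} (hf : Integrable f) : Continuous (𝓕⁻ f) := by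
  have h : 𝓕⁻ f = fun x => ∫ ζ, pwave x ζ • f ζ := funext fun x => fourierInv_eq_pwave f x
  rw [h]
  refine continuous_of_dominated (fun x => (integrable_pwave_smul x hf).1)
    (fun x => Filter.Eventually.of_forall fun ζ => ?_) hf.norm
    (Filter.Eventually.of_forall fun ζ => ?_)
  · rw [norm_smul, norm_pwave, one_mul]
  · unfold pwave
    fun_prop

lemma wienerE_add_le {f g : SpaceTime → F} (hf : Integrable f) (hg : Integrable g) :
    wienerE (fun ζ => f ζ + g ζ) ≤ wienerE f + wienerE g := by
  unfold wienerE
  rw [← lintegral_add_left' (continuous_fourierInv hf).aestronglyMeasurable.enorm]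
  refine lintegral_mono fun x => ?_
  simp only [fourierInv_eq_pwave, smul_add]
  rw [integral_add (integrable_pwave_smul x hf) (integrable_pwave_smul x hg)]
  exact enorm_add_le _ _

lemma wienerE_sum_le {ι : Type*} (s : Finset ι) {f : ι → SpaceTime → F}
    (hf : ∀ i, Integrable (f i)) :
    wienerE (fun ζ => ∑ i ∈ s, f i ζ) ≤ ∑ i ∈ s, wienerE (f i) := by
  classical
  induction s using Finset.induction_on with
  | empty => simp [wienerE, Real.fourierInv_eq']
  | insert a s ha ih =>
    simp only [Finset.sum_insert ha]
    exact (wienerE_add_le (hf a) (integrable_finsetSum s fun i _ => hf i)).trans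
      (add_le_add_right ih _)

lemma wienerE_pwave_sub_one_le (h : SpaceTime) {f : SpaceTime → F} (hf : Integrable f) :
    wienerE (fun ζ => (pwave h ζ - 1) • f ζ) ≤ 2 * wienerE f := by
  have h1 : (fun ζ => (pwave h ζ - 1) • f ζ) =
      fun ζ => pwave h ζ • f ζ + (-1 : ℂ) • f ζ := by
    ext ζ
    rw [sub_smul, one_smul, neg_smul, one_smul, sub_eq_add_neg]
  rw [h1]
  refine (wienerE_add_le (integrable_pwave_smul h hf) (hf.smul (-1 : ℂ))).trans ?_
  have h2 := wienerE_const_smul (-1) f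
  rw [enorm_neg, enorm_one, one_mul] at h2
  rw [wienerE_pwave, two_mul]
  exact add_le_add_right h2.le _

lemma pwave_smul_eq (s : ℝ) (h ζ : SpaceTime) :
    pwave (s • h) ζ = Complex.exp ((2 * Real.pi * ⟪h, ζ⟫ : ℝ) * Complex.I * s) := by
  unfold pwave
  rw [inner_smul_left]
  simp only [conj_trivial]
  push_cast
  ring_nf

lemma pwave_sub_one_eq (h ζ : SpaceTime) :
    pwave h ζ - 1 = (∫ s in Set.Ioc (0 : ℝ) 1, (2 * Real.pi * Complex.I) * pwave (s • h) ζ) *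
      (⟪h, ζ⟫ : ℝ) := by
  rw [← intervalIntegral.integral_of_le zero_le_one, intervalIntegral.integral_const_mul]
  simp only [pwave_smul_eq]
  by_cases hx : ⟪h, ζ⟫ = 0
  · simp [pwave, hx]
  have hc : (((2 * Real.pi * ⟪h, ζ⟫ : ℝ) : ℂ) * Complex.I) ≠ 0 :=
    mul_ne_zero (by exact_mod_cast mul_ne_zero Real.two_pi_pos.ne' hx) Complex.I_ne_zero
  rw [integral_exp_mul_complex hc, pwave]
  simp only [Complex.ofReal_one, mul_one, Complex.ofReal_zero, mul_zero, Complex.exp_zero]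
  have hx' : ((⟪h, ζ⟫ : ℝ) : ℂ) ≠ 0 := by exact_mod_cast hx
  have hpi : (Real.pi : ℂ) ≠ 0 := by exact_mod_cast Real.pi_ne_zero
  have hI := Complex.I_ne_zero
  push_cast
  field_simp

lemma wienerE_pwave_sub_one_le' (h : SpaceTime) {f : SpaceTime → F} (hm : StronglyMeasurable f)
    (hf : Integrable fun ζ => ((⟪h, ζ⟫ : ℝ) : ℂ) • f ζ) :
    wienerE (fun ζ => (pwave h ζ - 1) • f ζ) ≤
      ENNReal.ofReal (2 * Real.pi) * wienerE (fun ζ => ((⟪h, ζ⟫ : ℝ) : ℂ) • f ζ) := by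
  have hk : Measurable fun p : ℝ × SpaceTime => (2 * Real.pi * Complex.I) * pwave (p.1 • h) p.2 := by
    unfold pwave
    fun_prop
  have hg : StronglyMeasurable fun ζ : SpaceTime => ((⟪h, ζ⟫ : ℝ) : ℂ) • f ζ :=
    (by fun_prop : Measurable fun ζ : SpaceTime => ((⟪h, ζ⟫ : ℝ) : ℂ)).stronglyMeasurable.smul hm
  have hkg : StronglyMeasurable (Function.uncurry fun (s : ℝ) (ζ : SpaceTime) =>
      ((2 * Real.pi * Complex.I) * pwave (s • h) ζ) • (((⟪h, ζ⟫ : ℝ) : ℂ) • f ζ)) :=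
    hk.stronglyMeasurable.smul (hg.comp_measurable measurable_snd)
  have h1 := wienerE_average (volume.restrict (Set.Ioc (0 : ℝ) 1))
    (k := fun s ζ => (2 * Real.pi * Complex.I) * pwave (s • h) ζ)
    (f := fun ζ => ((⟪h, ζ⟫ : ℝ) : ℂ) • f ζ) hkg (by
      refine Integrable.mono' ((integrable_const (2 * Real.pi)).mul_prod hf.norm)
        hkg.aestronglyMeasurable (Filter.Eventually.of_forall fun p => ?_)
      simp only [Function.uncurry]
      rw [norm_smul, norm_mul, norm_pwave, mul_one]
      refine le_of_eq ?_
      simp [abs_of_pos Real.pi_pos])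
  have h2 : (fun ζ => (pwave h ζ - 1) • f ζ) = fun ζ =>
      (∫ s in Set.Ioc (0 : ℝ) 1, (2 * Real.pi * Complex.I) * pwave (s • h) ζ) •
        (((⟪h, ζ⟫ : ℝ) : ℂ) • f ζ) := by
    ext ζ
    rw [pwave_sub_one_eq, smul_smul]
  rw [h2]
  refine h1.trans (le_of_eq ?_)
  have h3 : ∀ s : ℝ, wienerE (fun ζ => ((2 * Real.pi * Complex.I) * pwave (s • h) ζ) •
      (((⟪h, ζ⟫ : ℝ) : ℂ) • f ζ)) = ‖(2 * Real.pi * Complex.I : ℂ)‖ₑ *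
        wienerE (fun ζ => ((⟪h, ζ⟫ : ℝ) : ℂ) • f ζ) := by
    intro s
    rw [← wienerE_pwave (s • h) (fun ζ => ((⟪h, ζ⟫ : ℝ) : ℂ) • f ζ), ← wienerE_const_smul]
    congr 1
    ext ζ
    exact mul_smul _ _ _
  simp only [h3]
  rw [setLIntegral_const]
  simp only [Real.volume_Ioc, sub_zero, ENNReal.ofReal_one, mul_one]
  congr 1
  rw [← ofReal_norm]
  simp [abs_of_pos Real.pi_pos]

lemma one_sub_cos_eq (h ζ : SpaceTime) : ((1 - Real.cos (2 * Real.pi * ⟪h, ζ⟫) : ℝ) : ℂ) =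
    (-(1 / 2) : ℂ) * (pwave (-h) ζ * ((pwave h ζ - 1) * (pwave h ζ - 1))) := by
  have h1 : pwave (-h) ζ * pwave h ζ = 1 := by
    unfold pwave
    rw [← Complex.exp_add, inner_neg_left]
    simp
  have h2 : ((Real.cos (2 * Real.pi * ⟪h, ζ⟫) : ℝ) : ℂ) = (pwave h ζ + pwave (-h) ζ) / 2 := by
    rw [Complex.ofReal_cos, Complex.cos, pwave, pwave, inner_neg_left]
    push_cast
    ring_nf
  rw [Complex.ofReal_sub, h2, Complex.ofReal_one]
  linear_combination (1 / 2 * pwave h ζ - 1) * h1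

lemma wienerE_one_sub_cos (h : SpaceTime) (f : SpaceTime → F) :
    wienerE (fun ζ => ((1 - Real.cos (2 * Real.pi * ⟪h, ζ⟫) : ℝ) : ℂ) • f ζ) ≤
      wienerE fun ζ => (pwave h ζ - 1) • (pwave h ζ - 1) • f ζ := by
  simp only [one_sub_cos_eq, mul_smul]
  rw [wienerE_const_smul, wienerE_pwave]
  conv_rhs => rw [← one_mul (wienerE _)]
  refine mul_le_mul_left ?_ _
  rw [← ofReal_norm, ← ENNReal.ofReal_one]
  refine ENNReal.ofReal_le_ofReal ?_
  norm_num

lemma wienerE_one_sub_cos_le (h : SpaceTime) {f : SpaceTime → F} (hf : Integrable f) :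
    wienerE (fun ζ => ((1 - Real.cos (2 * Real.pi * ⟪h, ζ⟫) : ℝ) : ℂ) • f ζ) ≤
      4 * wienerE f := by
  refine (wienerE_one_sub_cos h f).trans ?_
  have h1 : Integrable fun ζ => (pwave h ζ - 1) • f ζ :=
    integrable_smul_of_norm_le (by fun_prop) hf 2 fun ζ =>
      (norm_sub_le _ _).trans (by rw [norm_pwave, norm_one]; norm_num)
  refine (wienerE_pwave_sub_one_le h h1).trans ?_
  refine (mul_le_mul_right (wienerE_pwave_sub_one_le h hf) 2).trans (le_of_eq ?_)
  rw [← mul_assoc]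
  norm_num

lemma wienerE_one_sub_cos_le' (h : SpaceTime) {f : SpaceTime → F} (hm : StronglyMeasurable f)
    (hf : Integrable fun ζ => ((⟪h, ζ⟫ : ℝ) : ℂ) • f ζ)
    (hf' : Integrable fun ζ => ((⟪h, ζ⟫ : ℝ) : ℂ) • ((⟪h, ζ⟫ : ℝ) : ℂ) • f ζ) :
    wienerE (fun ζ => ((1 - Real.cos (2 * Real.pi * ⟪h, ζ⟫) : ℝ) : ℂ) • f ζ) ≤
      ENNReal.ofReal (2 * Real.pi) ^ 2 *
        wienerE (fun ζ => ((⟪h, ζ⟫ : ℝ) : ℂ) • ((⟪h, ζ⟫ : ℝ) : ℂ) • f ζ) := by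
  refine (wienerE_one_sub_cos h f).trans ?_
  have hp : Measurable fun ζ => pwave h ζ - 1 := by fun_prop
  have hc : (fun ζ => ((⟪h, ζ⟫ : ℝ) : ℂ) • (pwave h ζ - 1) • f ζ) =
      fun ζ => (pwave h ζ - 1) • ((⟪h, ζ⟫ : ℝ) : ℂ) • f ζ :=
    funext fun ζ => smul_comm _ _ _
  have hx : Measurable fun ζ : SpaceTime => ((⟪h, ζ⟫ : ℝ) : ℂ) := by fun_prop
  have h1 := wienerE_pwave_sub_one_le' h (f := fun ζ => (pwave h ζ - 1) • f ζ)
    (hp.stronglyMeasurable.smul hm) (by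
      rw [hc]
      exact integrable_smul_of_norm_le hp hf 2 fun ζ =>
        (norm_sub_le _ _).trans (by rw [norm_pwave, norm_one]; norm_num))
  have h2 := wienerE_pwave_sub_one_le' h (hx.stronglyMeasurable.smul hm) hf'
  rw [hc] at h1
  refine h1.trans ((mul_le_mul_right h2 _).trans (le_of_eq ?_))
  rw [← mul_assoc, sq]
  rfl

lemma wienerE_inner_smul_inner_smul_le (h : SpaceTime) {f : SpaceTime → F}
    (hf : ∀ i j : Fin 4, Integrable fun ζ : SpaceTime => (ζ i : ℂ) • (ζ j : ℂ) • f ζ) :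
    wienerE (fun ζ => ((⟪h, ζ⟫ : ℝ) : ℂ) • ((⟪h, ζ⟫ : ℝ) : ℂ) • f ζ) ≤
      ENNReal.ofReal (‖h‖ ^ 2) *
        ∑ p : Fin 4 × Fin 4, wienerE fun ζ => (ζ p.1 : ℂ) • (ζ p.2 : ℂ) • f ζ := by
  have h1 : (fun ζ : SpaceTime => ((⟪h, ζ⟫ : ℝ) : ℂ) • ((⟪h, ζ⟫ : ℝ) : ℂ) • f ζ) = fun ζ =>
      ∑ p : Fin 4 × Fin 4, ((h p.1 * h p.2 : ℝ) : ℂ) • ((ζ p.1 : ℂ) • (ζ p.2 : ℂ) • f ζ) := by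
    ext ζ
    simp only [smul_smul, ← Finset.sum_smul]
    congr 1
    norm_cast
    rw [PiLp.inner_apply, Fintype.sum_mul_sum, ← Finset.univ_product_univ, Finset.sum_product]
    refine Finset.sum_congr rfl fun i _ => Finset.sum_congr rfl fun j _ => ?_
    simp only [RCLike.inner_apply, conj_trivial]
    ring
  rw [h1, Finset.mul_sum]
  have h2 : ∀ p : Fin 4 × Fin 4, Integrable fun ζ : SpaceTime =>
      ((h p.1 * h p.2 : ℝ) : ℂ) • ((ζ p.1 : ℂ) • (ζ p.2 : ℂ) • f ζ) := fun p =>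
    Integrable.smul ((h p.1 * h p.2 : ℝ) : ℂ) (hf p.1 p.2)
  refine (wienerE_sum_le _ h2).trans (Finset.sum_le_sum fun p _ => ?_)
  refine (wienerE_const_smul _ _).le.trans (mul_le_mul_left ?_ _)
  rw [← ofReal_norm]
  refine ENNReal.ofReal_le_ofReal ?_
  rw [Complex.norm_real, norm_mul, sq]
  exact mul_le_mul (PiLp.norm_apply_le h _) (PiLp.norm_apply_le h _) (norm_nonneg _) (norm_nonneg _)

/-- Integrability of two moments of `f`, and integrability of the inverse Fourier transforms of
`f` and of its products with two coordinates. -/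
structure WienerReg (f : SpaceTime → F) : Prop where
  stronglyMeasurable : StronglyMeasurable f
  integrable : Integrable fun ζ => (1 + ‖ζ‖ ^ 2) * ‖f ζ‖
  wienerE_ne_top : wienerE f ≠ ∞
  wienerE_coord_ne_top : ∀ i j : Fin 4, (wienerE fun ζ => (ζ i : ℂ) • (ζ j : ℂ) • f ζ) ≠ ∞

lemma WienerReg.integrable_smul {f : SpaceTime → F} (hf : WienerReg f) {k : SpaceTime → ℂ}
    (hk : Measurable k) (C : ℝ) (hC : ∀ ζ, ‖k ζ‖ ≤ C * (1 + ‖ζ‖ ^ 2)) :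
    Integrable fun ζ => k ζ • f ζ := by
  refine Integrable.mono' (hf.integrable.const_mul C)
    (hk.stronglyMeasurable.smul hf.stronglyMeasurable).aestronglyMeasurable
    (Filter.Eventually.of_forall fun ζ => ?_)
  rw [norm_smul, ← mul_assoc]
  exact mul_le_mul_of_nonneg_right (hC ζ) (norm_nonneg _)

lemma WienerReg.integrable_coord {f : SpaceTime → F} (hf : WienerReg f) (i j : Fin 4) :
    Integrable fun ζ : SpaceTime => (ζ i : ℂ) • (ζ j : ℂ) • f ζ := by
  simp only [smul_smul]
  refine hf.integrable_smul (by fun_prop) 1 fun ζ => ?_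
  rw [norm_mul, Complex.norm_real, Complex.norm_real]
  have := mul_le_mul (PiLp.norm_apply_le ζ i) (PiLp.norm_apply_le ζ j) (norm_nonneg _)
    (norm_nonneg _)
  nlinarith

lemma WienerReg.wienerE_one_sub_cos_le {f : SpaceTime → F} (hf : WienerReg f) :
    ∃ M : ℝ≥0∞, M ≠ ∞ ∧ ∀ h : SpaceTime,
      wienerE (fun ζ => ((1 - Real.cos (2 * Real.pi * ⟪h, ζ⟫) : ℝ) : ℂ) • f ζ) ≤
        ENNReal.ofReal (min 1 (‖h‖ ^ 2)) * M := by
  set S := ∑ p : Fin 4 × Fin 4, wienerE fun ζ => (ζ p.1 : ℂ) • (ζ p.2 : ℂ) • f ζ with hS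
  have hS' : S ≠ ∞ := (ENNReal.sum_lt_top.2 fun p _ => (hf.wienerE_coord_ne_top _ _).lt_top).ne
  refine ⟨4 * wienerE f + ENNReal.ofReal (2 * Real.pi) ^ 2 * S, ?_, fun h => ?_⟩
  · exact ENNReal.add_ne_top.2 ⟨ENNReal.mul_ne_top (by simp) hf.wienerE_ne_top,
      ENNReal.mul_ne_top (ENNReal.pow_ne_top ENNReal.ofReal_ne_top) hS'⟩
  rcases le_total 1 (‖h‖ ^ 2) with h1 | h1
  · rw [min_eq_left h1, ENNReal.ofReal_one, one_mul]
    refine (_root_.wienerE_one_sub_cos_le h ?_).trans le_self_add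
    simpa using hf.integrable_smul (k := fun _ => 1) (by fun_prop) 1 fun ζ => by
      rw [norm_one]; nlinarith [norm_nonneg ζ]
  · rw [min_eq_right h1]
    have hi1 : ∀ ζ : SpaceTime, ‖((⟪h, ζ⟫ : ℝ) : ℂ)‖ ≤ ‖h‖ * ‖ζ‖ := fun ζ => by
      rw [Complex.norm_real]; exact norm_inner_le_norm _ _
    have h2 := wienerE_one_sub_cos_le' h hf.stronglyMeasurable
      (hf.integrable_smul (by fun_prop) ‖h‖ fun ζ => (hi1 ζ).trans
        (mul_le_mul_of_nonneg_left (by nlinarith [sq_nonneg (‖ζ‖ - 1)]) (norm_nonneg _)))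
      (by
        simp only [smul_smul]
        refine hf.integrable_smul (by fun_prop) (‖h‖ ^ 2) fun ζ => ?_
        rw [norm_mul]
        have := mul_le_mul (hi1 ζ) (hi1 ζ) (norm_nonneg _) (by positivity)
        nlinarith [sq_nonneg ‖h‖])
    refine h2.trans ?_
    refine (mul_le_mul_right (wienerE_inner_smul_inner_smul_le h hf.integrable_coord) _).trans ?_
    rw [← hS, mul_left_comm]
    exact mul_le_mul_right le_add_self _

lemma WienerReg.wienerE_average_ne_top {f : SpaceTime → F} (hf : WienerReg f) {Ω : Type*}
    [MeasurableSpace Ω] (ν : Measure Ω) [SFinite ν] {h : Ω → SpaceTime} (hh : Measurable h)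
    {w : Ω → ℝ} (hw : Measurable w) (hw0 : ∀ ω, 0 ≤ w ω)
    (hi : Integrable (fun ω => min 1 (‖h ω‖ ^ 2) * w ω) ν) :
    (wienerE fun ζ => (∫ ω, (((1 - Real.cos (2 * Real.pi * ⟪h ω, ζ⟫)) * w ω : ℝ) : ℂ) ∂ν) • f ζ)
      ≠ ∞ := by
  obtain ⟨M, hM, hb⟩ := hf.wienerE_one_sub_cos_le
  have hk : Measurable fun p : Ω × SpaceTime =>
      (((1 - Real.cos (2 * Real.pi * ⟪h p.1, p.2⟫)) * w p.1 : ℝ) : ℂ) := by fun_prop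
  have hs : StronglyMeasurable (Function.uncurry fun (ω : Ω) (ζ : SpaceTime) =>
      (((1 - Real.cos (2 * Real.pi * ⟪h ω, ζ⟫)) * w ω : ℝ) : ℂ) • f ζ) :=
    hk.stronglyMeasurable.smul (hf.stronglyMeasurable.comp_measurable measurable_snd)
  have h1 := wienerE_average ν hs (by
    refine Integrable.mono' ((hi.mul_prod hf.integrable).const_mul (2 * (1 + (2 * Real.pi) ^ 2)))
      hs.aestronglyMeasurable (Filter.Eventually.of_forall fun p => ?_)
    simp only [Function.uncurry]
    rw [norm_smul, Complex.norm_real, norm_mul, Real.norm_eq_abs, Real.norm_eq_abs,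
      abs_of_nonneg (hw0 _), abs_of_nonneg (one_sub_cos_nonneg _)]
    have h2 := one_sub_cos_inner_le (h p.1) p.2
    have h3 : 2 * (1 + (2 * Real.pi) ^ 2 * ‖p.2‖ ^ 2) * min 1 (‖h p.1‖ ^ 2) ≤
        2 * (1 + (2 * Real.pi) ^ 2) * (1 + ‖p.2‖ ^ 2) * min 1 (‖h p.1‖ ^ 2) := by
      refine mul_le_mul_of_nonneg_right ?_ (le_min zero_le_one (sq_nonneg _))
      nlinarith [sq_nonneg (2 * Real.pi), sq_nonneg ‖p.2‖]
    calc _ ≤ 2 * (1 + (2 * Real.pi) ^ 2) * (1 + ‖p.2‖ ^ 2) * min 1 (‖h p.1‖ ^ 2) * w p.1 *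
          ‖f p.2‖ := mul_le_mul_of_nonneg_right
            (mul_le_mul_of_nonneg_right (h2.trans h3) (hw0 _)) (norm_nonneg _)
      _ = _ := by ring)
  refine ne_top_of_le_ne_top ?_ h1
  have h4 : ∀ ω, wienerE (fun ζ => (((1 - Real.cos (2 * Real.pi * ⟪h ω, ζ⟫)) * w ω : ℝ) : ℂ) • f ζ)
      ≤ ENNReal.ofReal (min 1 (‖h ω‖ ^ 2) * w ω) * M := by
    intro ω
    have h5 : (fun ζ => (((1 - Real.cos (2 * Real.pi * ⟪h ω, ζ⟫)) * w ω : ℝ) : ℂ) • f ζ) =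
        fun ζ => (w ω : ℂ) • ((1 - Real.cos (2 * Real.pi * ⟪h ω, ζ⟫) : ℝ) : ℂ) • f ζ := by
      ext ζ
      rw [smul_smul, mul_comm, Complex.ofReal_mul]
    rw [h5]
    refine (wienerE_const_smul (w ω : ℂ) (fun ζ =>
      ((1 - Real.cos (2 * Real.pi * ⟪h ω, ζ⟫) : ℝ) : ℂ) • f ζ)).le.trans ?_
    rw [mul_comm (min _ _), ENNReal.ofReal_mul (hw0 _), mul_assoc, ← ofReal_norm, Complex.norm_real,
      Real.norm_eq_abs, abs_of_nonneg (hw0 _)]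
    exact mul_le_mul_right (hb _) _
  refine ne_top_of_le_ne_top ?_ (lintegral_mono h4)
  rw [lintegral_mul_const' _ _ hM]
  exact ENNReal.mul_ne_top hi.lintegral_lt_top.ne hM

lemma WienerReg.wienerE_norm_smul_ne_top {f : SpaceTime → F} (hf : WienerReg f) {E : Type*}
    [NormedAddCommGroup E] [InnerProductSpace ℝ E] [FiniteDimensional ℝ E] [MeasurableSpace E]
    [BorelSpace E] [Nontrivial E] {L : E → SpaceTime} {P : SpaceTime → E} (hL : Measurable L)
    (hn : ∀ y, ‖L y‖ = ‖y‖) (hP : ∀ y ζ, ⟪L y, ζ⟫ = ⟪y, P ζ⟫) :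
    (wienerE fun ζ => (‖P ζ‖ : ℂ) • f ζ) ≠ ∞ := by
  obtain ⟨c, hc⟩ := exists_norm_eq_levyInt E
  have h1 := hf.wienerE_average_ne_top (volume : Measure E) hL measurable_levyW levyW_nonneg
    (by simpa only [hn] using integrable_min_mul_levyW)
  have h2 : (fun ζ => (‖P ζ‖ : ℂ) • f ζ) = fun ζ => (c : ℂ) •
      ((∫ y, (((1 - Real.cos (2 * Real.pi * ⟪L y, ζ⟫)) * levyW y : ℝ) : ℂ)) • f ζ) := by
    ext ζ
    rw [smul_smul, integral_complex_ofReal, ← Complex.ofReal_mul]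
    simp only [hP]
    rw [hc (P ζ), levyInt]
  rw [h2]
  refine ne_of_eq_of_ne (wienerE_const_smul _ _) (ENNReal.mul_ne_top (by simp) h1)

end Wiener

section Symbols

variable {F : Type*} [NormedAddCommGroup F] [NormedSpace ℂ F]

lemma exists_schwartz_smul {g : SpaceTime → ℝ} (hg : g.HasTemperateGrowth)
    (ψ : SchwartzMap SpaceTime F) :
    ∃ φ : SchwartzMap SpaceTime F, ∀ ζ, φ ζ = (g ζ : ℂ) • ψ ζ := by
  have hg' : (fun ζ => (g ζ : ℂ)).HasTemperateGrowth := by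
    exact Function.HasTemperateGrowth.comp (Complex.ofRealCLM).hasTemperateGrowth hg
  exact ⟨SchwartzMap.smulLeftCLM F (fun ζ => (g ζ : ℂ)) ψ, fun ζ =>
    SchwartzMap.smulLeftCLM_apply_apply hg' ψ ζ⟩

lemma wienerReg_schwartz (ψ : SchwartzMap SpaceTime F) : WienerReg ψ := by
  have h1 : ∀ φ : SchwartzMap SpaceTime F, wienerE φ ≠ ∞ := by
    intro φ
    have h := (𝓕⁻ φ).integrable (μ := volume)
    rw [SchwartzMap.fourierInv_coe] at h
    exact h.hasFiniteIntegral.ne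
  refine ⟨ψ.continuous.stronglyMeasurable, ?_, h1 ψ, fun i j => ?_⟩
  · refine ((ψ.integrable_pow_mul volume 0).add (ψ.integrable_pow_mul volume 2)).congr
      (Filter.Eventually.of_forall fun ζ => ?_)
    simp only [Pi.add_apply]
    ring
  · obtain ⟨φ, hφ⟩ := exists_schwartz_smul (hasTemperateGrowth_coord j) ψ
    obtain ⟨χ, hχ⟩ := exists_schwartz_smul (hasTemperateGrowth_coord i) φ
    have := h1 χ
    rwa [show (χ : SpaceTime → F) = fun ζ => (ζ i : ℂ) • (ζ j : ℂ) • ψ ζ from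
      funext fun ζ => by rw [hχ, hφ]] at this

lemma norm_stpt (t : ℝ) (x : Space) : ‖stpt t x‖ ^ 2 = t ^ 2 + ‖x‖ ^ 2 := by
  rw [norm_sq_spaceTime]
  simp

lemma inner_spaceTime (η θ : SpaceTime) : ⟪η, θ⟫ = η 0 * θ 0 + ⟪spt η, spt θ⟫ := by
  rw [PiLp.inner_apply, PiLp.inner_apply, Fin.sum_univ_succ]
  simp [spt, mul_comm]

lemma WienerReg.wienerE_time_smul_ne_top {f : SpaceTime → F} (hf : WienerReg f) :
    (wienerE fun ζ => ((|ζ 0| : ℝ) : ℂ) • f ζ) ≠ ∞ := by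
  refine hf.wienerE_norm_smul_ne_top (E := ℝ) (L := fun y => stpt y 0) (P := fun ζ => ζ 0)
    (by fun_prop) (fun y => ?_) fun y ζ => ?_
  · rw [← sq_eq_sq₀ (norm_nonneg _) (norm_nonneg _), norm_stpt]
    simp
  · rw [inner_spaceTime]
    simp [mul_comm]

lemma WienerReg.wienerE_space_smul_ne_top {f : SpaceTime → F} (hf : WienerReg f) :
    (wienerE fun ζ => (‖spt ζ‖ : ℂ) • f ζ) ≠ ∞ := by
  refine hf.wienerE_norm_smul_ne_top (E := Space) (L := fun y => stpt 0 y) (P := spt)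
    (by fun_prop) (fun y => ?_) fun y ζ => ?_
  · rw [← sq_eq_sq₀ (norm_nonneg _) (norm_nonneg _), norm_stpt]
    simp
  · rw [inner_spaceTime]
    simp

lemma wienerReg_abs_time_smul (ψ : SchwartzMap SpaceTime F) :
    WienerReg fun ζ => ((|ζ 0| : ℝ) : ℂ) • ψ ζ := by
  refine ⟨?_, ?_, (wienerReg_schwartz ψ).wienerE_time_smul_ne_top, fun i j => ?_⟩
  · exact (by fun_prop : Continuous fun ζ : SpaceTime =>
      ((|ζ 0| : ℝ) : ℂ) • ψ ζ).stronglyMeasurable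
  · obtain ⟨φ, hφ⟩ := exists_schwartz_smul (hasTemperateGrowth_coord 0) ψ
    have := (wienerReg_schwartz φ).integrable
    simpa only [hφ, norm_smul, Complex.norm_real, norm_abs_eq_norm] using this
  · obtain ⟨φ, hφ⟩ := exists_schwartz_smul (hasTemperateGrowth_coord j) ψ
    obtain ⟨χ, hχ⟩ := exists_schwartz_smul (hasTemperateGrowth_coord i) φ
    have := (wienerReg_schwartz χ).wienerE_time_smul_ne_top
    convert this using 3 with ζ
    rw [hχ, hφ, smul_comm _ ((|ζ 0| : ℝ) : ℂ), smul_comm _ ((|ζ 0| : ℝ) : ℂ)]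

lemma norm_spt_le (ζ : SpaceTime) : ‖spt ζ‖ ≤ ‖ζ‖ := by
  have := norm_sq_spaceTime ζ
  exact abs_le_of_sq_le_sq' (by nlinarith [sq_nonneg (ζ 0)]) (norm_nonneg _) |>.2

lemma wienerE_pW_smul_ne_top (ψ : SchwartzMap SpaceTime F) :
    (wienerE fun ζ => (pW ζ : ℂ) • ψ ζ) ≠ ∞ ∧ Integrable fun ζ => (pW ζ : ℂ) • ψ ζ := by
  obtain ⟨φ, hφ⟩ := exists_schwartz_smul
    (hasTemperateGrowth_rpow_of_one_le hasTemperateGrowth_evenSq one_le_evenSq (1 / 2)) ψ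
  obtain ⟨χ, hχ⟩ := exists_schwartz_smul
    (hasTemperateGrowth_rpow_of_one_le hasTemperateGrowth_evenSq one_le_evenSq (-(1 / 2))) ψ
  have h1 : (fun ζ => (pW ζ : ℂ) • ψ ζ) =
      fun ζ => φ ζ + (‖spt ζ‖ : ℂ) • ((|ζ 0| : ℝ) : ℂ) • χ ζ := by
    ext ζ
    rw [hφ, hχ, smul_smul, smul_smul, ← add_smul, pW_eq]
    congr 1
    push_cast
    ring
  have hr := wienerReg_abs_time_smul χ
  have hi : Integrable fun ζ => (‖spt ζ‖ : ℂ) • ((|ζ 0| : ℝ) : ℂ) • χ ζ :=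
    hr.integrable_smul (by fun_prop) 1 fun ζ => by
      rw [Complex.norm_real, norm_norm]
      nlinarith [norm_spt_le ζ, sq_nonneg (‖ζ‖ - 1)]
  rw [h1]
  refine ⟨?_, φ.integrable.add hi⟩
  exact ne_top_of_le_ne_top (ENNReal.add_ne_top.2
    ⟨(wienerReg_schwartz φ).wienerE_ne_top, hr.wienerE_space_smul_ne_top⟩)
    (wienerE_add_le φ.integrable hi)

lemma FT_FTinv_of_wienerE [CompleteSpace F] {f : SpaceTime → F} (hc : Continuous f)
    (hi : Integrable f) (hw : wienerE f ≠ ∞) : FT (FTinv f) = f := by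
  have h : Integrable (𝓕⁻ f) := ⟨(continuous_fourierInv hi).aestronglyMeasurable, hw.lt_top⟩
  refine hc.fourier_fourierInv_eq hi (h.comp_neg.congr (Filter.Eventually.of_forall fun x => ?_))
  simp only [Real.fourierInv_eq_fourier_neg, neg_neg]

lemma FT_LamPlus_one [CompleteSpace F] (A : SchwartzMap SpaceTime F) :
    FT (LamPlus 1 A) = fun ζ => (pW ζ : ℂ) • (𝓕 A) ζ := by
  have h := wienerE_pW_smul_ne_top (𝓕 A)
  have h1 : LamPlus 1 (A : SpaceTime → F) = FTinv fun ζ => (pW ζ : ℂ) • (𝓕 A) ζ := by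
    unfold LamPlus rmult mult
    simp only [Real.rpow_one]
    rfl
  rw [h1]
  exact FT_FTinv_of_wienerE (by fun_prop) h.2 h.1

end Symbols

section Norms

variable {F : Type*} [NormedAddCommGroup F] [NormedSpace ℂ F]

lemma rpow_le_pW_rpow_abs {x : ℝ} {ζ : SpaceTime} (h1 : 1 ≤ x) (h2 : x ≤ pW ζ) (a : ℝ) :
    x ^ a ≤ pW ζ ^ |a| :=
  (Real.rpow_le_rpow_of_exponent_le h1 (le_abs_self a)).trans
    (Real.rpow_le_rpow (by linarith) h2 (abs_nonneg a))

lemma exists_nat_mul_le_pW_pow (a b : ℝ) : ∃ N : ℕ, ∀ ζ, nW ζ ^ a * dW ζ ^ b * pW ζ ≤ pW ζ ^ N := by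
  obtain ⟨N, hN⟩ := exists_nat_ge (|a| + |b| + 1)
  refine ⟨N, fun ζ => ?_⟩
  have hp := one_le_pW ζ
  calc nW ζ ^ a * dW ζ ^ b * pW ζ ≤ pW ζ ^ |a| * pW ζ ^ |b| * pW ζ ^ (1 : ℝ) := by
        rw [Real.rpow_one]
        have h1 := rpow_le_pW_rpow_abs (one_le_nW ζ) (nW_le_pW ζ) a
        have h2 := rpow_le_pW_rpow_abs (one_le_dW ζ) (dW_le_pW ζ) b
        have := Real.rpow_nonneg (dW_pos ζ).le b
        gcongr
    _ = pW ζ ^ (|a| + |b| + 1) := by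
        rw [Real.rpow_add (pW_pos ζ), Real.rpow_add (pW_pos ζ)]
    _ ≤ pW ζ ^ (N : ℝ) := Real.rpow_le_rpow_of_exponent_le hp hN
    _ = pW ζ ^ N := Real.rpow_natCast _ _

lemma pW_sq_le (ζ : SpaceTime) : pW ζ ^ 2 ≤ 2 * (1 + ‖ζ‖ ^ 2) := by
  have h := norm_sq_spaceTime ζ
  unfold pW
  rw [jap_sq]
  nlinarith [sq_nonneg (|ζ 0| - ‖spt ζ‖), sq_abs (ζ 0)]

lemma integrable_weight_sq {w : SpaceTime → ℝ} (hw : Measurable w) (h0 : ∀ ζ, 0 ≤ w ζ) {N : ℕ}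
    (hN : ∀ ζ, w ζ ≤ pW ζ ^ N) (ψ : SchwartzMap SpaceTime F) :
    Integrable fun ζ => (w ζ * ‖ψ ζ‖) ^ 2 := by
  have hg : (fun ζ : SpaceTime => (2 * (1 + ‖ζ‖ ^ 2)) ^ N).HasTemperateGrowth := by fun_prop
  obtain ⟨φ, hφ⟩ := exists_schwartz_smul hg ψ
  refine Integrable.mono' ((φ.memLp 2 volume).integrable_norm_pow two_ne_zero) ?_
    (Filter.Eventually.of_forall fun ζ => ?_)
  · exact ((hw.mul ψ.continuous.norm.measurable).pow_const 2).aestronglyMeasurable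
  · have h1 : w ζ ≤ (2 * (1 + ‖ζ‖ ^ 2)) ^ N := by
      refine (hN ζ).trans ((pow_le_pow_left₀ (pW_pos ζ).le ?_ N))
      have := one_le_pW ζ
      have := pW_sq_le ζ
      nlinarith
    have h2 : w ζ * ‖ψ ζ‖ ≤ ‖φ ζ‖ := by
      rw [hφ, norm_smul, Complex.norm_real, Real.norm_of_nonneg (by positivity)]
      exact mul_le_mul_of_nonneg_right h1 (norm_nonneg _)
    rw [Real.norm_of_nonneg (sq_nonneg _)]
    have h3 := mul_nonneg (h0 ζ) (norm_nonneg (ψ ζ))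
    simpa using pow_le_pow_left₀ h3 h2 2

lemma wnorm_schwartz {w : SpaceTime → ℝ} (hw : Measurable w) (h0 : ∀ ζ, 0 ≤ w ζ) {N : ℕ}
    (hN : ∀ ζ, w ζ ≤ pW ζ ^ N) (ψ : SchwartzMap SpaceTime F) :
    l2E (fun ζ => ENNReal.ofReal (w ζ * ‖ψ ζ‖)) ≠ ∞ ∧
      wnorm w ψ = (l2E fun ζ => ENNReal.ofReal (w ζ * ‖ψ ζ‖)).toReal := by
  have hi := integrable_weight_sq hw h0 hN ψ
  have h1 : ∫⁻ ζ, ENNReal.ofReal (w ζ * ‖ψ ζ‖) ^ 2 = ∫⁻ ζ, ENNReal.ofReal ((w ζ * ‖ψ ζ‖) ^ 2) :=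
    lintegral_congr fun ζ => (ENNReal.ofReal_pow (mul_nonneg (h0 ζ) (norm_nonneg _)) 2).symm
  unfold l2E wnorm
  rw [h1]
  refine ⟨ENNReal.rpow_ne_top_of_nonneg (by norm_num) hi.lintegral_lt_top.ne, ?_⟩
  rw [integral_eq_lintegral_of_nonneg_ae (Filter.Eventually.of_forall fun ζ => sq_nonneg _) hi.1,
    ENNReal.toReal_rpow]

lemma FsNorm_eq [CompleteSpace F] (ε s : ℝ) (A : SchwartzMap SpaceTime F) :
    l2E (fun ζ => ENNReal.ofReal (fW ε s ζ * ‖(𝓕 A) ζ‖)) ≠ ∞ ∧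
      FsNorm ε s A = (l2E fun ζ => ENNReal.ofReal (fW ε s ζ * ‖(𝓕 A) ζ‖)).toReal := by
  obtain ⟨N, hN⟩ := exists_nat_mul_le_pW_pow (s - 1) (3 / 4 + ε)
  have h := wnorm_schwartz (measurable_fW ε s) (fun ζ => (fW_pos ε s ζ).le) hN (𝓕 A)
  refine ⟨h.1, ?_⟩
  rw [← h.2, FsNorm, HsbNorm, FT_LamPlus_one]
  unfold wnorm
  congr 2
  ext ζ
  rw [norm_smul, Complex.norm_real, Real.norm_of_nonneg (pW_pos ζ).le, ← mul_assoc]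
  rfl

lemma FT_FTinv_eq_or [CompleteSpace F] {f : SpaceTime → F} (hc : Continuous f)
    (hi : Integrable f) : FT (FTinv f) = f ∨ FT (FTinv f) = 0 := by
  by_cases hw : wienerE f = ∞
  · refine Or.inr (funext fun x => ?_)
    have h : ¬ Integrable (FTinv f) := fun h => h.hasFiniteIntegral.ne hw
    have h2 : ¬ Integrable fun v => Real.fourierChar (-⟪v, x⟫) • FTinv f v := by
      intro h3
      refine h ((integrable_norm_iff
        (continuous_fourierInv hi).aestronglyMeasurable).1 (h3.norm.congr ?_))
      exact Filter.Eventually.of_forall fun v => Circle.norm_smul _ _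
    unfold FT
    rw [Real.fourier_eq, integral_undef h2]
    rfl
  · exact Or.inl (FT_FTinv_of_wienerE hc hi hw)

lemma FT_rmult_eq_or [CompleteSpace F] {m : SpaceTime → ℝ} (hm : Continuous m)
    {f : SpaceTime → F} {u : SpaceTime → F} (hu : FT u = f ∨ FT u = 0)
    (hc : Continuous f) (hi : Integrable fun ζ => (m ζ : ℂ) • f ζ) :
    FT (rmult m u) = (fun ζ => (m ζ : ℂ) • f ζ) ∨ FT (rmult m u) = 0 := by
  unfold rmult mult
  rcases hu with hu | hu
  · rw [hu]
    exact FT_FTinv_eq_or (by fun_prop) hi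
  · right
    rw [hu]
    ext x
    simp [FT, FTinv, Real.fourier_eq, Real.fourierInv_eq]

lemma GrNorm_le [CompleteSpace F] {ε : ℝ} (hε : ε ≤ 1) (r : ℝ) (Q : SchwartzMap SpaceTime F) :
    l2E (fun ζ => ENNReal.ofReal (gW ε r ζ * ‖(𝓕 Q) ζ‖)) ≠ ∞ ∧
      GrNorm ε r (LamPlus (-1) (LamMinus (ε - 1) Q)) ≤
        (l2E fun ζ => ENNReal.ofReal (gW ε r ζ * ‖(𝓕 Q) ζ‖)).toReal := by
  obtain ⟨N, hN⟩ := exists_nat_mul_le_pW_pow (r - 1) (2 * ε - 1 / 2)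
  have hN' : ∀ ζ, gW ε r ζ ≤ pW ζ ^ N := fun ζ =>
    (le_mul_of_one_le_right (gW_pos ε r ζ).le (one_le_pW ζ)).trans (hN ζ)
  have h := wnorm_schwartz (measurable_gW ε r) (fun ζ => (gW_pos ε r ζ).le) hN' (𝓕 Q)
  refine ⟨h.1, ?_⟩
  rw [← h.2]
  have hd : Continuous fun ζ => dW ζ ^ (ε - 1) :=
    Continuous.rpow_const (by fun_prop) fun ζ => Or.inl (dW_pos ζ).ne'
  have hp : ∀ a : ℝ, Continuous fun ζ => pW ζ ^ a := fun a =>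
    Continuous.rpow_const (by fun_prop) fun ζ => Or.inl (pW_pos ζ).ne'
  have hi : Integrable fun ζ => ((dW ζ ^ (ε - 1) : ℝ) : ℂ) • (𝓕 Q) ζ :=
    integrable_smul_of_norm_le (by fun_prop) (𝓕 Q).integrable 1 fun ζ => by
      rw [Complex.norm_real, Real.norm_of_nonneg (Real.rpow_nonneg (dW_pos ζ).le _)]
      exact Real.rpow_le_one_of_one_le_of_nonpos (one_le_dW ζ) (by linarith)
  have h1 : FT (LamMinus (ε - 1) Q) = (fun ζ => ((dW ζ ^ (ε - 1) : ℝ) : ℂ) • (𝓕 Q) ζ) ∨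
      FT (LamMinus (ε - 1) Q) = 0 :=
    FT_rmult_eq_or hd (Or.inl rfl) (𝓕 Q).continuous hi
  have hi2 : Integrable fun ζ => ((pW ζ ^ (-1 : ℝ) : ℝ) : ℂ) •
      (((dW ζ ^ (ε - 1) : ℝ) : ℂ) • (𝓕 Q) ζ) :=
    integrable_smul_of_norm_le (by fun_prop) hi 1 fun ζ => by
      rw [Complex.norm_real, Real.norm_of_nonneg (Real.rpow_nonneg (pW_pos ζ).le _)]
      exact Real.rpow_le_one_of_one_le_of_nonpos (one_le_pW ζ) (by norm_num)
  have h2 := FT_rmult_eq_or (hp (-1)) h1 (by fun_prop) hi2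
  have hc : (fun ζ => ((pW ζ ^ (1 : ℝ) : ℝ) : ℂ) • (((pW ζ ^ (-1 : ℝ) : ℝ) : ℂ) •
      (((dW ζ ^ (ε - 1) : ℝ) : ℂ) • (𝓕 Q) ζ))) =
      fun ζ => ((dW ζ ^ (ε - 1) : ℝ) : ℂ) • (𝓕 Q) ζ := by
    ext ζ
    rw [smul_smul, ← Complex.ofReal_mul, ← Real.rpow_add (pW_pos ζ)]
    simp
  have h3 := FT_rmult_eq_or (hp 1) h2 (by fun_prop) (by rw [hc]; exact hi)
  rw [hc] at h3
  change wnorm _ (FT (rmult (fun ζ => pW ζ ^ (1 : ℝ))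
    (rmult (fun ζ => pW ζ ^ (-1 : ℝ)) (LamMinus (ε - 1) Q)))) ≤ _
  rcases h3 with h3 | h3
  · rw [h3]
    refine le_of_eq ?_
    unfold wnorm
    congr 2
    ext ζ
    rw [norm_smul, Complex.norm_real, Real.norm_of_nonneg (Real.rpow_nonneg (dW_pos ζ).le _),
      ← mul_assoc]
    congr 2
    change nW ζ ^ (r - 1) * dW ζ ^ (1 / 2 + ε) * dW ζ ^ (ε - 1) = gW ε r ζ
    rw [mul_assoc, ← Real.rpow_add (dW_pos ζ), gW]
    ring_nf
  · rw [h3]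
    have h4 : wnorm (hWt (r - 1) (1 / 2 + ε)) (0 : SpaceTime → F) = 0 := by
      simp [wnorm]
    rw [h4]
    exact Real.rpow_nonneg (integral_nonneg fun ζ => sq_nonneg _) _

end Norms

open scoped LineDeriv

lemma nullQ_eq_sum (η θ : SpaceTime) : nullQ η θ = ∑ μ : Fin 4, mink μ * (η μ * θ μ) := by
  simp [nullQ, spt, PiLp.inner_apply, Fin.sum_univ_succ, mink, mul_comm]
  ring

section Bilinear

variable {F : Type*} [NormedAddCommGroup F] [NormedSpace ℂ F]

lemma fourier_pairing_apply [CompleteSpace F] (B : F →L[ℂ] F →L[ℂ] F)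
    (f g : SchwartzMap SpaceTime F) (ζ : SpaceTime) :
    (𝓕 (SchwartzMap.pairing B f g)) ζ = ∫ η, B ((𝓕 f) η) ((𝓕 g) (ζ - η)) := by
  have hneg : ∀ (h : SchwartzMap SpaceTime F) x, (𝓕⁻ h) x = (𝓕 h) (-x) := fun h x => by
    rw [SchwartzMap.fourierInv_coe, SchwartzMap.fourier_coe, Real.fourierInv_eq_fourier_neg]
  have h1 : SchwartzMap.convolution B (𝓕⁻ f) (𝓕⁻ g) = 𝓕⁻ (SchwartzMap.pairing B f g) := by
    simp [SchwartzMap.convolution]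
  have h2 : (𝓕 (SchwartzMap.pairing B f g)) ζ =
      SchwartzMap.convolution B (𝓕⁻ f) (𝓕⁻ g) (-ζ) := by
    rw [h1, hneg, neg_neg]
  rw [h2, SchwartzMap.convolution_apply, MeasureTheory.convolution_def,
    ← integral_neg_eq_self]
  refine integral_congr_ae (Filter.Eventually.of_forall fun η => ?_)
  simp only [hneg]
  congr 2
  · simp
  · abel

lemma integrable_pairing_fourier (B : F →L[ℂ] F →L[ℂ] F)
    (f g : SchwartzMap SpaceTime F) (ζ : SpaceTime) :
    Integrable fun η => B (f η) (g (ζ - η)) := by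
  obtain ⟨C, -, hC⟩ := g.decay 0 0
  refine Integrable.mono' ((f.integrable.norm).const_mul (‖B‖ * C)) ?_
    (Filter.Eventually.of_forall fun η => ?_)
  · exact Continuous.aestronglyMeasurable (by fun_prop)
  · refine (B.le_opNorm₂ _ _).trans ?_
    have : ‖g (ζ - η)‖ ≤ C := by simpa using hC (ζ - η)
    calc _ ≤ ‖B‖ * ‖f η‖ * C := by gcongr
      _ = _ := by ring

/-- The bilinear null form `∑ η^{μμ} B (∂_μ A) (∂_μ A')`. -/
def nullForm (B : F →L[ℂ] F →L[ℂ] F) (A A' : SchwartzMap SpaceTime F) : SchwartzMap SpaceTime F :=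
  ∑ μ : Fin 4, (mink μ : ℂ) • SchwartzMap.pairing B
    (∂_{(EuclideanSpace.single μ 1 : SpaceTime)} A) (∂_{(EuclideanSpace.single μ 1 : SpaceTime)} A')

lemma nullForm_apply (B : F →L[ℂ] F →L[ℂ] F) (A A' : SchwartzMap SpaceTime F) (x : SpaceTime) :
    nullForm B A A' x = ∑ μ : Fin 4, mink μ • B (pd μ A x) (pd μ A' x) := by
  unfold nullForm
  rw [sum_apply]
  refine Finset.sum_congr rfl fun μ _ => ?_
  rw [smul_apply, SchwartzMap.pairing_apply_apply, Complex.coe_smul,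
    SchwartzMap.lineDerivOp_apply_eq_fderiv, SchwartzMap.lineDerivOp_apply_eq_fderiv]
  rfl

lemma fourier_partial_apply (μ : Fin 4) (A : SchwartzMap SpaceTime F) (ζ : SpaceTime) :
    (𝓕 (∂_{(EuclideanSpace.single μ 1 : SpaceTime)} A)) ζ =
      (2 * Real.pi * Complex.I * (ζ μ : ℂ)) • (𝓕 A) ζ := by
  have h : (fun x : SpaceTime => inner ℝ x (EuclideanSpace.single μ 1)).HasTemperateGrowth := by
    fun_prop
  have h2 : (inner ℝ ζ (EuclideanSpace.single μ 1) : ℝ) = ζ μ := by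
    simp [EuclideanSpace.inner_single_right]
  rw [SchwartzMap.fourier_lineDerivOp_eq, smul_apply,
    SchwartzMap.smulLeftCLM_apply_apply h, h2, mul_smul _ (ζ μ : ℂ), Complex.coe_smul]

lemma fourier_nullForm_apply [CompleteSpace F] (B : F →L[ℂ] F →L[ℂ] F)
    (A A' : SchwartzMap SpaceTime F) (ζ : SpaceTime) :
    (𝓕 (nullForm B A A')) ζ =
      ∫ η, (-(4 * Real.pi ^ 2 * nullQ η (ζ - η) : ℝ) : ℂ) • B ((𝓕 A) η) ((𝓕 A') (ζ - η)) := by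
  have h1 : (𝓕 (nullForm B A A')) ζ = ∑ μ : Fin 4, (mink μ : ℂ) •
      (𝓕 (SchwartzMap.pairing B (∂_{(EuclideanSpace.single μ 1 : SpaceTime)} A)
        (∂_{(EuclideanSpace.single μ 1 : SpaceTime)} A'))) ζ := by
    have := map_sum (FourierTransform.fourierCLM ℂ (SchwartzMap SpaceTime F))
      (fun μ : Fin 4 => (mink μ : ℂ) • SchwartzMap.pairing B
        (∂_{(EuclideanSpace.single μ 1 : SpaceTime)} A)
        (∂_{(EuclideanSpace.single μ 1 : SpaceTime)} A')) Finset.univ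
    simp only [map_smul, FourierTransform.fourierCLM_apply] at this
    rw [nullForm, this]
    simp
  rw [h1]
  simp_rw [fourier_pairing_apply, ← integral_smul]
  rw [← integral_finsetSum _ fun μ _ => by
    exact (integrable_pairing_fourier B _ _ ζ).smul (mink μ : ℂ)]
  refine integral_congr_ae (Filter.Eventually.of_forall fun η => ?_)
  simp only [fourier_partial_apply, map_smul, smul_apply, smul_smul,
    ← Finset.sum_smul]
  congr 1
  rw [nullQ_eq_sum]
  push_cast
  rw [Finset.mul_sum, ← Finset.sum_neg_distrib]
  refine Finset.sum_congr rfl fun μ _ => ?_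
  linear_combination (4 * (mink μ : ℂ) * Real.pi ^ 2 * η μ * (ζ - η) μ) * Complex.I_sq

lemma ofReal_norm_fourier_nullForm_le [CompleteSpace F] (B : F →L[ℂ] F →L[ℂ] F)
    (A A' : SchwartzMap SpaceTime F) (ζ : SpaceTime) :
    ENNReal.ofReal ‖(𝓕 (nullForm B A A')) ζ‖ ≤
      ∫⁻ η, ENNReal.ofReal (4 * Real.pi ^ 2 * ‖B‖ *
        (|nullQ η (ζ - η)| * (‖(𝓕 A) η‖ * ‖(𝓕 A') (ζ - η)‖))) := by
  rw [fourier_nullForm_apply, ofReal_norm]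
  refine (enorm_integral_le_lintegral_enorm _).trans (lintegral_mono fun η => ?_)
  rw [← ofReal_norm]
  refine ENNReal.ofReal_le_ofReal ?_
  rw [norm_smul, norm_neg, Complex.norm_real, Real.norm_eq_abs, abs_mul,
    abs_of_nonneg (by positivity : (0 : ℝ) ≤ 4 * Real.pi ^ 2)]
  have := B.le_opNorm₂ ((𝓕 A) η) ((𝓕 A') (ζ - η))
  calc _ ≤ 4 * Real.pi ^ 2 * |nullQ η (ζ - η)| * (‖B‖ * ‖(𝓕 A) η‖ * ‖(𝓕 A') (ζ - η)‖) := by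
        gcongr
    _ = _ := by ring

lemma l2E_nullForm_le [CompleteSpace F] {ε r s : ℝ} (hε : ε ≤ 1)
    (hK : TriBdd fun η θ => ENNReal.ofReal (nullK ε s r η θ)) (B : F →L[ℂ] F →L[ℂ] F) :
    ∃ C : ℝ≥0∞, C ≠ ∞ ∧ ∀ A A' : SchwartzMap SpaceTime F,
      l2E (fun ζ => ENNReal.ofReal (gW ε r ζ * ‖(𝓕 (nullForm B A A')) ζ‖)) ≤
        C * (l2E (fun ζ => ENNReal.ofReal (fW ε s ζ * ‖(𝓕 A) ζ‖)) *
          l2E fun ζ => ENNReal.ofReal (fW ε s ζ * ‖(𝓕 A') ζ‖)) := by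
  obtain ⟨C, hC, h⟩ := hK
  set c₀ : ℝ≥0∞ := ENNReal.ofReal (4 * Real.pi ^ 2 * ‖B‖) with hc₀
  refine ⟨c₀ * C, ENNReal.mul_ne_top ENNReal.ofReal_ne_top hC, fun A A' => ?_⟩
  set a : SpaceTime → ℝ≥0∞ := fun ζ => ENNReal.ofReal (fW ε s ζ * ‖(𝓕 A) ζ‖) with ha
  set b : SpaceTime → ℝ≥0∞ := fun ζ => ENNReal.ofReal (fW ε s ζ * ‖(𝓕 A') ζ‖) with hb
  set c : SpaceTime → ℝ≥0∞ := fun ζ => ENNReal.ofReal (gW ε r ζ * ‖(𝓕 (nullForm B A A')) ζ‖)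
    with hc
  have hn : ∀ f : SchwartzMap SpaceTime F, Measurable fun ζ => ‖f ζ‖ := fun f =>
    f.continuous.norm.measurable
  have hma : Measurable a := ((measurable_fW ε s).mul (hn _)).ennreal_ofReal
  have hmb : Measurable b := ((measurable_fW ε s).mul (hn _)).ennreal_ofReal
  have hmc : Measurable c := ((measurable_gW ε r).mul (hn _)).ennreal_ofReal
  have hKm : Measurable (Function.uncurry fun η θ => ENNReal.ofReal (nullK ε s r η θ)) := by
    unfold nullK Function.uncurry
    have := measurable_nullQ
    unfold Function.uncurry at this
    fun_prop
  have hpt : ∀ ζ, c ζ ≤ c₀ * ∫⁻ η, ENNReal.ofReal (nullK ε s r η (ζ - η)) * (a η * b (ζ - η)) := by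
    intro ζ
    have hg := (gW_pos ε r ζ).le
    rw [hc, ← lintegral_const_mul' c₀ _ ENNReal.ofReal_ne_top]
    simp only
    rw [ENNReal.ofReal_mul hg]
    refine (mul_le_mul_right (ofReal_norm_fourier_nullForm_le B A A' ζ) _).trans ?_
    rw [← lintegral_const_mul' _ _ ENNReal.ofReal_ne_top]
    refine lintegral_mono fun η => le_of_eq ?_
    have h1 := fW_pos ε s η
    have h2 := fW_pos ε s (ζ - η)
    have hk : 0 ≤ nullK ε s r η (ζ - η) := by
      unfold nullK
      have := (gW_pos ε r (η + (ζ - η))).le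
      positivity
    rw [hc₀, ha, hb]
    simp only
    rw [← ENNReal.ofReal_mul hg, ← ENNReal.ofReal_mul (by positivity),
      ← ENNReal.ofReal_mul hk, ← ENNReal.ofReal_mul (by positivity)]
    congr 1
    rw [nullK, add_sub_cancel]
    field_simp
  have hsq : l2E c * l2E c ≤ c₀ * C * (l2E a * l2E b) * l2E c := by
    calc l2E c * l2E c = ∫⁻ ζ, c ζ ^ 2 := by rw [← sq, l2E_sq]
      _ ≤ ∫⁻ ζ, c₀ * ∫⁻ η, ENNReal.ofReal (nullK ε s r η (ζ - η)) *
            (a η * b (ζ - η) * c (η + (ζ - η))) := by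
          refine lintegral_mono fun ζ => ?_
          simp only [add_sub_cancel]
          simp_rw [← mul_assoc _ _ (c ζ)]
          rw [lintegral_mul_const' _ _ ENNReal.ofReal_ne_top, sq, ← mul_assoc]
          exact mul_le_mul_left (hpt ζ) _
      _ = c₀ * ∫⁻ η, ∫⁻ θ, ENNReal.ofReal (nullK ε s r η θ) * (a η * b θ * c (η + θ)) := by
          rw [lintegral_const_mul' _ _ ENNReal.ofReal_ne_top, lintegral_add_change
            (fun η θ => ENNReal.ofReal (nullK ε s r η θ) * (a η * b θ * c (η + θ)))
            (hKm.mul (by fun_prop))]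
      _ ≤ c₀ * (C * (l2E a * l2E b * l2E c)) := mul_le_mul_right (h a b c hma hmb hmc) _
      _ = _ := by ring
  have hct : l2E c ≠ ∞ := (GrNorm_le hε r (nullForm B A A')).1
  rcases eq_or_ne (l2E c) 0 with h0 | h0
  · rw [h0]
    exact zero_le
  · exact (ENNReal.mul_le_mul_iff_left h0 hct).1 hsq

end Bilinear

/-- The matrix commutator as a continuous bilinear map. -/
def commL (n : ℕ) : G n →L[ℂ] G n →L[ℂ] G n :=
  LinearMap.mkContinuous₂ (LinearMap.mk₂ ℂ (mcomm (n := n))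
    (fun X X' Y => by simp only [mcomm, add_mul, mul_add]; abel)
    (fun c X Y => by simp [mcomm, smul_sub])
    (fun X Y Y' => by simp only [mcomm, add_mul, mul_add]; abel)
    (fun c X Y => by simp [mcomm, smul_sub])) 2 fun X Y => by
      change ‖X * Y - Y * X‖ ≤ _
      have h1 := Matrix.frobenius_norm_mul X Y
      have h2 := Matrix.frobenius_norm_mul Y X
      have h3 := norm_sub_le (X * Y) (Y * X)
      linarith

lemma nullForm_commL {n : ℕ} (A A' : SchwartzMap SpaceTime (G n)) :
    ⇑(nullForm (commL n) A A') = Q0c A A' :=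
  funext fun x => nullForm_apply (commL n) A A' x

/-- for `s ≥ r`, `2s - r > 3/2`, `s > 3/4` and sufficiently small `ε > 0`,
`‖Λ₊^{-1}Λ₋^{ε-1}Q₀[A, A']‖_{G^r} ≲ ‖A‖_{F^s} ‖A'‖_{F^s}`, where `Q₀[u,v] = [∂_α u, ∂^α v]`. -/
theorem null_form_Q0_Gr_estimate (s r : ℝ)
    (h1 : s ≥ r) (h2 : 2*s - r > 3/2) (h3 : s > 3/4) :
    ∃ ε₀ > (0:ℝ), ∀ ε : ℝ, 0 < ε → ε < ε₀ →
      ∀ n : ℕ, ∃ C > 0, ∀ A A' : SchwartzMap SpaceTime (G n),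
        GrNorm ε r (LamPlus (-1) (LamMinus (ε-1) (Q0c ⇑A ⇑A')))
          ≤ C * FsNorm ε s ⇑A * FsNorm ε s ⇑A' := by
  refine ⟨min (1 / 10000) (min ((2 * s - r - 3 / 2) / 100) ((s - 3 / 4) / 100)),
    lt_min (by norm_num) (lt_min (by linarith) (by linarith)), fun ε hε hlt n => ?_⟩
  obtain ⟨h4, h5, h6⟩ : ε < 1 / 10000 ∧ ε < (2 * s - r - 3 / 2) / 100 ∧ ε < (s - 3 / 4) / 100 :=
    ⟨hlt.trans_le (min_le_left _ _), hlt.trans_le ((min_le_right _ _).trans (min_le_left _ _)),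
      hlt.trans_le ((min_le_right _ _).trans (min_le_right _ _))⟩
  have : CompleteSpace (G n) := FiniteDimensional.complete ℂ (G n)
  obtain ⟨C, hC, h⟩ := l2E_nullForm_le (by linarith)
    (triBdd_nullK hε h4.le h1 (by linarith) (by linarith) : TriBdd _) (commL n)
  refine ⟨C.toReal + 1, by positivity, fun A A' => ?_⟩
  obtain ⟨hA, hA'⟩ := FsNorm_eq ε s A
  obtain ⟨hB, hB'⟩ := FsNorm_eq ε s A'
  rw [← nullForm_commL, hA', hB']
  refine (GrNorm_le (by linarith) r _).2.trans ?_
  refine (ENNReal.toReal_mono (ENNReal.mul_ne_top hC (ENNReal.mul_ne_top hA hB))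
    (h A A')).trans ?_
  rw [ENNReal.toReal_mul, ENNReal.toReal_mul, ← mul_assoc]
  gcongr
  linarith
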